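/- arXiv:2102.10070 — 7 statements merged into one kernel-verified Lean document; each statement's English description precedes it below -/
import Mathlib

section
/- Let G be an insoluble minimal transitive permutation group of degree n = 2^x·3^y·5^z, where 0 ≤ y ≤ 1 and 0 ≤ z ≤ 1, and set k := y + z. Then there do not exist normal subgroups M₁, L₁, M₂, L₂, …, M_{k+1}, L_{k+1} of G with M₁ ≤ L₁ ≤ M₂ ≤ L₂ ≤ ⋯ ≤ M_{k+1} ≤ L_{k+1} such that every quotient group L_i/M_i (1 ≤ i ≤ k+1) is insoluble. (This is an equivalent formulation of the assertion that G has at most y + z nonabelian chief factors, since each insoluble normal section contains at least one nonabelian chief factor.) -/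
/-- For normal subgroups `M ≤ L` of a group `G` (with `M` normal in `G`, hence in `L`),
this says that the section `L/M` is insoluble. -/
def IsInsolubleSection {G : Type*} [Group G] (M L : Subgroup G) [M.Normal] : Prop :=
  ¬ IsSolvable (L ⧸ M.subgroupOf L)

open Subgroup in
/-- A Sylow `p`-subgroup of a finite group is a supplement to every subgroup of `p`-power index. -/
theorem Sylow.exists_mul_eq_of_index_eq_pow {G : Type*} [Group G] [Finite G] {p : ℕ}
    [Fact p.Prime] (P : Sylow p G) {D : Subgroup G} {a : ℕ} (hD : D.index = p ^ a) (g : G) :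
    ∃ q ∈ P, ∃ d ∈ D, q * d = g := by
  have hstab : MulAction.stabilizer (P : Subgroup G) ((1 : G) : G ⧸ D) =
      D.subgroupOf (P : Subgroup G) := by
    ext q
    rw [MulAction.mem_stabilizer_iff, mem_subgroupOf]
    change (((q : G) * 1 : G) : G ⧸ D) = ((1 : G) : G ⧸ D) ↔ _
    rw [mul_one, eq_comm, QuotientGroup.eq, inv_one, one_mul]
  have hdvd : p ^ a ∣ D.relIndex (P : Subgroup G) := by
    have h₁ := relIndex_inf_mul_relIndex (P : Subgroup G) D ⊤
    have h₂ := relIndex_inf_mul_relIndex D (P : Subgroup G) ⊤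
    simp only [inf_top_eq, relIndex_top_right] at h₁ h₂
    rw [inf_comm, ← h₁, hD] at h₂
    exact ((Nat.Prime.coprime_pow_of_not_dvd Fact.out P.not_dvd_index).symm).dvd_of_dvd_mul_right
      (h₂ ▸ dvd_mul_left _ _)
  have horb : MulAction.orbit (P : Subgroup G) ((1 : G) : G ⧸ D) = Set.univ := by
    apply Set.eq_of_subset_of_ncard_le (Set.subset_univ _) _ Set.finite_univ
    rw [Set.ncard_univ, ← MulAction.index_stabilizer, hstab, ← Subgroup.index, hD]
    exact Nat.le_of_dvd (Nat.pos_of_ne_zero Subgroup.FiniteIndex.index_ne_zero) hdvd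
  obtain ⟨q, hq⟩ : (g : G ⧸ D) ∈ MulAction.orbit (P : Subgroup G) ((1 : G) : G ⧸ D) :=
    horb ▸ Set.mem_univ _
  change (((q : G) * 1 : G) : G ⧸ D) = _ at hq
  rw [mul_one, QuotientGroup.eq] at hq
  exact ⟨q, q.2, _, hq, mul_inv_cancel_left _ _⟩

namespace Subgroup

/-- The second isomorphism theorem for indices, for a normal subgroup `M`. -/
theorem relIndex_sup_of_normal {G : Type*} [Group G] [Finite G] (A M : Subgroup G) [M.Normal] :
    A.relIndex (M ⊔ A) = A.relIndex M := by
  have h₁ := relIndex_inf_mul_relIndex A M (M ⊔ A)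
  have h₂ := relIndex_inf_mul_relIndex M A (M ⊔ A)
  rw [inf_eq_left.mpr le_sup_left, relIndex_sup_left] at h₁
  rw [inf_eq_left.mpr le_sup_right, inf_comm, ← h₁, mul_comm] at h₂
  exact Nat.eq_of_mul_eq_mul_right (Nat.pos_of_ne_zero FiniteIndex.index_ne_zero) h₂

/-- Let `H` be a subgroup of a finite group `G` that has no proper supplement in `G`, and let
`L ≤ M` be normal subgroups of `G`. If `L ⊔ H` has prime power index in `M ⊔ H`, then `M / L` is
solvable. -/
theorem isSolvable_quotient_of_relIndex_eq_pow {G : Type*} [Group G] [Finite G]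
    {H L M : Subgroup G} [L.Normal] [M.Normal]
    (hH : ∀ T : Subgroup G, (∀ g, ∃ t ∈ T, ∃ h ∈ H, t * h = g) → T = ⊤)
    (hLM : L ≤ M) {p a : ℕ} [Fact p.Prime] (hindex : (L ⊔ H).relIndex (M ⊔ H) = p ^ a) :
    Group.IsSolvable (M ⧸ L.subgroupOf M) := by
  obtain ⟨P⟩ : Nonempty (Sylow p M) := inferInstance
  set Q : Subgroup G := (P : Subgroup M).map M.subtype with hQ
  have hindex' : ((L ⊔ H).subgroupOf M).index = p ^ a := by
    rw [← hindex, ← sup_of_le_left hLM, sup_assoc, relIndex_sup_of_normal, sup_of_le_left hLM]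
    rfl
  have hfac (m : G) (hm : m ∈ M) : ∃ q ∈ Q ⊔ L, ∃ h ∈ H, q * h = m := by
    obtain ⟨q, hq, d, hd, hqd⟩ := P.exists_mul_eq_of_index_eq_pow hindex' ⟨m, hm⟩
    obtain ⟨l, hl, h, hh, hlh⟩ := mem_sup_of_normal_left.mp (mem_subgroupOf.mp hd)
    refine ⟨q * l, mul_mem_sup (mem_map_of_mem M.subtype hq) hl, h, hh, ?_⟩
    rw [mul_assoc, hlh]
    exact congrArg Subtype.val hqd
  have htop (T : Subgroup G) (hT : Q ⊔ L ≤ T) (hTM : T ⊔ M = ⊤) : T = ⊤ := by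
    refine hH T fun g ↦ ?_
    obtain ⟨t, ht, m, hm, rfl⟩ := mem_sup_of_normal_right.mp (hTM ▸ mem_top g)
    obtain ⟨q, hq, h, hh, rfl⟩ := hfac m hm
    exact ⟨t * q, mul_mem ht (hT hq), h, hh, mul_assoc _ _ _⟩
  have hnormal : (Q ⊔ L).Normal := by
    rw [← normalizer_eq_top_iff]
    refine htop _ le_normalizer (top_le_iff.mp ?_)
    rw [← P.normalizer_sup_eq_top]
    exact sup_le_sup_right normalizer_le_normalizer_sup_normal M
  set π := QuotientGroup.mk' (Q ⊔ L)
  have hπ : Function.Surjective π := QuotientGroup.mk'_surjective _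
  have hfrattini : M.map π ≤ frattini (G ⧸ (Q ⊔ L)) := by
    refine le_iInf₂ fun T hT ↦ ?_
    by_contra hMT
    have hsup : T ⊔ M.map π = ⊤ := hT.2 _ (left_lt_sup.mpr hMT)
    refine hT.1 (comap_injective hπ (htop _ ?_ ?_))
    · exact (QuotientGroup.ker_mk' (Q ⊔ L)).symm.le.trans (ker_le_comap π T)
    · rw [← comap_map_eq_self (f := π) (H := T.comap π ⊔ M)
        ((ker_le_comap π T).trans le_sup_left), map_sup, map_comap_eq_self_of_surjective hπ, hsup,
        comap_top]
  have := frattini_nilpotent (G := G ⧸ (Q ⊔ L))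
  have := P.isPGroup'.isNilpotent
  have hsolv : Group.IsSolvable (M.map π) :=
    Group.isSolvable_of_isSolvable_injective (inclusion_injective hfrattini)
  let φ : M ⧸ L.subgroupOf M →* G ⧸ (Q ⊔ L) :=
    QuotientGroup.map _ _ M.subtype fun l hl ↦ mem_sup_right (mem_subgroupOf.mp hl)
  have hφ (x) : φ x ∈ M.map π := by
    obtain ⟨m, rfl⟩ := QuotientGroup.mk_surjective x
    exact mem_map_of_mem π m.2
  refine Group.isSolvable_of_ker_le_range
    ((QuotientGroup.mk' (L.subgroupOf M)).comp (P : Subgroup M).subtype)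
    (φ.codRestrict (M.map π) hφ) fun x hx ↦ ?_
  obtain ⟨m, rfl⟩ := QuotientGroup.mk_surjective x
  have hm : ((m : G) : G ⧸ (Q ⊔ L)) = 1 := congrArg Subtype.val hx
  rw [QuotientGroup.eq_one_iff, mem_sup_of_normal_right] at hm
  obtain ⟨_, ⟨q, hq, rfl⟩, l, hl, hql⟩ := hm
  refine ⟨⟨q, hq⟩, QuotientGroup.eq.mpr (mem_subgroupOf.mpr ?_)⟩
  simpa [← hql] using hl

end Subgroup

open ArithmeticFunction in
/-- The number of odd prime factors of `n`, counted with multiplicity. -/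
def Nat.cardOddFactors (n : ℕ) : ℕ :=
  cardFactors (ordCompl[2] n)

namespace Nat

open ArithmeticFunction

theorem cardOddFactors_mul {m n : ℕ} (hm : m ≠ 0) (hn : n ≠ 0) :
    cardOddFactors (m * n) = cardOddFactors m + cardOddFactors n := by
  rw [cardOddFactors, ordCompl_mul,
    cardFactors_mul (ordCompl_pos 2 hm).ne' (ordCompl_pos 2 hn).ne']
  rfl

theorem exists_eq_two_pow_of_cardOddFactors_eq_zero {n : ℕ} (hn : n ≠ 0)
    (h : cardOddFactors n = 0) : ∃ a, n = 2 ^ a := by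
  rw [cardOddFactors, cardFactors_eq_zero_iff_eq_zero_or_one] at h
  refine ⟨n.factorization 2, ?_⟩
  conv_lhs => rw [← ordProj_mul_ordCompl_eq_self n 2,
    h.resolve_left (ordCompl_pos 2 hn).ne', mul_one]

theorem cardOddFactors_two_pow_mul (x y z : ℕ) :
    cardOddFactors (2 ^ x * 3 ^ y * 5 ^ z) = y + z := by
  have h : ¬ 2 ∣ 3 ^ y * 5 ^ z := by
    rw [← even_iff_two_dvd, not_even_iff_odd]
    exact (Odd.pow (by decide)).mul (Odd.pow (by decide))
  rw [cardOddFactors, mul_assoc, ordCompl_pow_mul_of_not_dvd x prime_two h,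
    cardFactors_mul (by positivity) (by positivity), cardFactors_apply_prime_pow prime_three,
    cardFactors_apply_prime_pow prime_five]

end Nat

open Subgroup in
theorem Subgroup.cardOddFactors_index_lt {G : Type*} [Group G] [Finite G] {H L M : Subgroup G}
    [L.Normal] [M.Normal] (hH : ∀ T : Subgroup G, (∀ g, ∃ t ∈ T, ∃ h ∈ H, t * h = g) → T = ⊤)
    (hLM : L ≤ M) (hinsol : IsInsolubleSection L M) :
    (M ⊔ H).index.cardOddFactors < (L ⊔ H).index.cardOddFactors := by
  have hrel : (L ⊔ H).relIndex (M ⊔ H) ≠ 0 := FiniteIndex.index_ne_zero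
  rw [← relIndex_mul_index (sup_le_sup_right hLM H),
    Nat.cardOddFactors_mul hrel FiniteIndex.index_ne_zero]
  refine Nat.lt_add_of_pos_left (Nat.pos_of_ne_zero fun h ↦ hinsol ?_)
  obtain ⟨a, ha⟩ := Nat.exists_eq_two_pow_of_cardOddFactors_eq_zero hrel h
  exact isSolvable_quotient_of_relIndex_eq_pow hH hLM ha

theorem Subgroup.cardOddFactors_index_anti {G : Type*} [Group G] [Finite G] {A B : Subgroup G}
    (h : A ≤ B) : B.index.cardOddFactors ≤ A.index.cardOddFactors := by
  have hrel : A.relIndex B ≠ 0 := FiniteIndex.index_ne_zero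
  rw [← relIndex_mul_index h, Nat.cardOddFactors_mul hrel FiniteIndex.index_ne_zero]
  exact Nat.le_add_left _ _

/-- A point stabilizer in a minimal transitive permutation group has no proper supplement. -/
theorem eq_top_of_forall_exists_mul_stabilizer {Ω : Type*} {G : Subgroup (Equiv.Perm Ω)}
    (htrans : MulAction.IsPretransitive G Ω)
    (hmin : ∀ H : Subgroup (Equiv.Perm Ω), H < G → ¬ MulAction.IsPretransitive H Ω) (ω : Ω)
    (T : Subgroup G) (hT : ∀ g, ∃ t ∈ T, ∃ h ∈ MulAction.stabilizer G ω, t * h = g) : T = ⊤ := by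
  by_contra hne
  have hlt : T.map G.subtype < G := by
    conv_rhs => rw [← G.range_subtype, MonoidHom.range_eq_map]
    exact (Subgroup.map_lt_map_iff_of_injective G.subtype_injective).mpr (lt_top_iff_ne_top.mpr hne)
  refine hmin _ hlt ((MulAction.isPretransitive_iff_base ω).mpr fun α ↦ ?_)
  obtain ⟨g, rfl⟩ := htrans.exists_smul_eq ω α
  obtain ⟨t, ht, h, hh, rfl⟩ := hT g
  refine ⟨⟨t, Subgroup.mem_map_of_mem G.subtype ht⟩, ?_⟩
  rw [mul_smul, MulAction.mem_stabilizer_iff.mp hh]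
  rfl

/-- **Theorem 3.1(i).** An insoluble minimal transitive permutation group of degree
`n = 2^x·3^y·5^z` (`0 ≤ y, z ≤ 1`) has at most `y + z` nonabelian chief factors: there is
no chain `M₁ ≤ L₁ ≤ M₂ ≤ ⋯ ≤ M_{k+1} ≤ L_{k+1}` of normal subgroups (`k = y + z`) all of
whose sections `L_i/M_i` are insoluble. -/
theorem minimal_transitive_at_most_yz_nonabelian_chief_factors
    {Ω : Type*} [Fintype Ω] (G : Subgroup (Equiv.Perm Ω))
    (htrans : MulAction.IsPretransitive G Ω)
    (hmin : ∀ H : Subgroup (Equiv.Perm Ω), H < G → ¬ MulAction.IsPretransitive H Ω)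
    (hinsol : ¬ IsSolvable G)
    (x y z : ℕ) (hy : y ≤ 1) (hz : z ≤ 1)
    (hcard : Fintype.card Ω = 2 ^ x * 3 ^ y * 5 ^ z) :
    ¬ ∃ (M L : Fin (y + z + 1) → Subgroup G)
        (hM : ∀ i, (M i).Normal) (_hL : ∀ i, (L i).Normal),
        (∀ i, M i ≤ L i) ∧
        (∀ i : Fin (y + z), L i.castSucc ≤ M i.succ) ∧
        (∀ i, @IsInsolubleSection _ _ (M i) (L i) (hM i)) := by
  rintro ⟨M, L, hM, hL, hML, hLM, hsec⟩
  have hne : Nonempty Ω := Fintype.card_pos_iff.mp (hcard ▸ by positivity)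
  obtain ⟨ω⟩ := hne
  set H := MulAction.stabilizer G ω
  have hH := eq_top_of_forall_exists_mul_stabilizer htrans hmin ω
  have hindex : H.index.cardOddFactors = y + z := by
    rw [MulAction.index_stabilizer_of_transitive, Nat.card_eq_fintype_card, hcard,
      Nat.cardOddFactors_two_pow_mul]
  have hlt (i) : (L i ⊔ H).index.cardOddFactors < (M i ⊔ H).index.cardOddFactors :=
    Subgroup.cardOddFactors_index_lt hH (hML i) (hsec i)
  have hbound (i : Fin (y + z + 1)) :
      (L i ⊔ H).index.cardOddFactors + i + 1 ≤ y + z := by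
    induction i using Fin.induction with
    | zero =>
      have := hlt 0
      have := Subgroup.cardOddFactors_index_anti (le_sup_right : H ≤ M 0 ⊔ H)
      simp only [Fin.val_zero]
      omega
    | succ i ih =>
      have := hlt i.succ
      have := Subgroup.cardOddFactors_index_anti (sup_le_sup_right (hLM i) H)
      simp only [Fin.val_succ, Fin.val_castSucc] at ih ⊢
      omega
  have := hbound (Fin.last _)
  simp only [Fin.val_last] at this
  omega
end

section
/- Let G be an insoluble minimal transitive permutation group of degree n = 2^x·3^y·5^z, where 0 ≤ y ≤ 1 and 0 ≤ z ≤ 1. Let N be a normal subgroup of G and let W be a minimal normal subgroup of G/N that is not abelian (i.e., W is a nonabelian chief factor of G). If W is isomorphic to a direct product (Alt_m)^e of e ≥ 1 copies of the alternating group Alt_m for some m ≥ 7, then m = 8 or m = 16. -/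
/-- An element of prime power order is conjugate into any subgroup of index prime to that prime. -/
theorem Subgroup.exists_conj_mem_of_not_dvd_index {G : Type*} [Group G] {p : ℕ} [Fact p.Prime]
    (H : Subgroup G) (hp : ¬ p ∣ H.index) (x : G) (hx : IsPGroup p (Subgroup.zpowers x)) :
    ∃ g : G, g * x * g⁻¹ ∈ H := by
  obtain ⟨y, hy⟩ := hx.nonempty_fixed_point_of_prime_not_dvd_card (G ⧸ H) hp
  obtain ⟨g, rfl⟩ := QuotientGroup.mk_surjective y
  have h := hy ⟨x, Subgroup.mem_zpowers x⟩
  refine ⟨g⁻¹, ?_⟩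
  have h2 : ((x * g : G) : G ⧸ H) = (g : G ⧸ H) := h
  rw [eq_comm, QuotientGroup.eq] at h2
  simpa [mul_assoc] using h2

theorem isPGroup_zpowers_of_orderOf_eq {G : Type*} [Group G] {p : ℕ} [Fact p.Prime] {x : G}
    (h : orderOf x = p) : IsPGroup p (Subgroup.zpowers x) :=
  IsPGroup.of_card (n := 1) (by rw [Nat.card_zpowers, h, pow_one])

open Equiv Equiv.Perm in
/-- A permutation supported on at most `q` points and of the same order as a `q`-cycle `c`
with the same support is conjugate to a power of `c`. -/
theorem exists_conj_mem_zpowers_of_isCycle {α : Type*} [Fintype α] [DecidableEq α]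
    (G : Subgroup (Perm α)) {c d : Perm α} {q : ℕ} [Fact q.Prime]
    (hc : c.IsCycle) (hq : c.support.card = q) (hcG : c ∈ G) (hdG : d ∈ G)
    (hd : orderOf d = q) (hds : d.support ⊆ c.support) :
    ∃ h ∈ G, h.support ⊆ c.support ∧ h * d * h⁻¹ ∈ Subgroup.zpowers c := by
  have hqp : q.Prime := Fact.out
  let S := {x // x ∈ c.support}
  let Q : Subgroup (Perm α) := (Perm.ofSubtype (p := fun x => x ∈ c.support)).range
  have hmemQ : ∀ g : Perm α, g ∈ Q ↔ g.support ⊆ c.support := by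
    intro g
    exact mem_range_ofSubtype_iff.trans Iff.rfl
  let K := G ⊓ Q
  have hK : Nat.card K ∣ q.factorial := by
    have h1 : Nat.card K ∣ Nat.card Q := Subgroup.card_dvd_of_le inf_le_right
    have h2 : Nat.card Q ∣ Nat.card (Perm S) := Subgroup.card_range_dvd _
    have h3 : Nat.card (Perm S) = q.factorial := by
      rw [Nat.card_perm, Nat.card_eq_fintype_card, Fintype.card_coe, hq]
    exact h3 ▸ h1.trans h2
  have hcK : c ∈ K := ⟨hcG, (hmemQ c).2 subset_rfl⟩
  have hdK : d ∈ K := ⟨hdG, (hmemQ d).2 hds⟩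
  have hnd : ¬ q ∣ (Subgroup.zpowers (⟨c, hcK⟩ : K)).index := by
    rintro ⟨r, hr⟩
    have h1 := (Subgroup.zpowers (⟨c, hcK⟩ : K)).card_mul_index
    rw [Nat.card_zpowers, Subgroup.orderOf_mk, hc.orderOf, hq, hr] at h1
    have h2 : q * q ∣ q * (q - 1).factorial := by
      rw [Nat.mul_factorial_pred hqp.ne_zero]
      exact (Dvd.intro r (by rw [← h1]; ring)).trans hK
    have h3 := (Nat.mul_dvd_mul_iff_left hqp.pos).1 h2
    have := (hqp.dvd_factorial).1 h3
    have := hqp.pos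
    omega
  obtain ⟨h, hh⟩ := Subgroup.exists_conj_mem_of_not_dvd_index _ hnd (⟨d, hdK⟩ : K)
    (isPGroup_zpowers_of_orderOf_eq (by rw [Subgroup.orderOf_mk, hd]))
  obtain ⟨i, hi⟩ := Subgroup.mem_zpowers_iff.1 hh
  refine ⟨h, h.2.1, (hmemQ _).1 h.2.2, Subgroup.mem_zpowers_iff.2 ⟨i, ?_⟩⟩
  simpa using congrArg Subtype.val hi

open Equiv Equiv.Perm MulAction in
/-- **Jordan's theorem.** A primitive permutation group containing a cycle of prime length `q ≥ 5`
that fixes at least three points contains the alternating group. -/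
theorem alternatingGroup_le_of_isPreprimitive_of_isCycle_mem {α : Type*} [Fintype α]
    [DecidableEq α] {G : Subgroup (Perm α)} (hG : IsPreprimitive G α) {c : Perm α} {q : ℕ}
    (hq : q.Prime) (h5 : 5 ≤ q) (hc : c.IsCycle) (hcq : c.support.card = q) (hcG : c ∈ G)
    (hα : q + 3 ≤ Fintype.card α) : alternatingGroup α ≤ G := by
  have : Fact q.Prime := ⟨hq⟩
  obtain ⟨n, hn⟩ : ∃ n, Fintype.card α = q + (n + 1) := ⟨Fintype.card α - q - 1, by omega⟩
  have hΔ : ((c.support : Set α)ᶜ).ncard = n + 1 := by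
    have := Set.ncard_add_ncard_compl (c.support : Set α)
    rw [Set.ncard_coe_finset, hcq, Nat.card_eq_fintype_card] at this
    omega
  have hprim : IsPreprimitive (fixingSubgroup G ((c.support : Set α)ᶜ))
      (SubMulAction.ofFixingSubgroup G ((c.support : Set α)ᶜ)) := by
    have := isPretransitive_of_isCycle_mem hc hcG
    apply IsPreprimitive.of_prime_card
    have h1 : Nat.card (SubMulAction.ofFixingSubgroup G ((c.support : Set α)ᶜ)) =
        (c.support : Set α).ncard := by
      rw [← Nat.card_coe_set_eq]
      apply Nat.card_congr
      exact Equiv.subtypeEquivRight fun x => by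
        rw [SubMulAction.mem_ofFixingSubgroup_iff]; simp
    rw [h1, Set.ncard_coe_finset, hcq]
    exact hq
  have htr := (hG.isMultiplyPreprimitive hΔ
    (by rw [Nat.card_eq_fintype_card]; omega) hprim).isMultiplyPretransitive
  have htr' : IsMultiplyPretransitive G α (n + 1) :=
    isMultiplyPretransitive_of_le' (n := n + 2) (by omega) (by
      rw [ENat.card_eq_coe_fintype_card]; norm_cast; omega)
  obtain ⟨e⟩ : Nonempty (Fin (n + 1) ≃ ((c.support : Set α)ᶜ : Set α)) := by
    rw [← Nat.card_coe_set_eq] at hΔ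
    exact ⟨(finCongr hΔ.symm).trans (Finite.equivFin _).symm⟩
  have hmem : ∀ x, x ∈ ((c.support : Set α)ᶜ : Set α) ↔ c x = x := by intro x; simp
  -- permutations of the fixed points of `c` are induced by elements normalising `⟨c⟩`
  have key : ∀ π : Perm α, (∀ x, c x = x → c (π x) = π x) →
      ∃ g ∈ G, (∀ x, c x = x → g x = π x) ∧ g * c * g⁻¹ ∈ Subgroup.zpowers c := by
    intro π hπ
    let x : Fin (n + 1) ↪ α := e.toEmbedding.trans (Function.Embedding.subtype _)
    obtain ⟨⟨g, hg⟩, hgx⟩ := htr'.exists_smul_eq x (x.trans π.toEmbedding)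
    have hgπ : ∀ y, c y = y → g y = π y := by
      intro y hy
      have := DFunLike.congr_fun hgx (e.symm ⟨y, (hmem y).2 hy⟩)
      simpa [x, Subgroup.smul_def] using this
    have hds : (g * c * g⁻¹).support ⊆ c.support := by
      have hsub : ∀ y, c y = y → c (g⁻¹ y) = g⁻¹ y := by
        intro y hy
        exact Equiv.Perm.perm_symm_mapsTo_of_mapsTo g (s := {y | c y = y})
          (fun z hz => by rw [hgπ z hz]; exact hπ z hz) hy
      intro y hy
      rw [mem_support] at hy ⊢
      intro h
      apply hy
      rw [Perm.mul_apply, Perm.mul_apply, hsub y h, ← Perm.mul_apply, mul_inv_cancel, Perm.one_apply]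
    obtain ⟨h, hhG, hhs, hh⟩ := exists_conj_mem_zpowers_of_isCycle G hc hcq hcG
      (G.mul_mem (G.mul_mem hg hcG) (G.inv_mem hg))
      (by rw [← hcq, ← hc.orderOf]; exact (MulAut.conj g).orderOf_eq c) hds
    refine ⟨h * g, G.mul_mem hhG hg, fun y hy => ?_, by simpa [mul_assoc] using hh⟩
    rw [Perm.mul_apply, hgπ y hy]
    by_contra h1
    exact (mem_support.1 (hhs (mem_support.2 h1))) (hπ y hy)
  obtain ⟨a, b, d, ha, hb, hd, hab, had, hbd⟩ : ∃ a b d, c a = a ∧ c b = b ∧ c d = d ∧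
      a ≠ b ∧ a ≠ d ∧ b ≠ d := by
    have : 2 < ((c.support : Set α)ᶜ).ncard := by omega
    rw [Set.two_lt_ncard_iff] at this
    obtain ⟨a, b, d, ha, hb, hd, h⟩ := this
    exact ⟨a, b, d, (hmem a).1 ha, (hmem b).1 hb, (hmem d).1 hd, h⟩
  have hswap : ∀ u v, c u = u → c v = v → ∀ x, c x = x → c (swap u v x) = swap u v x := by
    intro u v hu hv x hx
    rw [swap_apply_def]
    split_ifs <;> assumption
  obtain ⟨σ, hσG, hσ, hσc⟩ := key _ (hswap b a hb ha)
  obtain ⟨τ, hτG, hτ, hτc⟩ := key _ (hswap b d hb hd)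
  obtain ⟨i, hi⟩ := Subgroup.mem_zpowers_iff.1 hσc
  obtain ⟨j, hj⟩ := Subgroup.mem_zpowers_iff.1 hτc
  set s := swap b a * swap b d with hs
  have hs3 : s.IsThreeCycle := isThreeCycle_swap_mul_swap_same hab.symm hbd had
  set k := (τ * σ)⁻¹ * (σ * τ) with hk
  have hkG : k ∈ G := G.mul_mem (G.inv_mem (G.mul_mem hτG hσG)) (G.mul_mem hσG hτG)
  have hconj : (σ * τ) * c * (σ * τ)⁻¹ = (τ * σ) * c * (τ * σ)⁻¹ := by
    have h1 : (σ * τ) * c * (σ * τ)⁻¹ = c ^ (i * j) := by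
      rw [show (σ * τ) * c * (σ * τ)⁻¹ = σ * (τ * c * τ⁻¹) * σ⁻¹ by group, ← hj, ← conj_zpow,
        ← hi, zpow_mul]
    have h2 : (τ * σ) * c * (τ * σ)⁻¹ = c ^ (i * j) := by
      rw [show (τ * σ) * c * (τ * σ)⁻¹ = τ * (σ * c * σ⁻¹) * τ⁻¹ by group, ← hi, ← conj_zpow,
        ← hj, mul_comm i, zpow_mul]
    rw [h1, h2]
  have hcomm : Commute k c := by
    have h1 : k * c * k⁻¹ = c := by
      rw [hk, show (τ * σ)⁻¹ * (σ * τ) * c * ((τ * σ)⁻¹ * (σ * τ))⁻¹ =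
        (τ * σ)⁻¹ * ((σ * τ) * c * (σ * τ)⁻¹) * (τ * σ) by group, hconj]
      group
    exact mul_inv_eq_iff_eq_mul.1 h1
  have hsfix : ∀ x, c x = x → c (s x) = s x := fun x hx =>
    hswap b a hb ha _ (hswap b d hb hd x hx)
  have hkΔ : ∀ x, c x = x → k x = (s ^ 2) x := by
    intro x hx
    apply (τ * σ).injective
    have h1 : (τ * σ) (k x) = (σ * τ) x := by rw [hk, ← Perm.mul_apply, mul_inv_cancel_left]
    have h2 : c ((s ^ 2) x) = (s ^ 2) x := by rw [pow_two]; exact hsfix _ (hsfix _ hx)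
    rw [h1, Perm.mul_apply, hτ x hx, hσ _ (hswap b d hb hd x hx), Perm.mul_apply, hσ _ h2,
      hτ _ (hswap b a hb ha _ h2), pow_two, hs]
    simp
  have hkS : ∀ x, c x ≠ x → (k ^ q) x = x := by
    intro x hx
    have hcx : ∀ r : ℕ, k ^ r * c = c * k ^ r := fun r => (hcomm.pow_left r).eq
    have hkx : c (k x) ≠ k x := by
      rw [← Perm.mul_apply, ← hcomm.eq, Perm.mul_apply]
      exact fun h => hx (k.injective h)
    obtain ⟨r, hr⟩ := hc.exists_pow_eq hx hkx
    have h1 : ∀ l : ℕ, (k ^ l) x = (c ^ (r * l)) x := by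
      intro l
      induction l with
      | zero => simp
      | succ l ih =>
        rw [pow_succ', Perm.mul_apply, ih, ← Perm.mul_apply,
          (hcomm.pow_right _).eq, Perm.mul_apply, ← hr, ← Perm.mul_apply, ← pow_add, mul_add,
          mul_one]
    have h2 : c ^ q = 1 := by rw [← hcq, ← hc.orderOf, pow_orderOf_eq_one]
    rw [h1, mul_comm, pow_mul, h2, one_pow, Perm.one_apply]
  have hsS : ∀ x, c x ≠ x → s x = x := by
    intro x hx
    have h1 : x ≠ a := by rintro rfl; exact hx ha
    have h2 : x ≠ b := by rintro rfl; exact hx hb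
    have h3 : x ≠ d := by rintro rfl; exact hx hd
    rw [hs, Perm.mul_apply, swap_apply_of_ne_of_ne h2 h3, swap_apply_of_ne_of_ne h2 h1]
  have hpow : k ^ q = s ^ (2 * q) := by
    ext x
    by_cases hx : c x = x
    · have h1 : ∀ l : ℕ, (k ^ l) x = (s ^ (2 * l)) x ∧ c ((k ^ l) x) = (k ^ l) x := by
        intro l
        induction l with
        | zero => simpa using hx
        | succ l ih =>
          have h2 := hkΔ _ ih.2
          rw [pow_succ', Perm.mul_apply, h2]
          refine ⟨?_, hsfix _ (hsfix _ ih.2)⟩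
          rw [ih.1, ← Perm.mul_apply, ← pow_add]
          congr 2
          ring
      rw [(h1 q).1]
    · rw [hkS x hx]
      have h1 : ∀ l : ℕ, (s ^ l) x = x := fun l => by
        induction l with
        | zero => rfl
        | succ l ih => rw [pow_succ, Perm.mul_apply, hsS x hx, ih]
      rw [h1]
  have h3 : (s ^ (2 * q)).IsThreeCycle := by
    rw [← pow_mod_orderOf, hs3.orderOf]
    have hq3 : ¬ 3 ∣ q := fun h => by
      have := (Nat.prime_dvd_prime_iff_eq Nat.prime_three hq).1 h
      omega
    have : 2 * q % 3 = 1 ∨ 2 * q % 3 = 2 := by omega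
    rcases this with h | h <;> rw [h]
    · rwa [pow_one]
    · rw [pow_two]; exact hs3.isThreeCycle_sq
  exact alternatingGroup_le_of_isPreprimitive_of_isThreeCycle_mem hG h3
    (hpow ▸ G.pow_mem hkG q)

open Equiv Equiv.Perm MulAction Pointwise in
/-- A transitive permutation group containing a cycle whose length is a prime larger than half the
degree is primitive. -/
theorem isPreprimitive_of_isCycle_mem {α : Type*} [Fintype α] [DecidableEq α]
    {G : Subgroup (Perm α)} [IsPretransitive G α] {c : Perm α} {p : ℕ} (hp : p.Prime)
    (hc : c.IsCycle) (hcp : c.support.card = p) (hcG : c ∈ G) (hα : Fintype.card α < 2 * p) :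
    IsPreprimitive G α := by
  obtain ⟨a, ha, hca⟩ := id hc
  apply IsPreprimitive.of_isTrivialBlock_of_notMem_fixedPoints (a := a)
  · intro h
    exact ha (h ⟨c, hcG⟩)
  intro B haB hB
  let c' : G := ⟨c, hcG⟩
  have hpow : ∀ y, c y ≠ y → ∃ i : ℕ, c' ^ i • a = y := by
    intro y hy
    obtain ⟨i, hi⟩ := hc.exists_pow_eq ha hy
    exact ⟨i, hi⟩
  have hBs := isBlock_iff_smul_eq_of_nonempty.1 hB
  by_cases hcB : c' • B = B
  · right
    apply hB.eq_univ_of_card_lt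
    have hsub : (c.support : Set α) ⊆ B := by
      intro y hy
      obtain ⟨i, rfl⟩ := hpow y (by simpa using hy)
      have : c' ^ i ∈ stabilizer G B := Subgroup.pow_mem _ hcB _
      rw [mem_stabilizer_iff] at this
      rw [← this]
      exact Set.smul_mem_smul_set haB
    have := Set.ncard_le_ncard hsub (Set.toFinite _)
    rw [Set.ncard_coe_finset, hcp] at this
    rw [Nat.card_eq_fintype_card]
    omega
  · left
    have hord : orderOf c' = p := by rw [Subgroup.orderOf_mk, hc.orderOf, hcp]
    have h1 : ∀ y ∈ B, y = a := by
      intro y hy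
      by_contra hya
      have hcy : c y ≠ y := by
        intro h
        exact hcB (hBs ⟨y, ⟨y, hy, h⟩, hy⟩)
      obtain ⟨i, hi⟩ := hpow y hcy
      have h2 : c' ^ i ∈ stabilizer G B := hBs ⟨y, ⟨a, haB, hi⟩, hy⟩
      have h3 : (orderOf c').Coprime i := by
        rw [hord, Nat.Prime.coprime_iff_not_dvd hp, ← hord, orderOf_dvd_iff_pow_eq_one]
        intro h
        rw [h, one_smul] at hi
        exact hya hi.symm
      obtain ⟨j, hj⟩ := exists_pow_eq_self_of_coprime h3.symm
      exact hcB (hj ▸ Subgroup.pow_mem _ h2 j)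
    intro x hx y hy
    rw [h1 x hx, h1 y hy]

open Equiv Equiv.Perm MulAction Pointwise in
theorem exists_isCycle_mem_of_not_dvd_index {α : Type*} [Fintype α] [DecidableEq α]
    {R : Subgroup (Perm α)} {p : ℕ} (hp : p.Prime) (hpα : p ≤ Fintype.card α)
    (hpR : ¬ p ∣ R.index) : ∃ c ∈ R, c.IsCycle ∧ c.support.card = p := by
  have : Fact p.Prime := ⟨hp⟩
  obtain ⟨c, hc⟩ := (Equiv.Perm.exists_with_cycleType_iff (α := α) (m := {p})).2
    ⟨by simpa using hpα, by simpa using hp.two_le⟩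
  have hcc : c.IsCycle := card_cycleType_eq_one.1 (by rw [hc]; rfl)
  have hcs : c.support.card = p := by rw [← sum_cycleType, hc]; simp
  obtain ⟨g, hg⟩ := R.exists_conj_mem_of_not_dvd_index hpR c
    (isPGroup_zpowers_of_orderOf_eq (by rw [hcc.orderOf, hcs]))
  exact ⟨_, hg, hcc.conj, by rw [card_support_conj, hcs]⟩

open Equiv Equiv.Perm MulAction Pointwise in
theorem alternatingGroup_le_of_not_dvd_index {α : Type*} [Fintype α] [DecidableEq α]
    {R : Subgroup (Perm α)} [IsPretransitive R α] {p q : ℕ} (hp : p.Prime) (hq : q.Prime)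
    (hpα : p ≤ Fintype.card α) (hαp : Fintype.card α < 2 * p) (h5 : 5 ≤ q)
    (hqα : q + 3 ≤ Fintype.card α) (hpR : ¬ p ∣ R.index) (hqR : ¬ q ∣ R.index) :
    alternatingGroup α ≤ R := by
  obtain ⟨c, hcR, hc, hcp⟩ := exists_isCycle_mem_of_not_dvd_index hp hpα hpR
  obtain ⟨d, hdR, hd, hdq⟩ := exists_isCycle_mem_of_not_dvd_index hq (by omega) hqR
  exact alternatingGroup_le_of_isPreprimitive_of_isCycle_mem
    (isPreprimitive_of_isCycle_mem hp hc hcp hcR hαp) hq h5 hd hdq hdR hqα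

open Equiv Equiv.Perm MulAction Pointwise in
/-- If a permutation group leaves a `k`-subset of an `n`-set invariant, `n.choose k` divides its
index in the symmetric group. -/
theorem choose_card_dvd_index_of_invariant {α : Type*} [Fintype α] [DecidableEq α]
    {R : Subgroup (Perm α)} (s : Finset α) (hs : ∀ g ∈ R, ∀ x ∈ s, g x ∈ s) :
    (Fintype.card α).choose s.card ∣ R.index := by
  let S : Set.powersetCard α s.card := ⟨s, rfl⟩
  have hle : R ≤ stabilizer (Perm α) S := by
    intro g hg
    rw [mem_stabilizer_iff]
    apply Subtype.ext
    show g • s = s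
    apply Finset.eq_of_subset_of_card_le
    · intro x hx
      obtain ⟨y, hy, rfl⟩ := Finset.mem_smul_finset.1 hx
      exact hs g hg y hy
    · simp
  have hidx : (stabilizer (Perm α) S).index = (Fintype.card α).choose s.card := by
    have := Set.powersetCard.isPretransitive (α := α) (n := s.card)
    rw [index_stabilizer_of_transitive, Set.powersetCard.card, Nat.card_eq_fintype_card]
  exact hidx ▸ Subgroup.index_dvd_of_le hle

theorem Nat.dvd_two_pow_log_mul_of_choose_dvd {m k a : ℕ}
    (h : m.choose k ∣ 2 ^ a * 15) (hk : k ≤ m) : m.choose k ∣ 2 ^ Nat.log 2 m * 15 := by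
  have h0 : m.choose k ≠ 0 := (Nat.choose_pos hk).ne'
  rw [← Nat.ordProj_mul_ordCompl_eq_self (m.choose k) 2]
  apply Nat.mul_dvd_mul
  · exact Nat.pow_dvd_pow _ Nat.factorization_choose_le_log
  · have hc : Nat.Coprime (ordCompl[2] (m.choose k)) (2 ^ a) :=
      ((Nat.coprime_ordCompl Nat.prime_two h0).symm).pow_right _
    exact hc.dvd_of_dvd_mul_left ((Nat.ordCompl_dvd _ _).trans h)

theorem Nat.choose_le_choose_of_le_half {m j k : ℕ} (hjk : j ≤ k) (hk : 2 * k ≤ m) :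
    m.choose j ≤ m.choose k := by
  induction k, hjk using Nat.le_induction with
  | base => rfl
  | succ k hjk ih =>
    exact (ih (by omega)).trans (Nat.choose_le_succ_of_lt_half_left (by omega))

/-- The nontrivial binomial coefficients dividing some `2 ^ a * 15`. -/
theorem Nat.choose_dvd_two_pow_mul_fifteen {m k a : ℕ} (hm : 7 ≤ m) (hk : 2 ≤ k) (hkm : 2 * k ≤ m)
    (h : m.choose k ∣ 2 ^ a * 15) : (m = 10 ∧ k = 3) ∨ (m = 16 ∧ k = 2) := by
  have h1 := Nat.dvd_two_pow_log_mul_of_choose_dvd h (by omega)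
  have h2 : m.choose k ≤ m * 15 := (Nat.le_of_dvd (by positivity) h1).trans
    (Nat.mul_le_mul_right _ (Nat.pow_log_le_self 2 (by omega)))
  have hm32 : m < 32 := by
    have h3 := (Nat.choose_le_choose_of_le_half hk hkm).trans h2
    rw [Nat.choose_two_right, Nat.div_le_iff_le_mul_add_pred (by norm_num)] at h3
    obtain ⟨m, rfl⟩ := Nat.exists_eq_add_of_le' (show 1 ≤ m by omega)
    simp only [Nat.add_sub_cancel] at h3
    nlinarith
  have h4 : m.choose k ∣ 240 := by
    refine h1.trans ?_
    have : Nat.log 2 m ≤ 4 := Nat.lt_succ_iff.1 (Nat.log_lt_of_lt_pow (by omega) (by omega))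
    exact Nat.mul_dvd_mul_right (Nat.pow_dvd_pow 2 this) 15
  have h5 : ∀ m < 32, 7 ≤ m → ∀ k < 16, 2 ≤ k → 2 * k ≤ m → m.choose k ∣ 240 →
      (m = 10 ∧ k = 3) ∨ (m = 16 ∧ k = 2) := by
    intro m hm32 hm k hk16 hk hkm hd
    have h6 := Nat.le_of_dvd (by norm_num) hd
    by_cases hk3 : k = 2
    · subst hk3
      interval_cases m <;> simp_all +decide
    · have h7 := (Nat.choose_le_choose_of_le_half (show 3 ≤ k by omega) hkm).trans h6
      have hm13 : m < 13 := by
        by_contra hc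
        have := (Nat.choose_le_choose 3 (show 13 ≤ m by omega)).trans h7
        simp +decide at this
      have : k < 7 := by omega
      interval_cases m <;> interval_cases k <;> simp_all +decide
  exact h5 m hm32 hm k (by omega) hk hkm h4

theorem Subgroup.relIndex_dvd_index_of_normal_right {G : Type*} [Group G] [Finite G]
    (H K : Subgroup G) [K.Normal] : H.relIndex K ∣ H.index := by
  have h1 : H.relIndex K * K.relIndex (K ⊔ H) = K.relIndex H * H.relIndex (K ⊔ H) := by
    rw [← Subgroup.inf_relIndex_right H K,
      Subgroup.relIndex_mul_relIndex _ _ _ inf_le_right le_sup_left,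
      ← Subgroup.relIndex_mul_relIndex _ _ _ inf_le_left (le_sup_right : H ≤ K ⊔ H),
      Subgroup.inf_relIndex_left]
  rw [Subgroup.relIndex_sup_left, mul_comm] at h1
  have h2 : K.relIndex H ≠ 0 := Subgroup.index_ne_zero_of_finite
  rw [Nat.eq_of_mul_eq_mul_left (Nat.pos_of_ne_zero h2) h1]
  exact Subgroup.relIndex_dvd_index_of_le le_sup_right

section Invariant

open Equiv Equiv.Perm MulAction

variable {α : Type*} [Fintype α] [DecidableEq α]

/-- The permutations of the complement of `s` that, extended by the identity, lie in `R`. -/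
def restrictCompl (R : Subgroup (Perm α)) (s : Finset α) : Subgroup (Perm {x // x ∉ s}) :=
  R.comap Perm.ofSubtype

theorem mem_range_ofSubtype_notMem_iff (s : Finset α) (g : Perm α) :
    g ∈ (Perm.ofSubtype (p := fun x => x ∉ s)).range ↔ ∀ x ∈ s, g x = x := by
  rw [mem_range_ofSubtype_iff]
  constructor
  · intro h x hx
    by_contra hg
    exact h (mem_support.2 hg) hx
  · intro h x hx hxs
    exact mem_support.1 hx (h x hxs)

theorem restrictCompl_index_mul_choose_dvd {R : Subgroup (Perm α)} (s : Finset α)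
    (hs : ∀ g ∈ R, ∀ x ∈ s, g x ∈ s) :
    (restrictCompl R s).index * (Fintype.card α).choose s.card ∣ R.index := by
  let S : Subgroup (Perm α) :=
    { carrier := {g | ∀ x, g x ∈ s ↔ x ∈ s}
      mul_mem' := fun {a b} ha hb x => (ha _).trans (hb x)
      one_mem' := fun x => Iff.rfl
      inv_mem' := fun {a} ha x => by rw [← ha (a⁻¹ x), ← Perm.mul_apply, mul_inv_cancel, one_apply] }
  have hRS : R ≤ S := fun g hg x => ⟨fun h => by simpa using hs _ (R.inv_mem hg) _ h, hs g hg x⟩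
  have h1 : (Fintype.card α).choose s.card ∣ S.index :=
    choose_card_dvd_index_of_invariant s fun g hg x hx => (hg x).2 hx
  rw [← Subgroup.relIndex_mul_index hRS]
  refine Nat.mul_dvd_mul ?_ h1
  let F := (Perm.ofSubtype (p := fun x => x ∉ s)).range
  have hF := mem_range_ofSubtype_notMem_iff s
  have hFS : F ≤ S := by
    intro g hg x
    have hg' := (hF g).1 hg
    refine ⟨fun h => ?_, fun h => by rwa [hg' x h]⟩
    have := hg' _ h
    rwa [g.injective this] at h
  have hn : (F.subgroupOf S).Normal := by
    constructor
    rintro ⟨f, hf⟩ hfF ⟨g, hg⟩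
    rw [Subgroup.mem_subgroupOf] at hfF ⊢
    refine (hF _).2 fun x hx => ?_
    have h2 : g⁻¹ x ∈ s := (S.inv_mem hg x).2 hx
    have h3 := (hF f).1 hfF _ h2
    simp only [Subgroup.coe_mul, InvMemClass.coe_inv, Perm.mul_apply]
    rw [h3, ← Perm.mul_apply, mul_inv_cancel, one_apply]
  rw [restrictCompl, Subgroup.index_comap, ← Subgroup.relIndex_subgroupOf hFS]
  exact Subgroup.relIndex_dvd_index_of_normal_right _ _

theorem mem_of_alternatingGroup_le_restrictCompl {R : Subgroup (Perm α)} {s : Finset α}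
    (h : alternatingGroup {x // x ∉ s} ≤ restrictCompl R s) {g : Perm α}
    (hg : g ∈ alternatingGroup α) (hgs : ∀ x ∈ s, g x = x) : g ∈ R := by
  obtain ⟨g', rfl⟩ := (mem_range_ofSubtype_notMem_iff s g).2 hgs
  rw [mem_alternatingGroup, sign_ofSubtype] at hg
  exact h (mem_alternatingGroup.2 hg)

theorem card_notMem (s : Finset α) : Fintype.card {x // x ∉ s} = Fintype.card α - s.card := by
  rw [Fintype.card_subtype_compl, Fintype.card_coe]

theorem exists_invariant_of_not_isPretransitive [Nonempty α] {R : Subgroup (Perm α)}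
    (hR : ¬ IsPretransitive R α) : ∃ s : Finset α, s.Nonempty ∧ 2 * s.card ≤ Fintype.card α ∧
      ∀ g ∈ R, ∀ x ∈ s, g x ∈ s := by
  classical
  obtain ⟨a⟩ := ‹Nonempty α›
  have hinv : ∀ g ∈ R, ∀ x, g x ∈ orbit R a ↔ x ∈ orbit R a := fun g hg x =>
    show (⟨g, hg⟩ : R) • x ∈ orbit R a ↔ _ by rw [← orbit_eq_iff, orbit_smul, orbit_eq_iff]
  let s : Finset α := Finset.univ.filter fun x => x ∈ orbit R a
  have hs : s.card + sᶜ.card = Fintype.card α := Finset.card_add_card_compl s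
  by_cases h : 2 * s.card ≤ Fintype.card α
  · exact ⟨s, ⟨a, by simp [s]⟩, h, fun g hg x hx => by simpa [s, hinv g hg] using hx⟩
  · refine ⟨sᶜ, ?_, by omega, fun g hg x hx => by simpa [s, hinv g hg] using hx⟩
    rw [Finset.nonempty_iff_ne_empty]
    intro h0
    apply hR
    rw [isPretransitive_iff_base a]
    intro x
    have : x ∈ s := by
      rw [Finset.compl_eq_empty_iff] at h0
      rw [h0]; exact Finset.mem_univ x
    simpa [s, mem_orbit_iff] using this

end Invariant

theorem Nat.Prime.not_dvd_two_pow_mul_fifteen {p : ℕ} (hp : p.Prime) (h7 : 7 ≤ p) (a : ℕ) :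
    ¬ p ∣ 2 ^ a * 15 := by
  rw [hp.dvd_mul]
  rintro (h | h)
  · have := Nat.le_of_dvd (by norm_num) (hp.dvd_of_dvd_pow h)
    omega
  · have := Nat.le_of_dvd (by norm_num) h
    interval_cases p <;> simp_all +decide

theorem Nat.exists_prime_ge_seven_le_lt_two_mul {m : ℕ} (hm : 10 ≤ m) :
    ∃ p, p.Prime ∧ 7 ≤ p ∧ p ≤ m ∧ m < 2 * p := by
  obtain ⟨p, hp, h1, h2⟩ := Nat.exists_prime_lt_and_le_two_mul (m / 2) (by omega)
  refine ⟨p, hp, ?_, by omega, by omega⟩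
  by_contra h
  have : p = 6 := by omega
  subst this
  norm_num at hp

theorem Nat.not_choose_dvd_two_pow_mul_fifteen {m k a : ℕ} (hm : 7 ≤ m) (hk : 2 ≤ k)
    (hkm : k + 2 ≤ m) (h10 : m ≠ 10) (h16 : m ≠ 16) : ¬ m.choose k ∣ 2 ^ a * 15 := by
  intro h
  by_cases hk2 : 2 * k ≤ m
  · have := Nat.choose_dvd_two_pow_mul_fifteen hm hk hk2 h
    omega
  · rw [← Nat.choose_symm (by omega)] at h
    have := Nat.choose_dvd_two_pow_mul_fifteen hm (by omega) (by omega) h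
    omega

section Classification

open Equiv Equiv.Perm MulAction

variable {α : Type*} [Fintype α] [DecidableEq α] {R : Subgroup (Perm α)} {a : ℕ}

theorem alternatingGroup_le_of_index_dvd [IsPretransitive R α] (hα : 10 ≤ Fintype.card α)
    (hR : R.index ∣ 2 ^ a * 15) : alternatingGroup α ≤ R := by
  obtain ⟨p, hp, h7, hpα, hαp⟩ := Nat.exists_prime_ge_seven_le_lt_two_mul hα
  have h7p : Nat.Prime 7 := by norm_num
  exact alternatingGroup_le_of_not_dvd_index hp h7p hpα hαp (by norm_num) hα
    (fun h => hp.not_dvd_two_pow_mul_fifteen h7 a (h.trans hR))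
    (fun h => h7p.not_dvd_two_pow_mul_fifteen le_rfl a (h.trans hR))

theorem isPretransitive_or_exists_fixed (h7 : 7 ≤ Fintype.card α) (h10 : Fintype.card α ≠ 10)
    (h16 : Fintype.card α ≠ 16) (hR : R.index ∣ 2 ^ a * 15) :
    IsPretransitive R α ∨ ∃ i, ∀ g ∈ R, g i = i := by
  have : Nonempty α := Fintype.card_pos_iff.1 (by omega)
  by_contra! h
  obtain ⟨s, hs0, hs, hsR⟩ := exists_invariant_of_not_isPretransitive h.1
  have hd := (choose_card_dvd_index_of_invariant s hsR).trans hR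
  by_cases h1 : s.card = 1
  · obtain ⟨i, rfl⟩ := Finset.card_eq_one.1 h1
    obtain ⟨g, hg, hgi⟩ := h.2 i
    exact hgi (by simpa using hsR g hg i (by simp))
  · have := hs0.card_pos
    exact Nat.not_choose_dvd_two_pow_mul_fifteen h7 (by omega) (by omega) h10 h16 hd

theorem fixed_singleton {α : Type*} {R : Subgroup (Perm α)} {i : α} (hi : ∀ g ∈ R, g i = i) :
    ∀ g ∈ R, ∀ x ∈ ({i} : Finset α), g x ∈ ({i} : Finset α) := by
  intro g hg x hx
  rw [Finset.mem_singleton] at hx ⊢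
  rw [hx, hi g hg]

theorem card_mul_index_restrictCompl_dvd {i : α} (hi : ∀ g ∈ R, g i = i) :
    (restrictCompl R {i}).index * Fintype.card α ∣ R.index := by
  simpa using restrictCompl_index_mul_choose_dvd {i} (fixed_singleton hi)

/-- Subgroups of index dividing `2 ^ a * 15` in a symmetric group of degree at least eleven. -/
theorem alternatingGroup_le_or_exists_stabilizer_le (h11 : 11 ≤ Fintype.card α)
    (h16 : Fintype.card α ≠ 16) (hR : R.index ∣ 2 ^ a * 15) :
    alternatingGroup α ≤ R ∨ Fintype.card α ∣ R.index ∧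
      ∃ i, ∀ g ∈ alternatingGroup α, g i = i → g ∈ R := by
  rcases isPretransitive_or_exists_fixed (by omega) (by omega) h16 hR with h | ⟨i, hi⟩
  · exact Or.inl (alternatingGroup_le_of_index_dvd (by omega) hR)
  right
  have hd := card_mul_index_restrictCompl_dvd hi
  refine ⟨(Dvd.intro_left _ rfl).trans hd, i, ?_⟩
  have hcard := card_notMem ({i} : Finset α)
  rw [Finset.card_singleton] at hcard
  have hne : Nonempty {x // x ∉ ({i} : Finset α)} := Fintype.card_pos_iff.1 (by omega)
  have htr : IsPretransitive (restrictCompl R {i}) {x // x ∉ ({i} : Finset α)} := by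
    by_contra htr
    obtain ⟨s, hs0, hs, hsR⟩ := exists_invariant_of_not_isPretransitive htr
    let t : Finset α := insert i (s.map (Function.Embedding.subtype _))
    have ht : t.card = s.card + 1 := by
      rw [Finset.card_insert_of_notMem, Finset.card_map]
      simp
    have htR : ∀ g ∈ R, ∀ x ∈ t, g x ∈ t := by
      intro g hg x hx
      rw [Finset.mem_insert, Finset.mem_map] at hx ⊢
      rcases hx with rfl | ⟨y, hy, rfl⟩
      · exact Or.inl (hi g hg)
      · right
        obtain ⟨g', rfl⟩ := (mem_range_ofSubtype_notMem_iff ({i} : Finset α) g).2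
          (by simpa using hi g hg)
        exact ⟨g' y, hsR g' hg y hy, by simp⟩
    have := (choose_card_dvd_index_of_invariant t htR).trans hR
    have := hs0.card_pos
    exact Nat.not_choose_dvd_two_pow_mul_fifteen (by omega) (by omega) (by omega) (by omega) h16
      ((choose_card_dvd_index_of_invariant t htR).trans hR)
  have halt : alternatingGroup {x // x ∉ ({i} : Finset α)} ≤ restrictCompl R {i} :=
    alternatingGroup_le_of_index_dvd (by omega) (((Dvd.intro _ rfl).trans hd).trans hR)
  exact fun g hg hgi => mem_of_alternatingGroup_le_restrictCompl halt hg (by simpa using hgi)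

theorem isPretransitive_of_index_dvd (hα : Fintype.card α = 7 ∨ Fintype.card α = 9)
    (hR : R.index ∣ 2 ^ a * 15) : IsPretransitive R α := by
  rcases isPretransitive_or_exists_fixed (by omega) (by omega) (by omega) hR with h | ⟨i, hi⟩
  · exact h
  · exfalso
    have hd := ((Dvd.intro_left _ rfl).trans (card_mul_index_restrictCompl_dvd hi)).trans hR
    rcases hα with h | h
    · rw [h] at hd
      exact Nat.Prime.not_dvd_two_pow_mul_fifteen (by norm_num) le_rfl a hd
    · rw [h] at hd
      have h2 : Nat.Coprime 9 (2 ^ a) := Nat.Coprime.pow_right _ (by norm_num)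
      have := h2.dvd_of_dvd_mul_left hd
      norm_num at this

/-- Subgroups of index dividing `2 ^ a * 15` in the symmetric group of degree ten. -/
theorem exists_card_eq_three_stabilizer_le (hα : Fintype.card α = 10)
    (hR : R.index ∣ 2 ^ a * 15) :
    ∃ s : Finset α, s.card = 3 ∧ ∀ g ∈ alternatingGroup α, (∀ x ∈ s, g x = x) → g ∈ R := by
  have hne : Nonempty α := Fintype.card_pos_iff.1 (by omega)
  have h7 : Nat.Prime 7 := by norm_num
  have hn7 : ¬ 7 ∣ R.index := fun h => h7.not_dvd_two_pow_mul_fifteen le_rfl a (h.trans hR)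
  by_cases htr : IsPretransitive R α
  · obtain ⟨s, hs⟩ := Finset.exists_subset_card_eq (s := (Finset.univ : Finset α)) (n := 3)
      (by rw [Finset.card_univ]; omega)
    exact ⟨s, hs.2, fun g hg _ => alternatingGroup_le_of_index_dvd hα.ge hR hg⟩
  obtain ⟨s, hs0, hs, hsR⟩ := exists_invariant_of_not_isPretransitive htr
  have hd := restrictCompl_index_mul_choose_dvd s hsR
  have hcard := card_notMem s
  have hn7' : ¬ 7 ∣ (restrictCompl R s).index := fun h =>
    hn7 ((h.trans (Dvd.intro _ rfl)).trans hd)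
  have hd' := hd.trans hR
  rw [hα] at hd'
  have hs0 := hs0.card_pos
  have hs13 : s.card = 1 ∨ s.card = 3 := by
    by_contra! h
    have := Nat.choose_dvd_two_pow_mul_fifteen (by omega) (by omega) (by omega)
      ((Dvd.intro_left _ rfl).trans hd')
    omega
  have hne : Nonempty {x // x ∉ s} := Fintype.card_pos_iff.1 (by omega)
  rcases hs13 with h1 | h3
  · rw [h1, Nat.choose_one_right] at hd'
    have hcard9 : Fintype.card {x // x ∉ s} = 9 := by omega
    have h5 : ¬ 5 ∣ (restrictCompl R s).index := by
      intro h
      have h2 : 25 ∣ 2 ^ a * 15 := (Nat.mul_dvd_mul h (by norm_num : 5 ∣ 10)).trans hd'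
      have h3 : Nat.Coprime 25 (2 ^ a) := Nat.Coprime.pow_right _ (by norm_num)
      have := h3.dvd_of_dvd_mul_left h2
      norm_num at this
    have := isPretransitive_of_index_dvd (Or.inr hcard9) ((Dvd.intro _ rfl).trans hd')
    have halt := alternatingGroup_le_of_not_dvd_index h7 Nat.prime_five (by omega)
      (by omega) le_rfl (by omega) hn7' h5
    obtain ⟨t, hst, ht⟩ := Finset.exists_superset_card_eq (s := s) (n := 3) (by omega) (by omega)
    exact ⟨t, ht, fun g hg hgt =>
      mem_of_alternatingGroup_le_restrictCompl halt hg fun x hx => hgt x (hst hx)⟩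
  · rw [h3] at hd'
    have h3' : ¬ 3 ∣ (restrictCompl R s).index := by
      intro h
      have h2 : 9 ∣ 2 ^ a * 15 :=
        (Nat.mul_dvd_mul h (by decide : 3 ∣ Nat.choose 10 3)).trans hd'
      have h3 : Nat.Coprime 9 (2 ^ a) := Nat.Coprime.pow_right _ (by norm_num)
      have := h3.dvd_of_dvd_mul_left h2
      norm_num at this
    have hcard7 : Fintype.card {x // x ∉ s} = 7 := by omega
    have := isPretransitive_of_index_dvd (Or.inl hcard7) ((Dvd.intro _ rfl).trans hd')
    obtain ⟨c, hcR, hc, hcs⟩ := exists_isCycle_mem_of_not_dvd_index Nat.prime_three (by omega) h3'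
    have hprim : IsPreprimitive (restrictCompl R s) {x // x ∉ s} :=
      IsPreprimitive.of_prime_card (by rw [Nat.card_eq_fintype_card, hcard7]; exact h7)
    have halt := alternatingGroup_le_of_isPreprimitive_of_isThreeCycle_mem hprim
      (card_support_eq_three_iff.1 hcs) hcR
    exact ⟨s, h3, fun g hg hgs => mem_of_alternatingGroup_le_restrictCompl halt hg hgs⟩

/-- A subgroup of index `n` in an alternating group of degree `n` is a point stabilizer, provided
that it is not transitive. -/
theorem exists_mem_iff_fixes {H : Subgroup (Perm α)} (h7 : 7 ≤ Fintype.card α)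
    (hH : H ≤ alternatingGroup α) (hidx : H.index = 2 * Fintype.card α)
    (htr : ¬ IsPretransitive H α) :
    ∃ i, ∀ g, g ∈ H ↔ g ∈ alternatingGroup α ∧ g i = i := by
  have hne : Nonempty α := Fintype.card_pos_iff.1 (by omega)
  obtain ⟨s, hs0, hs, hsH⟩ := exists_invariant_of_not_isPretransitive htr
  have hd := choose_card_dvd_index_of_invariant s hsH
  have hs1 : s.card = 1 := by
    by_contra h1
    have h2 := (Nat.choose_le_choose_of_le_half (j := 2) (k := s.card)
      (by have := hs0.card_pos; omega) hs).trans (Nat.le_of_dvd (by omega) hd)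
    rw [Nat.choose_two_right, hidx, Nat.div_le_iff_le_mul_add_pred (by norm_num)] at h2
    obtain ⟨m, hm⟩ := Nat.exists_eq_add_of_le' (show 1 ≤ Fintype.card α by omega)
    rw [hm, Nat.add_sub_cancel] at h2
    nlinarith
  obtain ⟨i, rfl⟩ := Finset.card_eq_one.1 hs1
  have hle : H ≤ alternatingGroup α ⊓ stabilizer (Perm α) i := by
    intro g hg
    exact ⟨hH hg, by simpa using hsH g hg i (by simp)⟩
  have hn : Nontrivial α := Fintype.one_lt_card_iff_nontrivial.1 (by omega)
  have hidx2 : (alternatingGroup α ⊓ stabilizer (Perm α) i).index = 2 * Fintype.card α := by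
    have h1 : (stabilizer (Perm α) i).index = Fintype.card α := by
      rw [index_stabilizer_of_transitive, Nat.card_eq_fintype_card]
    have h2 : (alternatingGroup α).relIndex (stabilizer (Perm α) i) = 2 := by
      apply le_antisymm
      · exact (Nat.le_of_dvd (by rw [alternatingGroup.index_eq_two]; norm_num)
          (Subgroup.relIndex_dvd_index_of_normal _ _)).trans
          alternatingGroup.index_eq_two.le
      · have h0 : (alternatingGroup α).relIndex (stabilizer (Perm α) i) ≠ 0 :=
          Subgroup.index_ne_zero_of_finite
        have h1 : (alternatingGroup α).relIndex (stabilizer (Perm α) i) ≠ 1 := by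
          rw [Ne, Subgroup.relIndex_eq_one]
          intro hle
          obtain ⟨x, hx, y, hy, hxy⟩ : ∃ x ∈ ({i}ᶜ : Finset α), ∃ y ∈ ({i}ᶜ : Finset α), x ≠ y := by
            apply Finset.one_lt_card.1
            rw [Finset.card_compl, Finset.card_singleton]
            omega
          rw [Finset.mem_compl, Finset.mem_singleton] at hx hy
          have : swap x y ∈ alternatingGroup α :=
            hle (swap_apply_of_ne_of_ne (Ne.symm hx) (Ne.symm hy))
          rw [mem_alternatingGroup, sign_swap hxy] at this
          exact absurd this (by decide)
        omega
    rw [← Subgroup.relIndex_mul_index inf_le_right, Subgroup.inf_relIndex_right, h1, h2]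
  have heq : H = alternatingGroup α ⊓ stabilizer (Perm α) i := by
    apply Subgroup.eq_of_le_of_card_ge hle
    have h1 := H.card_mul_index
    have h2 := (alternatingGroup α ⊓ stabilizer (Perm α) i).card_mul_index
    rw [hidx] at h1
    rw [hidx2, ← h1] at h2
    exact (Nat.eq_of_mul_eq_mul_right (by omega) h2).le
  exact ⟨i, fun g => by rw [heq]; rfl⟩

theorem not_isPretransitive_of_index_eq {H : Subgroup (Perm α)}
    (hα : Fintype.card α = 7 ∨ Fintype.card α = 9 ∨
      10 ≤ Fintype.card α ∧ Fintype.card α ∣ 2 ^ a * 15)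
    (hidx : H.index = 2 * Fintype.card α) : ¬ IsPretransitive H α := by
  intro htr
  have hne : Nonempty α := Fintype.card_pos_iff.1 (by omega)
  have hn : Nontrivial α := Fintype.one_lt_card_iff_nontrivial.1 (by omega)
  have hnot : ¬ alternatingGroup α ≤ H := by
    intro h
    have := Nat.le_of_dvd (by rw [alternatingGroup.index_eq_two]; norm_num)
      (Subgroup.index_dvd_of_le h)
    rw [hidx, alternatingGroup.index_eq_two] at this
    omega
  rcases hα with h | h | ⟨h10, h⟩
  · obtain ⟨x⟩ := hne
    have h1 : Fintype.card α ∣ Nat.card H := by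
      rw [← Nat.card_eq_fintype_card, ← index_stabilizer_of_transitive H x]
      exact (stabilizer H x).index_dvd_card
    have h2 := H.card_mul_index
    rw [hidx, Nat.card_perm, Nat.card_eq_fintype_card (α := α), h] at h2
    rw [h] at h1
    rw [show Nat.factorial 7 = 5040 by rfl] at h2
    omega
  · apply hnot
    exact alternatingGroup_le_of_not_dvd_index (p := 7) (q := 5) (by norm_num) (by norm_num)
      (by omega) (by omega) le_rfl (by omega) (by rw [hidx, h]; norm_num)
      (by rw [hidx, h]; norm_num)
  · exact hnot (alternatingGroup_le_of_index_dvd (a := a + 1) h10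
      (by rw [hidx, pow_succ', mul_assoc]; exact Nat.mul_dvd_mul_left 2 h))

end Classification

section Automorphisms

open Equiv Equiv.Perm MulAction

variable {α : Type*} [Fintype α] [DecidableEq α]

theorem eq_of_forall_mem_alternatingGroup_fixes (hα : 4 ≤ Fintype.card α) {x y : α}
    (h : ∀ g ∈ alternatingGroup α, g x = x → g y = y) : x = y := by
  by_contra hxy
  obtain ⟨k, hk, l, hl, hkl⟩ : ∃ k ∈ ({x, y}ᶜ : Finset α), ∃ l ∈ ({x, y}ᶜ : Finset α), k ≠ l := by
    apply Finset.one_lt_card.1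
    rw [Finset.card_compl, Finset.card_pair hxy]
    omega
  simp only [Finset.mem_compl, Finset.mem_insert, Finset.mem_singleton, not_or] at hk hl
  have h1 := h (swap y k * swap y l)
    (isThreeCycle_swap_mul_swap_same (Ne.symm hk.2) (Ne.symm hl.2) hkl).mem_alternatingGroup
    (by rw [Perm.mul_apply, swap_apply_of_ne_of_ne hxy (Ne.symm hl.1),
      swap_apply_of_ne_of_ne hxy (Ne.symm hk.1)])
  rw [Perm.mul_apply, swap_apply_left, swap_apply_of_ne_of_ne hl.2 (Ne.symm hkl)] at h1
  exact hl.2 h1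

/-- In the degrees considered here, every automorphism of an alternating group is induced by
conjugation in the symmetric group. -/
theorem exists_perm_conj_of_mulAut {a : ℕ} (h7 : 7 ≤ Fintype.card α)
    (hα : Fintype.card α = 7 ∨ Fintype.card α = 9 ∨
      10 ≤ Fintype.card α ∧ Fintype.card α ∣ 2 ^ a * 15)
    (φ : alternatingGroup α ≃* alternatingGroup α) :
    ∃ σ : Perm α, ∀ g : alternatingGroup α, (φ g : Perm α) = σ * g * σ⁻¹ := by
  have hn : Nontrivial α := Fintype.one_lt_card_iff_nontrivial.1 (by omega)
  have htr : IsPretransitive (alternatingGroup α) α :=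
    alternatingGroup.isPretransitive_of_three_le_card α (by rw [Nat.card_eq_fintype_card]; omega)
  have hf : ∀ i : α, ∃ j : α, ∀ g : alternatingGroup α, (φ g : Perm α) j = j ↔ (g : Perm α) i = i := by
    intro i
    let K := (stabilizer (alternatingGroup α) i).map φ.toMonoidHom
    have hK : K.index = Fintype.card α := by
      rw [← Nat.card_eq_fintype_card, ← index_stabilizer_of_transitive (alternatingGroup α) i]
      exact Subgroup.index_map_equiv _ φ
    have hidx : (K.map (alternatingGroup α).subtype).index = 2 * Fintype.card α := by
      rw [Subgroup.index_map_subtype, hK, alternatingGroup.index_eq_two, mul_comm]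
    obtain ⟨j, hj⟩ := exists_mem_iff_fixes h7 (Subgroup.map_subtype_le K) hidx
      (not_isPretransitive_of_index_eq hα hidx)
    refine ⟨j, fun g => ?_⟩
    have h1 := hj (φ g)
    rw [and_iff_right (φ g).2] at h1
    have h2 : (φ g : Perm α) ∈ K.map (alternatingGroup α).subtype ↔ φ g ∈ K :=
      Subgroup.mem_map_iff_mem (Subgroup.subtype_injective _)
    have h3 : φ g ∈ K ↔ g ∈ stabilizer (alternatingGroup α) i :=
      Subgroup.mem_map_iff_mem (f := φ.toMonoidHom) φ.injective
    rw [← h1, h2, h3]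
    rfl
  choose f hf using hf
  have hinj : Function.Injective f := by
    intro i j hij
    apply eq_of_forall_mem_alternatingGroup_fixes (by omega)
    intro g hg hgi
    have := (hf i ⟨g, hg⟩).2 hgi
    rw [hij] at this
    exact (hf j ⟨g, hg⟩).1 this
  have hequiv : ∀ (g : alternatingGroup α) i, (φ g : Perm α) (f i) = f ((g : Perm α) i) := by
    intro g i
    apply eq_of_forall_mem_alternatingGroup_fixes (by omega)
    intro h' hh' hfix
    obtain ⟨h, hh⟩ := φ.surjective ⟨h', hh'⟩
    have h1 : (φ (g⁻¹ * h * g) : Perm α) (f i) = f i := by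
      simp only [map_mul, map_inv, Subgroup.coe_mul, InvMemClass.coe_inv, Perm.mul_apply, hh,
        Perm.inv_eq_iff_eq]
      exact hfix
    have h2 := (hf i _).1 h1
    simp only [Subgroup.coe_mul, InvMemClass.coe_inv, Perm.mul_apply, Perm.inv_eq_iff_eq] at h2
    have h3 := (hf _ _).2 h2
    rwa [hh] at h3
  refine ⟨Equiv.ofBijective f (Finite.injective_iff_bijective.1 hinj), fun g => ?_⟩
  rw [eq_mul_inv_iff_mul_eq]
  ext i
  exact hequiv g i

/-- A subgroup of the alternating group that is normalised by an odd permutation is mapped by every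
automorphism to a conjugate. -/
theorem exists_map_eq_conj_of_odd {a : ℕ} (h7 : 7 ≤ Fintype.card α)
    (hα : Fintype.card α = 7 ∨ Fintype.card α = 9 ∨
      10 ≤ Fintype.card α ∧ Fintype.card α ∣ 2 ^ a * 15)
    (H : Subgroup (Perm α)) {τ : Perm α} (hτ : τ ∈ H) (hτ' : sign τ = -1)
    (φ : alternatingGroup α ≃* alternatingGroup α) :
    ∃ t : alternatingGroup α, ∀ g ∈ H.subgroupOf (alternatingGroup α),
      t * φ g * t⁻¹ ∈ H.subgroupOf (alternatingGroup α) := by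
  obtain ⟨σ, hσ⟩ := exists_perm_conj_of_mulAut h7 hα φ
  rcases Int.units_eq_one_or (sign σ) with h | h
  · refine ⟨⟨σ⁻¹, by simp [mem_alternatingGroup, h]⟩, fun g hg => ?_⟩
    rw [Subgroup.mem_subgroupOf] at hg ⊢
    simpa [hσ, mul_assoc] using hg
  · refine ⟨⟨τ * σ⁻¹, by simp [mem_alternatingGroup, h, hτ']⟩, fun g hg => ?_⟩
    rw [Subgroup.mem_subgroupOf] at hg ⊢
    simpa [hσ, mul_assoc] using H.mul_mem (H.mul_mem hτ hg) (H.inv_mem hτ)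

end Automorphisms

section SteinerSystem

open Equiv Equiv.Perm MulAction Pointwise

/-- The blocks of the Steiner system `S(3, 4, 10)`, encoded as bit masks: the images of `𝔽₃ ∪ {∞}`
in the projective line over `𝔽₉ = 𝔽₃(i)`, where `a + b i` is numbered `a + 3 b` and `∞` is
numbered `9`. -/
def steinerMask : Fin 30 → ℕ :=
  ![519, 27, 291, 195, 45, 149, 325, 585, 393, 113, 785, 673, 78, 54, 390, 170, 778, 338,
    658, 610, 284, 652, 596, 228, 804, 568, 216, 360, 432, 960]

/-- The block of `S(3, 4, 10)` with a given number. -/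
def steinerBlock (i : Fin 30) : Finset (Fin 10) :=
  Finset.univ.filter fun x => (steinerMask i).testBit x

/-- The automorphism group of `S(3, 4, 10)`, that is, `PΓL(2, 9)`. -/
def steinerGroup : Subgroup (Perm (Fin 10)) :=
  stabilizer (Perm (Fin 10)) (Finset.univ.image steinerBlock)

theorem mem_steinerGroup {g : Perm (Fin 10)} (f : Fin 30 → Fin 30)
    (h : ∀ i (x : Fin 10), (steinerMask i).testBit x = (steinerMask (f i)).testBit (g x)) :
    g ∈ steinerGroup := by
  rw [steinerGroup, mem_stabilizer_iff]
  apply Finset.eq_of_subset_of_card_le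
  · intro x hx
    obtain ⟨b, hb, rfl⟩ := Finset.mem_smul_finset.1 hx
    obtain ⟨i, -, rfl⟩ := Finset.mem_image.1 hb
    refine Finset.mem_image.2 ⟨f i, Finset.mem_univ _, ?_⟩
    ext y
    rw [← Finset.inv_smul_mem_iff, steinerBlock, steinerBlock, Finset.mem_filter_univ,
      Finset.mem_filter_univ, h i, ← Perm.smul_def, smul_inv_smul]
  · simp

theorem sign_eq_of_prod {n : ℕ} {g : Perm (Fin n)} {u : ℤˣ}
    (h : ∏ j, ∏ i ∈ Finset.Iio j, (if g i < g j then 1 else -1 : ℤˣ) = u) : sign g = u :=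
  (sign_eq_prod_prod_Iio g).trans h

/-- The translation `x ↦ x + 1`. -/
def translateOne : Perm (Fin 10) :=
  ⟨![1, 2, 0, 4, 5, 3, 7, 8, 6, 9], ![2, 0, 1, 5, 3, 4, 8, 6, 7, 9], by decide, by decide⟩

/-- The translation `x ↦ x + i`. -/
def translateI : Perm (Fin 10) :=
  ⟨![3, 4, 5, 6, 7, 8, 0, 1, 2, 9], ![6, 7, 8, 0, 1, 2, 3, 4, 5, 9], by decide, by decide⟩

/-- The inversion `x ↦ -1 / x`. -/
def negInversion : Perm (Fin 10) :=
  ⟨![9, 2, 1, 3, 7, 8, 6, 4, 5, 0], ![9, 2, 1, 3, 7, 8, 6, 4, 5, 0], by decide, by decide⟩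

/-- The homothety `x ↦ i x`. -/
def mulI : Perm (Fin 10) :=
  ⟨![0, 3, 6, 2, 5, 8, 1, 4, 7, 9], ![0, 6, 3, 1, 7, 4, 2, 8, 5, 9], by decide, by decide⟩

/-- The semilinear map `x ↦ (1 + i) x ^ 3`. -/
def mulFrobenius : Perm (Fin 10) :=
  ⟨![0, 4, 8, 7, 2, 3, 5, 6, 1, 9], ![0, 8, 4, 5, 1, 6, 7, 3, 2, 9], by decide, by decide⟩

/-- The Frobenius map `x ↦ x ^ 3`. -/
def frobeniusNine : Perm (Fin 10) :=
  ⟨![0, 1, 2, 6, 7, 8, 3, 4, 5, 9], ![0, 1, 2, 6, 7, 8, 3, 4, 5, 9], by decide, by decide⟩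

theorem frobeniusNine_mem : frobeniusNine ∈ steinerGroup :=
  mem_steinerGroup
    ![0, 3, 2, 1, 6, 5, 4, 7, 9, 8, 11, 10, 12, 14, 13, 17, 19, 15, 18, 16, 23, 22, 21, 20,
    24, 29, 26, 27, 28, 25]
    (by decide +kernel)

theorem sign_frobeniusNine : sign frobeniusNine = -1 := sign_eq_of_prod (by decide +kernel)

/-- The Mathieu group of degree ten. -/
def mathieuTen : Subgroup (Perm (Fin 10)) := steinerGroup ⊓ alternatingGroup (Fin 10)

theorem translateOne_mem : translateOne ∈ mathieuTen :=
  ⟨mem_steinerGroup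
    ![0, 13, 12, 14, 1, 2, 3, 18, 17, 15, 19, 16, 5, 4, 6, 20, 22, 23, 24, 21, 9, 10, 11, 8,
    7, 25, 28, 26, 27, 29]
    (by decide +kernel), mem_alternatingGroup.2 (sign_eq_of_prod (by decide +kernel))⟩

theorem translateI_mem : translateI ∈ mathieuTen :=
  ⟨mem_steinerGroup
    ![25, 26, 20, 1, 27, 15, 4, 7, 12, 8, 21, 16, 9, 28, 13, 17, 22, 5, 18, 10, 23, 19, 11,
    2, 24, 29, 3, 6, 14, 0]
    (by decide +kernel), mem_alternatingGroup.2 (sign_eq_of_prod (by decide +kernel))⟩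

theorem negInversion_mem : negInversion ∈ mathieuTen :=
  ⟨mem_steinerGroup
    ![0, 21, 24, 22, 16, 18, 19, 7, 25, 29, 11, 10, 12, 14, 13, 20, 4, 23, 5, 6, 15, 1, 3,
    17, 2, 8, 26, 27, 28, 9]
    (by decide +kernel), mem_alternatingGroup.2 (sign_eq_of_prod (by decide +kernel))⟩

theorem mulI_mem : mulI ∈ mathieuTen :=
  ⟨mem_steinerGroup
    ![7, 4, 8, 1, 6, 9, 3, 0, 5, 2, 11, 10, 12, 27, 26, 20, 21, 15, 25, 16, 23, 22, 19, 17,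
    29, 24, 13, 14, 28, 18]
    (by decide +kernel), mem_alternatingGroup.2 (sign_eq_of_prod (by decide +kernel))⟩

theorem mulFrobenius_mem : mulFrobenius ∈ mathieuTen :=
  ⟨mem_steinerGroup
    ![10, 5, 1, 9, 8, 6, 2, 11, 3, 4, 0, 7, 28, 20, 17, 26, 18, 13, 22, 25, 14, 29, 24, 27,
    16, 21, 23, 15, 12, 19]
    (by decide +kernel), mem_alternatingGroup.2 (sign_eq_of_prod (by decide +kernel))⟩

theorem exists_mathieuTen_fix_one {y : Fin 10} (hy : y ≠ 9) :
    ∃ g ∈ mathieuTen, g 9 = 9 ∧ g 0 = y := by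
  have h : ∀ y : Fin 10, y ≠ 9 → ∃ a b : Fin 3,
      (translateOne ^ a.val * translateI ^ b.val) 9 = 9 ∧
      (translateOne ^ a.val * translateI ^ b.val) 0 = y := by decide +kernel
  obtain ⟨a, b, h⟩ := h y hy
  exact ⟨_, mul_mem (pow_mem translateOne_mem _) (pow_mem translateI_mem _), h⟩

theorem exists_mathieuTen (x : Fin 10) : ∃ g ∈ mathieuTen, g 9 = x := by
  by_cases hx : x = 9
  · exact ⟨1, one_mem _, hx.symm⟩
  · obtain ⟨g, hg, -, h⟩ := exists_mathieuTen_fix_one hx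
    exact ⟨g * negInversion, mul_mem hg negInversion_mem, h⟩

theorem exists_mathieuTen_fix_two {z : Fin 10} (hz : z ≠ 9) (hz0 : z ≠ 0) :
    ∃ g ∈ mathieuTen, g 9 = 9 ∧ g 0 = 0 ∧ g 1 = z := by
  have h : ∀ z : Fin 10, z ≠ 9 → z ≠ 0 → ∃ (a : Fin 4) (b : Fin 2),
      (mulI ^ a.val * mulFrobenius ^ b.val) 9 = 9 ∧ (mulI ^ a.val * mulFrobenius ^ b.val) 0 = 0 ∧
      (mulI ^ a.val * mulFrobenius ^ b.val) 1 = z := by decide +kernel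
  obtain ⟨a, b, h⟩ := h z hz hz0
  exact ⟨_, mul_mem (pow_mem mulI_mem _) (pow_mem mulFrobenius_mem _), h⟩

theorem exists_mathieuTen_triple {x y z : Fin 10} (hxy : x ≠ y) (hxz : x ≠ z) (hyz : y ≠ z) :
    ∃ g ∈ mathieuTen, g 9 = x ∧ g 0 = y ∧ g 1 = z := by
  obtain ⟨f, hf, hfx⟩ := exists_mathieuTen x
  obtain ⟨g, hg, hg9, hgy⟩ := exists_mathieuTen_fix_one (y := f⁻¹ y)
    (by rw [Ne, Perm.inv_eq_iff_eq, hfx]; exact hxy.symm)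
  obtain ⟨h, hh, hh9, hh0, hhz⟩ := exists_mathieuTen_fix_two (z := (f * g)⁻¹ z)
    (by rw [Ne, Perm.inv_eq_iff_eq, Perm.mul_apply, hg9, hfx]; exact hxz.symm)
    (by rw [Ne, Perm.inv_eq_iff_eq, Perm.mul_apply, hgy]; simpa using hyz.symm)
  refine ⟨f * g * h, mul_mem (mul_mem hf hg) hh, ?_, ?_, ?_⟩
  · rw [Perm.mul_apply, hh9, Perm.mul_apply, hg9, hfx]
  · rw [Perm.mul_apply, hh0, Perm.mul_apply, hgy]; simp
  · rw [Perm.mul_apply, hhz]; simp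

/-- The Mathieu group of degree ten realises every permutation on any three points. -/
theorem exists_mathieuTen_eqOn {s : Finset (Fin 10)} (hs : s.card = 3) (t : Perm (Fin 10)) :
    ∃ g ∈ mathieuTen, ∀ x ∈ s, g x = t x := by
  obtain ⟨x, y, z, hxy, hxz, hyz, rfl⟩ := Finset.card_eq_three.1 hs
  obtain ⟨g, hg, hgx, hgy, hgz⟩ := exists_mathieuTen_triple hxy hxz hyz
  obtain ⟨h, hh, hhx, hhy, hhz⟩ := exists_mathieuTen_triple (t.injective.ne hxy)
    (t.injective.ne hxz) (t.injective.ne hyz)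
  refine ⟨h * g⁻¹, mul_mem hh (inv_mem hg), ?_⟩
  simp only [Finset.mem_insert, Finset.mem_singleton, forall_eq_or_imp, forall_eq]
  rw [← hhx, ← hhy, ← hhz, ← hgx, ← hgy, ← hgz]
  simp

theorem exists_mem_alternatingGroup_notMem_steinerGroup :
    ∃ g ∈ alternatingGroup (Fin 10), g ∉ steinerGroup := by
  refine ⟨swap 0 1 * swap 0 3, (isThreeCycle_swap_mul_swap_same (by decide) (by decide)
    (by decide)).mem_alternatingGroup, fun h => ?_⟩
  rw [steinerGroup, mem_stabilizer_iff] at h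
  have h1 := Finset.smul_mem_smul_finset (a := swap (0 : Fin 10) 1 * swap 0 3)
    (Finset.mem_image_of_mem steinerBlock (Finset.mem_univ 0))
  rw [h] at h1
  obtain ⟨j, -, hj⟩ := Finset.mem_image.1 h1
  have h2 : ∀ x : Fin 10, (steinerMask j).testBit ((swap 0 1 * swap 0 3 : Perm (Fin 10)) x) =
      (steinerMask 0).testBit x := by
    intro x
    have h3 : (swap 0 1 * swap 0 3 : Perm (Fin 10)) • x ∈ steinerBlock j ↔ x ∈ steinerBlock 0 := by
      rw [hj, Finset.smul_mem_smul_finset_iff]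
    rw [steinerBlock, steinerBlock, Finset.mem_filter_univ, Finset.mem_filter_univ] at h3
    exact Bool.eq_iff_iff.2 h3
  clear hj
  revert j
  decide +kernel

end SteinerSystem

/-- The subgroup `M` of `T` is not normal, every automorphism of `T` maps it to a conjugate, and
it supplements all subgroups of `T` whose index divides some `2 ^ a * 15`. -/
structure IsFrattiniSupplement {T : Type*} [Group T] (M : Subgroup T) : Prop where
  not_normal : ¬ M.Normal
  exists_conj_mem : ∀ φ : T ≃* T, ∃ t, ∀ g ∈ M, t * φ g * t⁻¹ ∈ M
  exists_eq_mul : ∀ (a : ℕ) (R : Subgroup T), R.index ∣ 2 ^ a * 15 →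
    ∀ t, ∃ s ∈ M, ∃ r ∈ R, t = s * r

section Supplements

open Equiv Equiv.Perm MulAction

variable {α : Type*} [Fintype α] [DecidableEq α]

theorem index_map_subtype_dvd {a : ℕ} [Nontrivial α] {R : Subgroup (alternatingGroup α)}
    (hR : R.index ∣ 2 ^ a * 15) :
    (R.map (alternatingGroup α).subtype).index ∣ 2 ^ (a + 1) * 15 := by
  rw [Subgroup.index_map_subtype, alternatingGroup.index_eq_two, mul_comm, pow_succ', mul_assoc]
  exact Nat.mul_dvd_mul_left 2 hR

theorem mem_of_mem_map_subtype {R : Subgroup (alternatingGroup α)} {g : alternatingGroup α}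
    (h : (g : Perm α) ∈ R.map (alternatingGroup α).subtype) : g ∈ R :=
  (Subgroup.mem_map_iff_mem (Subgroup.subtype_injective _)).1 h

theorem not_normal_of_ne (hα : 5 ≤ Fintype.card α) {M : Subgroup (alternatingGroup α)}
    (hbot : M ≠ ⊥) (htop : M ≠ ⊤) : ¬ M.Normal := by
  have := alternatingGroup.isSimpleGroup (α := α) (by rwa [Nat.card_eq_fintype_card])
  intro h
  rcases h.eq_bot_or_eq_top with h | h
  · exact hbot h
  · exact htop h

/-- A permutation group containing odd permutations, but not the alternating group, and inducing
every even permutation on each `k`-subset, supplements the subgroups that contain the pointwise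
stabilizer of a `k`-subset. -/
theorem isFrattiniSupplement_subgroupOf {k b : ℕ} (hk : k ≠ 0) (h7 : 7 ≤ Fintype.card α)
    (hkα : k ≤ Fintype.card α)
    (hα : Fintype.card α = 7 ∨ Fintype.card α = 9 ∨
      10 ≤ Fintype.card α ∧ Fintype.card α ∣ 2 ^ b * 15)
    (H : Subgroup (Perm α)) {τ : Perm α} (hτ : τ ∈ H) (hτ' : sign τ = -1)
    (htop : ∃ g ∈ alternatingGroup α, g ∉ H)
    (hH : ∀ s : Finset α, s.card = k → ∀ t ∈ alternatingGroup α, ∃ g ∈ H ⊓ alternatingGroup α,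
      ∀ x ∈ s, g x = t x)
    (hR : ∀ (a : ℕ) (R : Subgroup (Perm α)), R.index ∣ 2 ^ a * 15 →
      ∃ s : Finset α, s.card = k ∧ ∀ g ∈ alternatingGroup α, (∀ x ∈ s, g x = x) → g ∈ R) :
    IsFrattiniSupplement (H.subgroupOf (alternatingGroup α)) where
  not_normal := by
    apply not_normal_of_ne (by omega)
    · intro hbot
      obtain ⟨s, hs⟩ := Finset.exists_subset_card_eq (s := (Finset.univ : Finset α)) (n := k)
        (by rwa [Finset.card_univ])
      obtain ⟨x, hx⟩ := Finset.card_pos.1 (by omega : 0 < s.card)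
      have hall : ∀ t ∈ alternatingGroup α, t x = x := by
        intro t ht
        obtain ⟨g, hg, hgt⟩ := hH s hs.2 t ht
        have : (⟨g, hg.2⟩ : alternatingGroup α) ∈ H.subgroupOf (alternatingGroup α) := hg.1
        rw [hbot, Subgroup.mem_bot] at this
        rw [← hgt x hx, show g = 1 from congrArg Subtype.val this, one_apply]
      obtain ⟨y, hy⟩ := Fintype.exists_ne_of_one_lt_card (by omega) x
      exact hy (eq_of_forall_mem_alternatingGroup_fixes (by omega)
        fun g hg _ => hall g hg)
    · intro h
      obtain ⟨g, hg, hgH⟩ := htop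
      have : (⟨g, hg⟩ : alternatingGroup α) ∈ H.subgroupOf (alternatingGroup α) := h ▸ trivial
      exact hgH this
  exists_conj_mem := exists_map_eq_conj_of_odd h7 hα H hτ hτ'
  exists_eq_mul := by
    intro a R hRa t
    have hn : Nontrivial α := Fintype.one_lt_card_iff_nontrivial.1 (by omega)
    obtain ⟨s, hs, hsR⟩ := hR _ _ (index_map_subtype_dvd hRa)
    obtain ⟨g, hg, hgt⟩ := hH s hs t t.2
    refine ⟨⟨g, hg.2⟩, hg.1, ⟨g, hg.2⟩⁻¹ * t, ?_, by group⟩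
    apply mem_of_mem_map_subtype
    apply hsR _ (SetLike.coe_mem _)
    intro x hx
    simp [← hgt x hx]

/-- Point stabilizers are Frattini supplements in degrees seven and nine. -/
theorem isFrattiniSupplement_stabilizer (hα : Fintype.card α = 7 ∨ Fintype.card α = 9) (i : α) :
    IsFrattiniSupplement ((stabilizer (Perm α) i).subgroupOf (alternatingGroup α)) where
  not_normal := by
    obtain ⟨y, hy⟩ := Fintype.exists_ne_of_one_lt_card (by omega) i
    apply not_normal_of_ne (by omega)
    · intro hbot
      refine hy (eq_of_forall_mem_alternatingGroup_fixes (by omega) fun g hg hgi => ?_).symm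
      have : (⟨g, hg⟩ : alternatingGroup α) ∈
          (stabilizer (Perm α) i).subgroupOf (alternatingGroup α) := hgi
      rw [hbot, Subgroup.mem_bot] at this
      rw [show g = 1 from congrArg Subtype.val this, one_apply]
    · intro h
      refine hy (eq_of_forall_mem_alternatingGroup_fixes (by omega) fun g hg _ => ?_)
      have : (⟨g, hg⟩ : alternatingGroup α) ∈
          (stabilizer (Perm α) i).subgroupOf (alternatingGroup α) := h ▸ trivial
      exact this
  exists_conj_mem := by
    obtain ⟨x, hx, y, hy, hxy⟩ : ∃ x ∈ ({i}ᶜ : Finset α), ∃ y ∈ ({i}ᶜ : Finset α), x ≠ y := by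
      apply Finset.one_lt_card.1
      rw [Finset.card_compl, Finset.card_singleton]
      omega
    simp only [Finset.mem_compl, Finset.mem_singleton] at hx hy
    exact exists_map_eq_conj_of_odd (a := 0) (by omega) (by omega) _
      (swap_apply_of_ne_of_ne (Ne.symm hx) (Ne.symm hy)) (sign_swap hxy)
  exists_eq_mul := by
    intro a R hR t
    have hn : Nontrivial α := Fintype.one_lt_card_iff_nontrivial.1 (by omega)
    have htr := isPretransitive_of_index_dvd hα (index_map_subtype_dvd hR)
    obtain ⟨⟨r, hr⟩, hri⟩ := htr.exists_smul_eq ((t⁻¹ : alternatingGroup α) • i) i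
    obtain ⟨r, hrR, rfl⟩ := Subgroup.mem_map.1 hr
    refine ⟨t * r⁻¹, ?_, r, hrR, by group⟩
    rw [Subgroup.mem_subgroupOf, mem_stabilizer_iff]
    have h1 : r • (t⁻¹ • i) = i := hri
    show (t * r⁻¹) • i = i
    rw [mul_smul, inv_smul_eq_iff.2 h1.symm, smul_inv_smul]

/-- The Mathieu group of degree ten is a Frattini supplement. -/
theorem isFrattiniSupplement_mathieuTen :
    IsFrattiniSupplement (steinerGroup.subgroupOf (alternatingGroup (Fin 10))) := by
  refine isFrattiniSupplement_subgroupOf (k := 3) (b := 1) (by norm_num) (by simp) (by simp)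
    (by simp) _ frobeniusNine_mem sign_frobeniusNine
    exists_mem_alternatingGroup_notMem_steinerGroup (fun s hs t _ => exists_mathieuTen_eqOn hs t)
    fun a R hR => exists_card_eq_three_stabilizer_le (by simp) hR

/-- The permutations of `Fin m` that preserve congruence modulo `d`. -/
def congruenceStabilizer (m d : ℕ) : Subgroup (Perm (Fin m)) where
  carrier := {g | ∀ x y, (g x).val ≡ (g y).val [MOD d] ↔ x.val ≡ y.val [MOD d]}
  mul_mem' := fun {a b} ha hb x y => (ha _ _).trans (hb x y)
  one_mem' := fun _ _ => Iff.rfl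
  inv_mem' := fun {a} ha x y => by
    rw [← ha (a⁻¹ x), ← Perm.mul_apply, ← Perm.mul_apply, mul_inv_cancel, one_apply, one_apply]

theorem swap_mem_congruenceStabilizer {m d : ℕ} {x y : Fin m} (h : x.val ≡ y.val [MOD d]) :
    swap x y ∈ congruenceStabilizer m d := by
  have h1 : ∀ z, (swap x y z).val ≡ z.val [MOD d] := by
    intro z
    rw [swap_apply_def]
    split_ifs with h1 h2
    · rw [h1]; exact h.symm
    · rw [h2]; exact h
    · rfl
  exact fun u v => ⟨fun h => ((h1 u).symm.trans h).trans (h1 v),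
    fun h => ((h1 u).trans h).trans (h1 v).symm⟩

theorem addRight_mem_congruenceStabilizer {m d : ℕ} [NeZero m] (hd : d ∣ m) (k : Fin m) :
    Equiv.addRight k ∈ congruenceStabilizer m d := by
  intro x y
  have h1 : ∀ z : Fin m, (Equiv.addRight k z).val ≡ z.val + k.val [MOD d] := by
    intro z
    rw [Equiv.coe_addRight, Fin.val_add]
    exact (Nat.mod_modEq _ m).of_dvd hd
  exact ⟨fun h => Nat.ModEq.add_right_cancel' _ (((h1 x).symm.trans h).trans (h1 y)),
    fun h => ((h1 x).trans (h.add_right _)).trans (h1 y).symm⟩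

/-- Imprimitive wreath products are Frattini supplements. -/
theorem isFrattiniSupplement_congruenceStabilizer {m d b : ℕ} (h11 : 11 ≤ m) (h16 : m ≠ 16)
    (hm : m ∣ 2 ^ b * 15) (hdm : d ∣ m) (hd : 2 ≤ d) (hd2 : 2 * d ≤ m) :
    IsFrattiniSupplement ((congruenceStabilizer m d).subgroupOf (alternatingGroup (Fin m))) := by
  have : NeZero m := ⟨by omega⟩
  -- swaps within a residue class avoiding a given point
  have hswap : ∀ i : Fin m, ∃ u v : Fin m, u ≠ v ∧ u.val ≡ v.val [MOD d] ∧ i ≠ u ∧ i ≠ v := by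
    intro i
    by_cases hi : i.val ≡ 0 [MOD d]
    · have h1 : ¬ 1 ≡ 0 [MOD d] := by
        rw [Nat.modEq_zero_iff_dvd, Nat.dvd_one]; omega
      refine ⟨⟨1, by omega⟩, ⟨d + 1, by omega⟩, ?_, ?_, ?_, ?_⟩
      · simp [Fin.ext_iff]; omega
      · simp [Nat.ModEq]
      · rintro rfl; exact h1 hi
      · rintro rfl; exact h1 (by simpa [Nat.ModEq] using hi)
    · refine ⟨⟨0, by omega⟩, ⟨d, by omega⟩, ?_, ?_, ?_, ?_⟩
      · simp [Fin.ext_iff]; omega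
      · simp [Nat.ModEq]
      · rintro rfl; exact hi rfl
      · rintro rfl; exact hi (by simp [Nat.ModEq])
  obtain ⟨u, v, huv, huvd, -⟩ := hswap 0
  refine isFrattiniSupplement_subgroupOf (k := 1) (b := b) one_ne_zero
    (by rw [Fintype.card_fin]; omega) (by rw [Fintype.card_fin]; omega)
    (by rw [Fintype.card_fin]; exact Or.inr (Or.inr ⟨by omega, hm⟩)) _
    (swap_mem_congruenceStabilizer huvd) (sign_swap huv) ?_ ?_ ?_
  · have h01 : (⟨0, by omega⟩ : Fin m) ≠ ⟨1, by omega⟩ := by simp [Fin.ext_iff]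
    have h0d : (⟨0, by omega⟩ : Fin m) ≠ ⟨d + 1, by omega⟩ := by simp [Fin.ext_iff]
    have h1d : (⟨1, by omega⟩ : Fin m) ≠ ⟨d + 1, by omega⟩ := by simp [Fin.ext_iff]; omega
    refine ⟨swap ⟨0, by omega⟩ ⟨1, by omega⟩ * swap ⟨0, by omega⟩ ⟨d + 1, by omega⟩,
      (isThreeCycle_swap_mul_swap_same h01 h0d h1d).mem_alternatingGroup, fun h => ?_⟩
    have h2 := (h ⟨0, by omega⟩ ⟨d, by omega⟩).2 (by simp [Nat.ModEq])
    have hd0 : (⟨d, by omega⟩ : Fin m) ≠ ⟨0, by omega⟩ := by simp [Fin.ext_iff]; omega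
    have hd1 : (⟨d, by omega⟩ : Fin m) ≠ ⟨1, by omega⟩ := by simp [Fin.ext_iff]; omega
    have hdd : (⟨d, by omega⟩ : Fin m) ≠ ⟨d + 1, by omega⟩ := by simp [Fin.ext_iff]
    rw [Perm.mul_apply, Perm.mul_apply, swap_apply_left, swap_apply_of_ne_of_ne h0d.symm h1d.symm,
      swap_apply_of_ne_of_ne hd0 hdd, swap_apply_of_ne_of_ne hd0 hd1] at h2
    have h3 : 1 ≡ 0 [MOD d] := by simpa [Nat.ModEq] using h2
    rw [Nat.modEq_zero_iff_dvd, Nat.dvd_one] at h3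
    omega
  · intro s hs t _
    obtain ⟨i, rfl⟩ := Finset.card_eq_one.1 hs
    have hg := addRight_mem_congruenceStabilizer hdm (t i - i)
    have hgi : Equiv.addRight (t i - i) i = t i := by simp
    rcases Int.units_eq_one_or (sign (Equiv.addRight (t i - i))) with h | h
    · exact ⟨_, ⟨hg, mem_alternatingGroup.2 h⟩, by simp⟩
    · obtain ⟨u, v, huv, huvd, hiu, hiv⟩ := hswap i
      refine ⟨_, ⟨mul_mem hg (swap_mem_congruenceStabilizer huvd), ?_⟩, ?_⟩
      · exact mem_alternatingGroup.2 (by rw [map_mul, h, sign_swap huv]; rfl)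
      · intro x hx
        rw [Finset.mem_singleton] at hx
        rw [hx, Perm.mul_apply, swap_apply_of_ne_of_ne hiu hiv, hgi]
  · intro a R hR
    rcases alternatingGroup_le_or_exists_stabilizer_le (by simpa using h11) (by simpa using h16) hR
      with h | ⟨-, i, hi⟩
    · exact ⟨{0}, Finset.card_singleton _, fun g hg _ => h hg⟩
    · exact ⟨{i}, Finset.card_singleton _, fun g hg hgi => hi g hg (hgi i (by simp))⟩

/-- Sylow subgroups are Frattini supplements when all proper subgroups are excluded. -/
theorem exists_isFrattiniSupplement_of_not_dvd {m : ℕ} (h11 : 11 ≤ m)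
    (hm : ∀ b, ¬ m ∣ 2 ^ b * 15) :
    ∃ M : Subgroup (alternatingGroup (Fin m)), IsFrattiniSupplement M := by
  have hn : Nontrivial (Fin m) := Fin.nontrivial_iff_two_le.2 (by omega)
  have h16 : m ≠ 16 := by
    rintro rfl
    exact hm 4 (by norm_num)
  have : Fact (Nat.Prime 3) := ⟨Nat.prime_three⟩
  have : Fact (Nat.Prime 2) := ⟨Nat.prime_two⟩
  have hcard : ∀ p : ℕ, p.Prime → p ≠ 2 → p ≤ m → p ∣ Nat.card (alternatingGroup (Fin m)) := by
    intro p hp hp2 hpm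
    have h1 : p ∣ 2 * Nat.card (alternatingGroup (Fin m)) := by
      rw [two_mul_nat_card_alternatingGroup, Nat.card_perm, Nat.card_eq_fintype_card,
        Fintype.card_fin]
      exact hp.dvd_factorial.2 hpm
    rcases hp.dvd_mul.1 h1 with h | h
    · exact absurd ((Nat.prime_dvd_prime_iff_eq hp Nat.prime_two).1 h) hp2
    · exact h
  obtain ⟨P⟩ : Nonempty (Sylow 3 (alternatingGroup (Fin m))) := inferInstance
  refine ⟨P, ?_, ?_, ?_⟩
  · apply not_normal_of_ne (by rw [Fintype.card_fin]; omega)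
    · exact P.ne_bot_of_dvd_card (hcard 3 Nat.prime_three (by norm_num) (by omega))
    · intro h
      have h5 := hcard 5 Nat.prime_five (by norm_num) (by omega)
      obtain ⟨n, hn⟩ := IsPGroup.iff_card.1 P.isPGroup'
      rw [h, Subgroup.card_top] at hn
      rw [hn] at h5
      have := Nat.Prime.dvd_of_dvd_pow Nat.prime_five h5
      norm_num at this
  · intro φ
    obtain ⟨t, ht⟩ := exists_smul_eq (alternatingGroup (Fin m))
      ((show MulAut (alternatingGroup (Fin m)) from φ) • P) P
    refine ⟨t, fun g hg => ?_⟩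
    have h := Subgroup.smul_mem_pointwise_smul _ (MulAut.conj t)
      _ (Subgroup.smul_mem_pointwise_smul _ (show MulAut (alternatingGroup (Fin m)) from φ) _ hg)
    have h' := congrArg Sylow.toSubgroup ht
    rw [Sylow.coe_subgroup_smul] at h'
    exact h' ▸ h
  · intro a R hR t
    have h1 := alternatingGroup_le_or_exists_stabilizer_le (by simpa using h11)
      (by simpa using h16) (index_map_subtype_dvd hR)
    rcases h1 with h | ⟨h, -⟩
    · exact ⟨1, one_mem _, t, mem_of_mem_map_subtype (h t.2), by simp⟩
    · exact absurd (h.trans (index_map_subtype_dvd hR)) (by simpa using hm (a + 1))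

theorem exists_isFrattiniSupplement {m : ℕ} (h7 : 7 ≤ m) (h8 : m ≠ 8) (h16 : m ≠ 16) :
    ∃ M : Subgroup (alternatingGroup (Fin m)), IsFrattiniSupplement M := by
  by_cases h79 : m = 7 ∨ m = 9
  · exact ⟨_, isFrattiniSupplement_stabilizer (by simpa using h79) ⟨0, by omega⟩⟩
  by_cases h10 : m = 10
  · subst h10
    exact ⟨_, isFrattiniSupplement_mathieuTen⟩
  by_cases hm : ∃ b, m ∣ 2 ^ b * 15
  · obtain ⟨b, hb⟩ := hm
    by_cases h2 : 2 ∣ m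
    · exact ⟨_, isFrattiniSupplement_congruenceStabilizer (by omega) h16 hb h2 le_rfl (by omega)⟩
    · have h15 : m ∣ 15 := by
        refine Nat.Coprime.dvd_of_dvd_mul_left (Nat.Coprime.pow_right b ?_) hb
        exact ((Nat.Prime.coprime_iff_not_dvd Nat.prime_two).2 h2).symm
      have hle := Nat.le_of_dvd (by norm_num) h15
      have h15' : m = 15 := by
        interval_cases m <;> simp_all +decide
      subst h15'
      exact ⟨_, isFrattiniSupplement_congruenceStabilizer (d := 3) (by omega) h16 hb (by norm_num)
        (by norm_num) (by norm_num)⟩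
  · exact exists_isFrattiniSupplement_of_not_dvd (by omega) (not_exists.1 hm)

end Supplements

section Pi

variable {T ι : Type*} [Group T] [DecidableEq ι] [Finite ι]

/-- Automorphisms of a power of a finite nonabelian simple group permute the factors. -/
theorem MulEquiv.exists_pi_apply_eq [Finite T] [IsSimpleGroup T] (hT : ∃ a b : T, a * b ≠ b * a)
    (Φ : (ι → T) ≃* (ι → T)) (j : ι) : ∃ i, ∃ φ : T ≃* T, ∀ f, Φ f j = φ (f i) := by
  let ev : (ι → T) →* T := (Pi.evalMonoidHom _ j).comp Φ.toMonoidHom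
  have hev : Function.Surjective ev := fun t =>
    ⟨Φ.symm fun _ => t, by simp [ev]⟩
  let θ : ι → T →* T := fun i => ev.comp (MonoidHom.mulSingle (fun _ => T) i)
  have hnormal : ∀ i, (θ i).range.Normal := by
    intro i
    constructor
    rintro _ ⟨t, rfl⟩ s
    obtain ⟨f, rfl⟩ := hev s
    refine ⟨f i * t * (f i)⁻¹, ?_⟩
    simp only [θ, MonoidHom.comp_apply, ← map_mul, ← map_inv]
    congr 1
    ext k
    by_cases hk : k = i
    · subst hk; simp
    · simp [hk]
  obtain ⟨i, hi⟩ : ∃ i, (θ i).range = ⊤ := by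
    by_contra! h
    have hbot : ∀ i, (θ i).range = ⊥ := fun i =>
      ((hnormal i).eq_bot_or_eq_top).resolve_right (h i)
    obtain ⟨a, ha⟩ := exists_ne (1 : T)
    obtain ⟨f, rfl⟩ := hev a
    exact ha (MonoidHom.mem_ker.1 (Subgroup.pi_mem_of_mulSingle_mem f fun i => by
      have : θ i (f i) ∈ (θ i).range := ⟨_, rfl⟩
      rw [hbot i, Subgroup.mem_bot] at this
      exact MonoidHom.mem_ker.2 this))
  have hone : ∀ k, k ≠ i → ∀ t, θ k t = 1 := by
    intro k hk t
    have hcenter : Subgroup.center T = ⊥ := by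
      refine (Subgroup.Normal.eq_bot_or_eq_top inferInstance).resolve_right fun h => ?_
      obtain ⟨a, b, hab⟩ := hT
      have ha : b ∈ Subgroup.center T := h ▸ Subgroup.mem_top b
      exact hab (Subgroup.mem_center_iff.1 ha a)
    rw [← Subgroup.mem_bot, ← hcenter, Subgroup.mem_center_iff]
    intro s
    have hs : s ∈ (θ i).range := hi ▸ Subgroup.mem_top s
    obtain ⟨s, rfl⟩ := hs
    simp only [θ, MonoidHom.comp_apply, ← map_mul]
    congr 1
    exact (Pi.mulSingle_commute (f := fun _ : ι => T) hk.symm s t).eq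
  have hsurj : Function.Surjective (θ i) := MonoidHom.range_eq_top.1 hi
  refine ⟨i, MulEquiv.ofBijective (θ i) ⟨Finite.injective_iff_surjective.2 hsurj, hsurj⟩,
    fun f => ?_⟩
  have hmem : (Pi.mulSingle i (f i))⁻¹ * f ∈ ev.ker := by
    refine Subgroup.pi_mem_of_mulSingle_mem _ fun k => ?_
    by_cases hk : k = i
    · subst hk; simp
    · exact MonoidHom.mem_ker.2 (hone k hk _)
  rw [MonoidHom.mem_ker, map_mul, map_inv, inv_mul_eq_one] at hmem
  exact hmem.symm

namespace IsFrattiniSupplement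

theorem pi [Finite T] [IsSimpleGroup T] [Nonempty ι] (hT : ∃ a b : T, a * b ≠ b * a)
    {M : Subgroup T} (hM : IsFrattiniSupplement M) :
    IsFrattiniSupplement (Subgroup.pi Set.univ fun _ : ι => M) where
  not_normal h := by
    refine hM.not_normal ⟨fun s hs t => ?_⟩
    have := h.conj_mem (fun _ => s) (fun _ _ => hs) fun _ => t
    exact this (Classical.arbitrary ι) trivial
  exists_conj_mem Φ := by
    choose i φ hφ using Φ.exists_pi_apply_eq hT
    choose t ht using fun j => hM.exists_conj_mem (φ j)
    refine ⟨t, fun g hg j _ => ?_⟩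
    rw [Pi.mul_apply, Pi.mul_apply, Pi.inv_apply, hφ]
    exact ht j _ (hg _ trivial)
  exists_eq_mul a R hR f := by
    have h : ∀ i, ∃ s ∈ M, ∃ r ∈ R.comap (MonoidHom.mulSingle (fun _ => T) i), f i = s * r := by
      intro i
      refine hM.exists_eq_mul a _ (dvd_trans ?_ hR) (f i)
      rw [Subgroup.index_comap]
      have : (MonoidHom.mulSingle (fun _ : ι => T) i).range.Normal := by
        constructor
        rintro _ ⟨t, rfl⟩ g
        refine ⟨g i * t * (g i)⁻¹, ?_⟩
        ext k
        by_cases hk : k = i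
        · subst hk; simp
        · simp [hk]
      exact Subgroup.relIndex_dvd_index_of_normal_right _ _
    choose s hs r hr hsr using h
    exact ⟨s, fun i _ => hs i, r, Subgroup.pi_mem_of_mulSingle_mem r hr, funext hsr⟩

theorem comap {L : Type*} [Group L] {M : Subgroup T} (hM : IsFrattiniSupplement M) (e : L ≃* T) :
    IsFrattiniSupplement (M.comap e.toMonoidHom) where
  not_normal h := hM.not_normal ⟨fun s hs t => by
    simpa using h.conj_mem (e.symm s) (by simpa using hs) (e.symm t)⟩
  exists_conj_mem φ := by
    obtain ⟨t, ht⟩ := hM.exists_conj_mem ((e.symm.trans φ).trans e)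
    exact ⟨e.symm t, fun g hg => by simpa using ht (e g) hg⟩
  exists_eq_mul a R hR t := by
    obtain ⟨s, hs, r, hr, h⟩ := hM.exists_eq_mul a (R.map e.toMonoidHom)
      (by rwa [show R.map e.toMonoidHom = R.map (e : L →* T) from rfl, Subgroup.index_map_equiv])
      (e t)
    obtain ⟨r, hr, rfl⟩ := hr
    exact ⟨e.symm s, by simpa using hs, r, hr, e.injective (by simpa using h)⟩

/-- A Frattini argument: supplements in `G` of a subgroup `A` of index dividing `2 ^ a * 15`
include the normalizer of a Frattini supplement in a normal subgroup. -/
theorem exists_supplement_ne_top {G : Type*} [Group G] [Finite G] {L A : Subgroup G} [L.Normal]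
    {M : Subgroup L} (hM : IsFrattiniSupplement M) {a : ℕ} (hA : A.index ∣ 2 ^ a * 15) :
    ∃ H : Subgroup G, H ≠ ⊤ ∧ ∀ g, ∃ h ∈ H, ∃ b ∈ A, g = h * b := by
  refine ⟨Subgroup.normalizer (M.map L.subtype : Set G), fun htop => ?_, fun g => ?_⟩
  · refine hM.not_normal ⟨fun s hs t => ?_⟩
    have ht : (t : G) ∈ Subgroup.normalizer (M.map L.subtype : Set G) := htop ▸ Subgroup.mem_top _
    obtain ⟨s', hs', h⟩ := (Subgroup.mem_normalizer_iff.1 ht s).1 ⟨s, hs, rfl⟩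
    have : s' = t * s * t⁻¹ := Subtype.ext (by simpa using h)
    exact this ▸ hs'
  · obtain ⟨t, ht⟩ := hM.exists_conj_mem (MulAut.conjNormal g : MulAut L)
    obtain ⟨s, hs, r, hr, htr⟩ := hM.exists_eq_mul a (A.subgroupOf L)
      ((Subgroup.relIndex_dvd_index_of_normal_right A L).trans hA) (MulAut.conjNormal g⁻¹ t⁻¹)
    have hmem : (t : G) * g ∈ Subgroup.normalizer (M.map L.subtype : Set G) := by
      refine Subgroup.mem_normalizer_fintype ?_
      rintro _ ⟨x, hx, rfl⟩
      exact ⟨_, ht x hx, by simp [mul_assoc]⟩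
    have hs' : (s : G) ∈ Subgroup.normalizer (M.map L.subtype : Set G) :=
      Subgroup.le_normalizer ⟨s, hs, rfl⟩
    refine ⟨t * g * s, mul_mem hmem hs', r, hr, ?_⟩
    have h := congrArg (Subtype.val) htr
    simp at h
    rw [mul_assoc, ← h]
    group

end IsFrattiniSupplement

end Pi

/-- The preimage of a subgroup supplementing the image of a point stabilizer of a transitive group
is transitive. -/
theorem MulAction.isPretransitive_comap_of_forall_exists_eq_mul {G Ω : Type*} [Group G]
    [MulAction G Ω] [MulAction.IsPretransitive G Ω] {Q : Type*} [Group Q] (f : G →* Q)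
    (ω : Ω) {H : Subgroup Q}
    (h : ∀ q, ∃ k ∈ H, ∃ b ∈ (MulAction.stabilizer G ω).map f, q = k * b) :
    MulAction.IsPretransitive (H.comap f) Ω := by
  refine (MulAction.isPretransitive_iff_base ω).2 fun y => ?_
  obtain ⟨g, rfl⟩ := MulAction.exists_smul_eq G ω y
  obtain ⟨k, hk, _, ⟨b, hb, rfl⟩, hg⟩ := h (f g)
  refine ⟨⟨g * b⁻¹, ?_⟩, ?_⟩
  · rw [Subgroup.mem_comap, map_mul, map_inv, hg, mul_inv_cancel_right]
    exact hk
  · rw [Subgroup.mk_smul, mul_smul, MulAction.mem_stabilizer_iff.1 (inv_mem hb)]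

/-- **Theorem 3.1(ii), alternating case.** If a nonabelian chief factor `W` of an insoluble
minimal transitive permutation group of degree `n = 2^x·3^y·5^z` (`0 ≤ y, z ≤ 1`) is
isomorphic to `(Alt_m)^e` with `m ≥ 7` and `e ≥ 1`, then `m = 8` or `m = 16`. -/
theorem minimal_transitive_chief_factor_alternating
    {Ω : Type*} [Fintype Ω] (G : Subgroup (Equiv.Perm Ω))
    (htrans : MulAction.IsPretransitive G Ω)
    (hmin : ∀ H : Subgroup (Equiv.Perm Ω), H < G → ¬ MulAction.IsPretransitive H Ω)
    (hinsol : ¬ IsSolvable G)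
    (x y z : ℕ) (hy : y ≤ 1) (hz : z ≤ 1)
    (hcard : Fintype.card Ω = 2 ^ x * 3 ^ y * 5 ^ z)
    (N : Subgroup G) [N.Normal] (W : Subgroup (G ⧸ N))
    (hWnormal : W.Normal) (hWbot : W ≠ ⊥)
    (hWmin : ∀ W' : Subgroup (G ⧸ N), W'.Normal → W' ≠ ⊥ → W' ≤ W → W' = W)
    (hWnonab : ¬ ∀ a ∈ W, ∀ b ∈ W, a * b = b * a)
    (m e : ℕ) (hm : 7 ≤ m) (he : 1 ≤ e)
    (hiso : Nonempty (W ≃* (Fin e → alternatingGroup (Fin m)))) :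
    m = 8 ∨ m = 16 := by
  by_contra! h
  obtain ⟨h8, h16⟩ := h
  obtain ⟨M, hM⟩ := exists_isFrattiniSupplement hm h8 h16
  obtain ⟨φ⟩ := hiso
  have : IsSimpleGroup (alternatingGroup (Fin m)) :=
    alternatingGroup.isSimpleGroup (by simpa using (show 5 ≤ m by omega))
  have : Nonempty (Fin e) := ⟨⟨0, he⟩⟩
  have hT : ∃ a b : alternatingGroup (Fin m), a * b ≠ b * a := by
    by_contra! hcomm
    exact hM.not_normal ⟨fun s hs t => by rwa [hcomm t s, mul_inv_cancel_right]⟩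
  have hcard0 : Fintype.card Ω ≠ 0 := by rw [hcard]; positivity
  obtain ⟨ω⟩ : Nonempty Ω := Fintype.card_pos_iff.1 (Nat.pos_of_ne_zero hcard0)
  have hindex : (MulAction.stabilizer G ω).index ∣ 2 ^ x * 15 := by
    rw [MulAction.index_stabilizer_of_transitive, Nat.card_eq_fintype_card, hcard, mul_assoc]
    refine mul_dvd_mul_left _ ?_
    interval_cases y <;> interval_cases z <;> norm_num
  obtain ⟨H, hH, hsup⟩ := ((hM.pi hT).comap φ).exists_supplement_ne_top
    (((MulAction.stabilizer G ω).index_map_dvd (QuotientGroup.mk'_surjective N)).trans hindex)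
  have htransH := MulAction.isPretransitive_comap_of_forall_exists_eq_mul _ ω hsup
  refine hmin ((H.comap (QuotientGroup.mk' N)).map G.subtype) ?_ ?_
  · refine lt_of_le_of_ne (Subgroup.map_subtype_le _) fun heq => hH ?_
    rw [eq_top_iff]
    intro q _
    obtain ⟨g, rfl⟩ := QuotientGroup.mk'_surjective N q
    have hg : (g : Equiv.Perm Ω) ∈ (H.comap (QuotientGroup.mk' N)).map G.subtype := heq.ge g.2
    exact (Subgroup.mem_map_iff_mem G.subtype_injective).1 hg
  · refine ⟨fun a b => ?_⟩
    obtain ⟨g, hg⟩ := MulAction.exists_smul_eq (H.comap (QuotientGroup.mk' N)) a b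
    exact ⟨⟨_, Subgroup.mem_map_of_mem _ g.2⟩, hg⟩
end

section
/- Let G be an insoluble minimal transitive permutation group of degree n = 2^x·3^y·5^z, where 0 ≤ y ≤ 1 and 0 ≤ z ≤ 1. Let N be a normal subgroup of G and let W be a minimal normal subgroup of G/N that is not abelian (i.e., W is a nonabelian chief factor of G). If W is isomorphic to a direct product PSL(2,q)^e of e ≥ 1 copies of PSL(2,q) := SL₂(𝔽_q)/Z(SL₂(𝔽_q)) for some prime power q ≥ 11, then q has the form q = 2^{x₁}·3^{y₁}·5^{z₁} − 1 with x₁ ≥ 0 and 0 ≤ y₁, z₁ ≤ 1. -/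
namespace MinimalTransitive

open MulAction Matrix

/-- In a finite group, intersecting a subgroup with a normal subgroup gives an index
dividing the original one. -/
lemma relIndex_dvd_index {S : Type*} [Group S] [Finite S] (H K : Subgroup S) [K.Normal] :
    H.relIndex K ∣ H.index := by
  have h1 := Subgroup.relIndex_mul_relIndex (H ⊓ K) H (H ⊔ K) inf_le_left le_sup_left
  have h2 := Subgroup.relIndex_mul_relIndex (H ⊓ K) K (H ⊔ K) inf_le_right le_sup_right
  rw [← h2, Subgroup.relIndex_sup_right, Subgroup.inf_relIndex_left, Subgroup.inf_relIndex_right,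
    mul_comm] at h1
  have h3 : H.relIndex (H ⊔ K) = H.relIndex K :=
    Nat.eq_of_mul_eq_mul_right
      (Nat.pos_of_ne_zero (Subgroup.index_ne_zero_of_finite (H := K.subgroupOf H))) h1
  rw [← h3]
  exact Subgroup.relIndex_dvd_index_of_le le_sup_left

/-- A group acting with trivial stabilizers on an invariant set has order dividing the size
of that set. -/
lemma card_dvd_ncard_of_free {H X : Type*} [Group H] [Finite H] [Finite X] [MulAction H X]
    (s : Set X) (hs : ∀ h : H, ∀ x ∈ s, h • x ∈ s)
    (hfree : ∀ h : H, ∀ x ∈ s, h • x = x → h = 1) : Nat.card H ∣ s.ncard := by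
  classical
  cases nonempty_fintype H
  cases nonempty_fintype X
  let Y : SubMulAction H X := ⟨s, fun h {x} hx => hs h x hx⟩
  have hY : Nat.card Y = s.ncard := Nat.card_coe_set_eq s
  have key := sum_card_fixedBy_eq_card_orbits_mul_card_group H Y
  rw [Finset.sum_eq_single 1] at key
  · have h1 : fixedBy Y (1 : H) = Set.univ := by ext; simp
    rw [← hY, Nat.card_eq_fintype_card, Nat.card_eq_fintype_card]
    refine ⟨_, Eq.trans ?_ (key.trans (mul_comm _ _))⟩
    simp [h1]
  · intro h _ hne
    rw [Fintype.card_eq_zero_iff]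
    refine ⟨fun y => hne ?_⟩
    exact hfree h y.1.1 y.1.2 (congrArg Subtype.val y.2)
  · simp

/-- The Frattini argument for chief factors of a minimal transitive group: a proper Sylow
normalizer of a normal section does not factorize that section together with the image of a
point stabilizer. -/
lemma exists_not_mem_mul {S Ω : Type*} [Group S] [Finite S] [Finite Ω] [MulAction S Ω]
    [IsPretransitive S Ω] [Nonempty Ω]
    (hmin : ∀ H : Subgroup S, IsPretransitive H Ω → H = ⊤)
    (N : Subgroup S) [N.Normal] (W : Subgroup (S ⧸ N)) [W.Normal] :
    ∃ A : Subgroup W, A.index ∣ Nat.card Ω ∧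
      ∀ (p : ℕ) [Fact p.Prime] (P : Sylow p W), ¬ ((P : Subgroup W).map W.subtype).Normal →
        ∃ w : W, ∀ n ∈ Subgroup.normalizer ((P : Subgroup W) : Set W), ∀ a ∈ A, w ≠ n * a := by
  obtain ⟨α⟩ := ‹Nonempty Ω›
  let π := QuotientGroup.mk' N
  let L := W.comap π
  let f : L →* W := (π.comp L.subtype).codRestrict W (fun l => l.2)
  have hf : Function.Surjective f := by
    rintro ⟨w, hw⟩
    obtain ⟨s, rfl⟩ := QuotientGroup.mk'_surjective N w
    exact ⟨⟨s, hw⟩, rfl⟩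
  refine ⟨((stabilizer S α).subgroupOf L).map f, ?_, ?_⟩
  · refine (Subgroup.index_map_dvd _ hf).trans ((relIndex_dvd_index _ L).trans ?_)
    rw [index_stabilizer_of_transitive]
  · intro p _ P hP
    by_contra! hcon
    let R := Subgroup.normalizer (((P : Subgroup W).map W.subtype : Subgroup (S ⧸ N)) : Set (S ⧸ N))
    have hR : R.comap π = ⊤ := by
      refine hmin _ ⟨fun β γ => ?_⟩
      have key : ∀ γ : Ω, ∃ h : R.comap π, h • α = γ := by
        intro γ
        obtain ⟨g, rfl⟩ := exists_smul_eq S α γ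
        have hg : π g ∈ R ⊔ W := by
          rw [Sylow.normalizer_sup_eq_top P]; trivial
        obtain ⟨n, hn, w, hw, hnw⟩ := Subgroup.mem_sup_of_normal_right.1 hg
        obtain ⟨n', hn', a, ha, hwa⟩ := hcon ⟨w, hw⟩
        obtain ⟨l, hl, rfl⟩ := ha
        refine ⟨⟨g * (l : S)⁻¹, ?_⟩, ?_⟩
        · have h1 : (n' : S ⧸ N) ∈ R := by
            have := Subgroup.le_normalizer_map (H := (P : Subgroup W)) W.subtype
              (Subgroup.mem_map_of_mem _ hn')
            exact this
          have h2 : π (g * (l : S)⁻¹) = n * n' := by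
            have h3 : w = n' * π l := congrArg Subtype.val hwa
            rw [map_mul, ← hnw, h3, map_inv]
            group
          change π (g * (l : S)⁻¹) ∈ R
          rw [h2]
          exact mul_mem hn h1
        · have hl' : (l : S) • α = α := hl
          change (g * (l : S)⁻¹) • α = g • α
          rw [mul_smul, inv_smul_eq_iff.2 hl'.symm]
      obtain ⟨h, rfl⟩ := key β
      obtain ⟨h', rfl⟩ := key γ
      exact ⟨h' * h⁻¹, by simp [mul_smul]⟩
    apply hP
    rw [← Subgroup.normalizer_eq_top_iff, eq_top_iff]
    intro x _
    obtain ⟨s, rfl⟩ := QuotientGroup.mk'_surjective N x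
    have : s ∈ R.comap π := hR ▸ Subgroup.mem_top s
    exact this

section ProjectiveLine

variable {F : Type*} [Field F] [DecidableEq F]

/-- The action of `SL₂(F)` on the projective line by Möbius transformations. -/
noncomputable instance projectiveLineAction :
    MulAction (SpecialLinearGroup (Fin 2) F) (OnePoint F) :=
  MulAction.compHom _ SpecialLinearGroup.toGL

lemma smul_def (g : SpecialLinearGroup (Fin 2) F) (x : OnePoint F) :
    g • x = SpecialLinearGroup.toGL g • x := rfl

lemma smul_infty (g : SpecialLinearGroup (Fin 2) F) :
    g • (OnePoint.infty : OnePoint F) =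
      if g 1 0 = 0 then OnePoint.infty else ((g 0 0 / g 1 0 : F) : OnePoint F) := by
  rw [smul_def, OnePoint.smul_infty_eq_ite]; rfl

lemma mem_stabilizer_infty (g : SpecialLinearGroup (Fin 2) F) :
    g ∈ stabilizer (SpecialLinearGroup (Fin 2) F) (OnePoint.infty : OnePoint F) ↔ g 1 0 = 0 := by
  rw [mem_stabilizer_iff, smul_def, OnePoint.smul_infty_eq_self_iff]; rfl

omit [DecidableEq F] in
lemma diag_mul_diag {g : SpecialLinearGroup (Fin 2) F} (hg : g 1 0 = 0) :
    g 0 0 * g 1 1 = 1 := by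
  have := g.det_coe
  rw [det_fin_two, hg, mul_zero, sub_zero] at this
  exact this

lemma smul_coe {g : SpecialLinearGroup (Fin 2) F} (hg : g 1 0 = 0) (c : F) :
    g • (c : OnePoint F) = ((g 0 0 * g 0 0 * c + g 0 0 * g 0 1 : F) : OnePoint F) := by
  have h1 := diag_mul_diag hg
  have h2 : g 1 1 ≠ 0 := right_ne_zero_of_mul_eq_one h1
  have h3 : (SpecialLinearGroup.toGL g) 1 0 = 0 := hg
  have h4 : (SpecialLinearGroup.toGL g) 1 1 = g 1 1 := rfl
  have h5 : (SpecialLinearGroup.toGL g) 0 1 = g 0 1 := rfl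
  have h6 : (SpecialLinearGroup.toGL g) 0 0 = g 0 0 := rfl
  rw [smul_def, OnePoint.smul_some_eq_ite, h3, h4, h5, h6, zero_mul, zero_add, if_neg h2]
  congr 1
  rw [div_eq_iff h2]
  linear_combination -(g 0 0 * c + g 0 1) * h1

instance isPretransitive_projectiveLine :
    IsPretransitive (SpecialLinearGroup (Fin 2) F) (OnePoint F) := by
  have key : ∀ x : OnePoint F, ∃ g : SpecialLinearGroup (Fin 2) F,
      g • (OnePoint.infty : OnePoint F) = x := by
    intro x
    induction x using OnePoint.rec with
    | infty => exact ⟨1, one_smul _ _⟩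
    | coe c =>
      refine ⟨⟨!![c, -1; 1, 0], by simp [det_fin_two]⟩, ?_⟩
      exact (smul_infty _).trans ((if_neg one_ne_zero).trans (congrArg _ (div_one c)))
  refine ⟨fun x y => ?_⟩
  obtain ⟨g, rfl⟩ := key x
  obtain ⟨h, rfl⟩ := key y
  exact ⟨h * g⁻¹, by simp [mul_smul]⟩

variable (F) in
/-- The upper left entry, as a character of the stabilizer of infinity. -/
noncomputable def diagHom :
    stabilizer (SpecialLinearGroup (Fin 2) F) (OnePoint.infty : OnePoint F) →* Fˣ :=
  MonoidHom.toHomUnits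
    { toFun := fun g => (g : SpecialLinearGroup (Fin 2) F) 0 0
      map_one' := by simp
      map_mul' := fun g h => by
        have := (mem_stabilizer_infty _).1 h.2
        simp [Matrix.mul_apply, Fin.sum_univ_two, this] }

lemma coe_diagHom (g : stabilizer (SpecialLinearGroup (Fin 2) F) (OnePoint.infty : OnePoint F)) :
    (diagHom F g : F) = (g : SpecialLinearGroup (Fin 2) F) 0 0 := rfl

variable (F) in
/-- The parametrization of upper triangular matrices. -/
noncomputable def stabilizerEquiv :
    stabilizer (SpecialLinearGroup (Fin 2) F) (OnePoint.infty : OnePoint F) ≃ Fˣ × F where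
  toFun g := (diagHom F g, (g : SpecialLinearGroup (Fin 2) F) 0 1)
  invFun a := ⟨⟨!![(a.1 : F), a.2; 0, ((a.1⁻¹ : Fˣ) : F)], by simp [det_fin_two]⟩,
    (mem_stabilizer_infty _).2 rfl⟩
  left_inv g := by
    have h0 := (mem_stabilizer_infty _).1 g.2
    have h1 := diag_mul_diag h0
    apply Subtype.ext
    ext i j
    fin_cases i <;> fin_cases j
    · rfl
    · rfl
    · exact h0.symm
    · simp [coe_diagHom, inv_eq_of_mul_eq_one_right h1]
  right_inv a := by
    refine Prod.ext (Units.ext ?_) ?_ <;> simp [coe_diagHom]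

lemma diagHom_surjective : Function.Surjective (diagHom F) := fun a =>
  ⟨(stabilizerEquiv F).symm (a, 0), congrArg Prod.fst ((stabilizerEquiv F).apply_symm_apply (a, 0))⟩

/-- An upper triangular matrix with trivial character fixing a finite point is trivial. -/
lemma eq_one_of_smul_coe
    (g : stabilizer (SpecialLinearGroup (Fin 2) F) (OnePoint.infty : OnePoint F))
    (hg : diagHom F g = 1) {c : F}
    (hc : (g : SpecialLinearGroup (Fin 2) F) • (c : OnePoint F) = c) : g = 1 := by
  apply (stabilizerEquiv F).injective
  have h0 : (g : SpecialLinearGroup (Fin 2) F) 0 0 = 1 := by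
    rw [← coe_diagHom, hg]; rfl
  rw [smul_coe ((mem_stabilizer_infty _).1 g.2), OnePoint.coe_eq_coe, h0] at hc
  refine Prod.ext ?_ ?_
  · change diagHom F g = diagHom F 1
    rw [hg, map_one]
  · change (g : SpecialLinearGroup (Fin 2) F) 0 1 = (1 : SpecialLinearGroup (Fin 2) F) 0 1
    have h1 : (g : SpecialLinearGroup (Fin 2) F) 0 1 = 0 := by linear_combination hc
    rw [h1]
    rfl

lemma card_stabilizer_infty :
    Nat.card (stabilizer (SpecialLinearGroup (Fin 2) F) (OnePoint.infty : OnePoint F)) =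
      Nat.card Fˣ * Nat.card F := by
  rw [Nat.card_congr (stabilizerEquiv F), Nat.card_prod]

/-- Orbit-stabilizer for a subgroup acting on the projective line, inside the stabilizer of
infinity. -/
lemma card_orbit_mul_card (M : Subgroup (SpecialLinearGroup (Fin 2) F)) :
    (orbit M (OnePoint.infty : OnePoint F)).ncard *
      Nat.card (M.subgroupOf (stabilizer (SpecialLinearGroup (Fin 2) F)
        (OnePoint.infty : OnePoint F))) = Nat.card M := by
  rw [← index_stabilizer, ← Subgroup.index_mul_card (stabilizer M (OnePoint.infty : OnePoint F))]
  congr 1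
  refine Nat.card_congr ⟨fun g => ⟨⟨g.1.1, g.2⟩, g.1.2⟩, fun g => ⟨⟨g.1.1, g.2⟩, g.1.2⟩,
    fun _ => rfl, fun _ => rfl⟩

variable [Finite F]

lemma card_sl_two : Nat.card (SpecialLinearGroup (Fin 2) F) =
    Nat.card Fˣ * Nat.card F * (Nat.card F + 1) := by
  rw [← Subgroup.card_mul_index
    (stabilizer (SpecialLinearGroup (Fin 2) F) (OnePoint.infty : OnePoint F)),
    index_stabilizer_of_transitive, show Nat.card (OnePoint F) = Nat.card F + 1 from Finite.card_option,
    card_stabilizer_infty]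

lemma card_ker_diagHom : Nat.card (diagHom F).ker = Nat.card F := by
  have h := Subgroup.card_mul_index (diagHom F).ker
  rw [Subgroup.index_ker, MonoidHom.range_eq_top.2 diagHom_surjective, Subgroup.card_top,
    card_stabilizer_infty, mul_comm] at h
  exact Nat.eq_of_mul_eq_mul_left Nat.card_pos h

end ProjectiveLine

/-- Numbers of the form `2 ^ x * 3 ^ y * 5 ^ z` with `y, z ≤ 1`. -/
def IsAdmissible (n : ℕ) : Prop :=
  ∃ x y z : ℕ, y ≤ 1 ∧ z ≤ 1 ∧ n = 2 ^ x * 3 ^ y * 5 ^ z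

lemma IsAdmissible.of_dvd {m n : ℕ} (hn : IsAdmissible n) (h : m ∣ n) : IsAdmissible m := by
  obtain ⟨x, y, z, hy, hz, rfl⟩ := hn
  obtain ⟨a, c, hab, hc, rfl⟩ := exists_dvd_and_dvd_of_dvd_mul h
  obtain ⟨a, b, ha, hb, rfl⟩ := exists_dvd_and_dvd_of_dvd_mul hab
  obtain ⟨x', -, rfl⟩ := (Nat.dvd_prime_pow Nat.prime_two).1 ha
  obtain ⟨y', hy', rfl⟩ := (Nat.dvd_prime_pow Nat.prime_three).1 hb
  obtain ⟨z', hz', rfl⟩ := (Nat.dvd_prime_pow Nat.prime_five).1 hc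
  exact ⟨x', y', z', hy'.trans hy, hz'.trans hz, rfl⟩

lemma IsAdmissible.dvd_two_pow_mul {n : ℕ} (hn : IsAdmissible n) : ∃ x, n ∣ 2 ^ x * 15 := by
  obtain ⟨x, y, z, hy, hz, rfl⟩ := hn
  refine ⟨x, ?_⟩
  rw [mul_assoc]
  refine mul_dvd_mul_left _ ?_
  interval_cases y <;> interval_cases z <;> norm_num

lemma IsAdmissible.not_prime_sq_dvd {n p : ℕ} (hn : IsAdmissible n) (hp : p.Prime) (h2 : p ≠ 2) :
    ¬ p ^ 2 ∣ n := by
  intro h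
  obtain ⟨x, hx⟩ := hn.dvd_two_pow_mul
  have hc : Nat.Coprime (p ^ 2) (2 ^ x) :=
    Nat.Coprime.pow _ _ ((Nat.coprime_primes hp Nat.prime_two).2 h2)
  have h15 := hc.dvd_of_dvd_mul_left (h.trans hx)
  have : p ≤ 3 := by
    have := Nat.le_of_dvd (by norm_num) h15
    nlinarith
  have := hp.two_le
  interval_cases p <;> simp_all

lemma IsAdmissible.prime_dvd {n p : ℕ} (hn : IsAdmissible n) (hp : p.Prime) (h2 : p ≠ 2)
    (h : p ∣ n) : p = 3 ∨ p = 5 := by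
  obtain ⟨x, hx⟩ := hn.dvd_two_pow_mul
  have hc : Nat.Coprime p (2 ^ x) :=
    Nat.Coprime.pow_right _ ((Nat.coprime_primes hp Nat.prime_two).2 h2)
  have h15 : p ∣ 3 * 5 := hc.dvd_of_dvd_mul_left (h.trans hx)
  rcases hp.dvd_mul.1 h15 with h | h
  · exact .inl ((Nat.prime_dvd_prime_iff_eq hp Nat.prime_three).1 h)
  · exact .inr ((Nat.prime_dvd_prime_iff_eq hp Nat.prime_five).1 h)

/-- The arithmetic of an orbit on the projective line over a field of odd characteristic. -/
lemma orbit_arith_odd {p k q i o j n σ v : ℕ} (hp : p.Prime) (hp2 : p ≠ 2) (hq : q = p ^ k)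
    (hq11 : 11 ≤ q) (hi : IsAdmissible i) (hio : i * o = (q + 1) * j) (hj : j ∣ q * (q - 1))
    (ho : o = 1 + n * σ) (hoq : o ≤ q + 1) (hσ : σ * p ^ v = q) (hv : p ^ v ∣ i) :
    o = q + 1 ∨ q + 1 ∣ i := by
  rcases Nat.eq_zero_or_pos n with rfl | hn
  · right
    rw [zero_mul, add_zero] at ho
    rw [ho, mul_one] at hio
    exact ⟨j, hio⟩
  have hv1 : v < 2 := by
    by_contra! h
    exact hi.not_prime_sq_dvd hp hp2 ((pow_dvd_pow p h).trans hv)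
  left
  interval_cases v
  · rw [pow_zero, mul_one] at hσ
    subst hσ
    nlinarith
  rw [pow_one] at hσ hv
  have hnp : n ≤ p := by
    have h1 : n * σ ≤ p * σ := by rw [mul_comm p, hσ]; omega
    exact Nat.le_of_mul_le_mul_right h1 (by
      rcases Nat.eq_zero_or_pos σ with rfl | h
      · omega
      · exact h)
  rcases hnp.eq_or_lt with rfl | hlt
  · rw [ho, mul_comm n, hσ, add_comm]
  exfalso
  have hσk : ∃ l, k = l + 2 := by
    have hp5 : p ≤ 5 := by rcases hi.prime_dvd hp hp2 hv with h | h <;> omega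
    refine ⟨k - 2, ?_⟩
    by_contra hk
    have hk1 : k ≤ 1 := by omega
    have := Nat.pow_le_pow_right hp.pos hk1
    rw [pow_one, ← hq] at this
    omega
  obtain ⟨l, rfl⟩ := hσk
  have hσp : σ = p ^ l * p := by
    refine Nat.eq_of_mul_eq_mul_right hp.pos ?_
    rw [hσ, hq]; ring
  have hcop : Nat.Coprime o q := by
    rw [hq]
    refine Nat.Coprime.pow_right _ ?_
    rw [ho, hσp, ← mul_assoc]
    simp
  have hdvd : o ∣ (q + 1) * (q - 1) := by
    refine hcop.dvd_of_dvd_mul_left ?_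
    have h1 : o ∣ (q + 1) * j := ⟨i, by rw [← hio, mul_comm]⟩
    refine h1.trans ((mul_dvd_mul_left _ hj).trans (dvd_of_eq (by ring)))
  have hle : o ≤ p ^ 2 - n ^ 2 := by
    have hlt2 : n ^ 2 < p ^ 2 := Nat.pow_lt_pow_left hlt two_ne_zero
    refine Nat.le_of_dvd (by omega) ?_
    zify [hlt2.le]
    have h1 : (o : ℤ) ∣ ((q : ℤ) + 1) * (q - 1) := by
      have := Int.natCast_dvd_natCast.2 hdvd
      rwa [Nat.cast_mul, Nat.cast_sub (by omega), Nat.cast_add, Nat.cast_one] at this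
    have h2 : (p : ℤ) ^ 2 - n ^ 2 =
        n ^ 2 * (((q : ℤ) + 1) * (q - 1)) - o * (p ^ 2 * (o - 2)) := by
      have e1 : (q : ℤ) = σ * p := by rw [← hσ]; push_cast; ring
      have e2 : (o : ℤ) = 1 + n * σ := by rw [ho]; push_cast; ring
      rw [e1, e2]; ring
    rw [h2]
    exact dvd_sub (h1.mul_left _) (dvd_mul_right _ _)
  rcases hi.prime_dvd hp hp2 hv with rfl | rfl
  · rcases l with _ | l
    · simp at hq; omega
    · have : 9 ≤ σ := by
        rw [hσp, pow_succ]
        have := Nat.one_le_pow l 3 (by norm_num)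
        omega
      interval_cases n <;> omega
  · rcases l with _ | l
    · have h13 : 13 ∣ i * o := by rw [hio, hq]; exact ⟨2 * j, by ring⟩
      rcases (Nat.Prime.dvd_mul (by norm_num)).1 h13 with h | h
      · rcases hi.prime_dvd (p := 13) (by norm_num) (by norm_num) h with h | h <;> omega
      · rw [ho, hσp] at h
        interval_cases n <;> omega
    · have : 25 ≤ σ := by
        rw [hσp, pow_succ]
        have := Nat.one_le_pow l 5 (by norm_num)
        omega
      interval_cases n <;> omega

/-- The arithmetic of an orbit on the projective line over a field of characteristic two. -/
lemma orbit_arith_two {f q i o u r m δ : ℕ} (hq : q = 2 ^ f) (hq11 : 11 ≤ q)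
    (hi : IsAdmissible i) (hur : u * r + 1 = q) (hio : u * (q + 1) ∣ i * o)
    (ho : o = δ + m * r) (hδ : 1 ≤ δ) (hδ2 : δ ≤ 2) (hoq : o ≤ q + 1) : o = q + 1 := by
  have hf : 4 ≤ f := by
    by_contra! h
    interval_cases f <;> omega
  obtain ⟨x, hx⟩ := hi.dvd_two_pow_mul
  have hqodd : q % 2 = 0 := by
    rw [hq, show f = (f - 1) + 1 by omega, pow_succ]; omega
  have huodd : u % 2 = 1 := by
    rcases Nat.mod_two_eq_zero_or_one u with h | h
    · have : u * r % 2 = 0 := by rw [Nat.mul_mod, h]; simp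
      omega
    · exact h
  have hdvd : u * (q + 1) ∣ 15 * o := by
    have hc : Nat.Coprime (u * (q + 1)) (2 ^ x) := by
      refine Nat.Coprime.pow_right _ (Nat.Coprime.symm ?_)
      rw [Nat.prime_two.coprime_iff_not_dvd]
      intro h
      rcases Nat.prime_two.dvd_mul.1 h with h | h <;> omega
    refine hc.dvd_of_dvd_mul_left (hio.trans ?_)
    rw [← mul_assoc]
    exact mul_dvd_mul_right hx o
  obtain ⟨w, hw⟩ := hdvd
  obtain ⟨t, ht⟩ : ∃ t, t = u * w := ⟨_, rfl⟩
  have hto : 15 * o = t * (q + 1) := by rw [hw, ht]; ring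
  have ht15 : t ≤ 15 := by nlinarith
  have ht1 : 1 ≤ t := by
    rcases Nat.eq_zero_or_pos t with rfl | h
    · omega
    · exact h
  have hu15 : u ≤ t := Nat.le_of_dvd ht1 ⟨w, ht⟩
  have h16 : ∀ n, 16 ^ n % 15 = 1 := fun n => by rw [Nat.pow_mod]; simp
  have hq15 : q = 16 ^ (f / 4) * 2 ^ (f % 4) := by
    rw [hq, show (16 : ℕ) = 2 ^ 4 by norm_num, ← pow_mul, ← pow_add, Nat.div_add_mod]
  have h16n := h16 (f / 4)
  have h16le : 16 ^ 1 ≤ 16 ^ (f / 4) := Nat.pow_le_pow_right (by norm_num) (by omega)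
  have hf4 : f % 4 < 4 := Nat.mod_lt _ (by norm_num)
  have hr : 15 * δ + 15 * (m * r) = t * (u * r + 2) := by rw [← mul_add, ← ho, hto, ← hur]
  generalize 16 ^ (f / 4) = Q at *
  by_contra hne
  have ht14 : t ≤ 14 := by
    by_contra! h
    obtain rfl : t = 15 := by omega
    omega
  have hq16 : 2 ^ 4 ≤ q := hq ▸ Nat.pow_le_pow_right (by norm_num) hf
  have hr2 : 2 ≤ r := by
    by_contra! h
    interval_cases r <;> omega
  have hmu : m ≤ u := by
    have h1 : m * r < (u + 1) * r := by
      rw [add_mul]; omega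
    exact Nat.lt_succ_iff.1 (Nat.lt_of_mul_lt_mul_right h1)
  clear hio hx hq ho hi hw hne
  generalize f % 4 = s at *
  have hs : s = 0 ∨ s = 1 ∨ s = 2 ∨ s = 3 := by omega
  rcases hs with rfl | rfl | rfl | rfl <;> norm_num at hq15 <;> interval_cases t <;>
    (try (exfalso; omega)) <;> interval_cases u <;> (try (exfalso; omega)) <;>
    interval_cases δ <;> interval_cases m <;> omega

section Transitivity

variable {F : Type*} [Field F] [DecidableEq F] [Finite F]

instance : Finite (OnePoint F) := inferInstanceAs (Finite (Option F))

/-- A `p`-subgroup fixing infinity acts semiregularly on the other points, so its order divides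
the size of the rest of the orbit of infinity. -/
lemma card_dvd_orbit_diff {p : ℕ} [Fact p.Prime] [CharP F p]
    {M Q : Subgroup (SpecialLinearGroup (Fin 2) F)} (hQM : Q ≤ M) (hQp : IsPGroup p Q)
    (hQ : Q ≤ stabilizer (SpecialLinearGroup (Fin 2) F) (OnePoint.infty : OnePoint F)) :
    Nat.card Q ∣ (orbit M (OnePoint.infty : OnePoint F) \ {OnePoint.infty}).ncard := by
  refine card_dvd_ncard_of_free _ ?_ ?_
  · rintro ⟨h, hh⟩ x ⟨hx, hxne⟩
    have hfix : h • (OnePoint.infty : OnePoint F) = OnePoint.infty := hQ hh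
    refine ⟨(orbit_eq_iff.2 hx) ▸ ?_, fun hc => hxne ?_⟩
    · exact mem_orbit x (⟨h, hQM hh⟩ : M)
    · have hc' : h • x = OnePoint.infty := hc
      exact (smul_left_cancel h (hc'.trans hfix.symm))
  · rintro ⟨h, hh⟩ x ⟨-, hxne⟩ hx
    induction x using OnePoint.rec with
    | infty => exact absurd rfl hxne
    | coe c =>
      have h1 : diagHom F ⟨h, hQ hh⟩ = 1 := by
        obtain ⟨k, hk⟩ := hQp ⟨h, hh⟩
        have hk' : (⟨h, hQ hh⟩ : stabilizer (SpecialLinearGroup (Fin 2) F)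
            (OnePoint.infty : OnePoint F)) ^ p ^ k = 1 :=
          Subtype.ext (show h ^ p ^ k = 1 from congrArg Q.subtype hk)
        have h2 := congrArg (fun g => ((diagHom F g : Fˣ) : F)) hk'
        simp only [map_pow, Units.val_pow_eq_pow_val, map_one, Units.val_one] at h2
        have h3 := (ExpChar.pow_prime_pow_mul_eq_one_iff p k 1 (x := (diagHom F ⟨h, hQ hh⟩ : F))).1
          (by rwa [mul_one])
        rw [pow_one] at h3
        exact Units.ext h3
      exact Subtype.ext (show h = 1 from
        congrArg (Subgroup.subtype _) (eq_one_of_smul_coe ⟨h, hQ hh⟩ h1 hx))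

lemma isPretransitive_of_ncard_orbit {M : Subgroup (SpecialLinearGroup (Fin 2) F)}
    (h : (orbit M (OnePoint.infty : OnePoint F)).ncard = Nat.card F + 1) :
    IsPretransitive M (OnePoint F) := by
  rw [isPretransitive_iff_orbit_eq_univ (OnePoint.infty : OnePoint F)]
  refine Set.eq_of_subset_of_ncard_le (Set.subset_univ _) ?_
  rw [h, Set.ncard_univ]
  exact (Finite.card_option (α := F)).le

/-- The basic relation between the index of a subgroup and the length of an orbit. -/
lemma index_mul_ncard_orbit (M : Subgroup (SpecialLinearGroup (Fin 2) F)) :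
    M.index * (orbit M (OnePoint.infty : OnePoint F)).ncard =
      (Nat.card F + 1) * (M.subgroupOf (stabilizer (SpecialLinearGroup (Fin 2) F)
        (OnePoint.infty : OnePoint F))).index := by
  have h1 := card_orbit_mul_card M
  have h2 := Subgroup.card_mul_index M
  have h3 := Subgroup.card_mul_index (M.subgroupOf (stabilizer (SpecialLinearGroup (Fin 2) F)
        (OnePoint.infty : OnePoint F)))
  rw [card_stabilizer_infty] at h3
  rw [card_sl_two, ← h3, ← h1] at h2
  refine Nat.eq_of_mul_eq_mul_left (Nat.card_pos (α := M.subgroupOf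
    (stabilizer (SpecialLinearGroup (Fin 2) F) (OnePoint.infty : OnePoint F)))) ?_
  linarith

lemma ncard_orbit_le (M : Subgroup (SpecialLinearGroup (Fin 2) F)) :
    (orbit M (OnePoint.infty : OnePoint F)).ncard ≤ Nat.card F + 1 := by
  rw [← show Nat.card (OnePoint F) = Nat.card F + 1 from Finite.card_option]
  exact Set.ncard_le_card _

lemma transitive_or_of_sylow_le {p : ℕ} [Fact p.Prime] [CharP F p] (hp2 : p ≠ 2)
    (hq : 11 ≤ Nat.card F) {M : Subgroup (SpecialLinearGroup (Fin 2) F)}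
    (hM : IsAdmissible M.index) (P : Sylow p M)
    (hP : (P : Subgroup M).map M.subtype ≤
      stabilizer (SpecialLinearGroup (Fin 2) F) (OnePoint.infty : OnePoint F)) :
    IsPretransitive M (OnePoint F) ∨ IsAdmissible (Nat.card F + 1) := by
  have hp : p.Prime := Fact.out
  cases nonempty_fintype F
  obtain ⟨k, -, hk⟩ := FiniteField.card F p
  rw [← Nat.card_eq_fintype_card] at hk
  have hσ : Nat.card P * p ^ M.index.factorization p = Nat.card F := by
    rw [Sylow.card_eq_multiplicity, ← pow_add]
    have h2 := congrArg (fun n => n.factorization p) (Subgroup.card_mul_index M)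
    beta_reduce at h2
    rw [Nat.factorization_mul Nat.card_pos.ne' Subgroup.index_ne_zero_of_finite, card_sl_two,
      Finsupp.add_apply] at h2
    rw [h2]
    have hc1 := Nat.card_eq_card_units_add_one F
    have hcop : ∀ n, ¬ p ∣ n → n.factorization p = 0 := fun n => Nat.factorization_eq_zero_of_not_dvd
    have hpq : p ∣ Nat.card F := hk ▸ dvd_pow_self p k.ne_zero
    have e1 : (Nat.card Fˣ).factorization p = 0 := hcop _ fun h =>
      hp.one_lt.ne' (Nat.dvd_one.1 ((Nat.dvd_add_right h).1 (hc1 ▸ hpq)))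
    have e2 : (Nat.card F + 1).factorization p = 0 := hcop _ fun h =>
      hp.one_lt.ne' (Nat.dvd_one.1 ((Nat.dvd_add_right hpq).1 h))
    rw [Nat.factorization_mul (mul_ne_zero Nat.card_pos.ne' Nat.card_pos.ne') (Nat.succ_ne_zero _),
      Nat.factorization_mul Nat.card_pos.ne' Nat.card_pos.ne', Finsupp.add_apply, Finsupp.add_apply,
      e1, e2, hk, hp.factorization_pow]
    simp
  obtain ⟨n, hn⟩ := card_dvd_orbit_diff (Subgroup.map_subtype_le _) (P.isPGroup'.map _) hP
  rw [Subgroup.card_map_of_injective M.subtype_injective] at hn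
  have ho := Set.ncard_sdiff_singleton_add_one (mem_orbit_self (M := M) (OnePoint.infty : OnePoint F))
  rw [hn] at ho
  have hj : (M.subgroupOf (stabilizer (SpecialLinearGroup (Fin 2) F)
      (OnePoint.infty : OnePoint F))).index ∣ Nat.card F * (Nat.card F - 1) := by
    refine (Subgroup.index_dvd_card _).trans (dvd_of_eq ?_)
    rw [card_stabilizer_infty, mul_comm, Nat.card_eq_card_units_add_one F, Nat.add_sub_cancel]
  rcases orbit_arith_odd hp hp2 hk hq hM (index_mul_ncard_orbit M) hj (n := n)
    (by rw [← ho]; ring)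
    (ncard_orbit_le M) hσ (Nat.ordProj_dvd _ _) with h | h
  · exact .inl (isPretransitive_of_ncard_orbit h)
  · exact .inr (hM.of_dvd h)

lemma transitive_or_of_odd {p : ℕ} [Fact p.Prime] [CharP F p] (hp2 : p ≠ 2)
    (hq : 11 ≤ Nat.card F) {M : Subgroup (SpecialLinearGroup (Fin 2) F)}
    (hM : IsAdmissible M.index) :
    IsPretransitive M (OnePoint F) ∨ IsAdmissible (Nat.card F + 1) := by
  have hp : p.Prime := Fact.out
  cases nonempty_fintype F
  obtain ⟨k, -, hk⟩ := FiniteField.card F p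
  rw [← Nat.card_eq_fintype_card] at hk
  obtain ⟨P⟩ : Nonempty (Sylow p M) := inferInstance
  obtain ⟨x, hx⟩ := P.isPGroup'.nonempty_fixed_point_of_prime_not_dvd_card (OnePoint F) (by
    rw [show Nat.card (OnePoint F) = Nat.card F + 1 from Finite.card_option, hk]
    intro h
    exact hp.one_lt.ne' (Nat.dvd_one.1 ((Nat.dvd_add_right (dvd_pow_self p k.ne_zero)).1 h)))
  obtain ⟨g, rfl⟩ := exists_smul_eq (SpecialLinearGroup (Fin 2) F) (OnePoint.infty : OnePoint F) x
  let φ := MulAut.conj g⁻¹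
  let f := φ.subgroupMap M
  have hfs : Function.Surjective f.toMonoidHom := f.surjective
  have hM' : IsAdmissible (M.map φ.toMonoidHom).index := by
    rwa [show (M.map φ.toMonoidHom).index = M.index from M.index_map_equiv φ]
  have hfix : ((P.mapSurjective hfs : Sylow p (M.map φ.toMonoidHom)) :
      Subgroup (M.map φ.toMonoidHom)).map (M.map φ.toMonoidHom).subtype ≤
      stabilizer (SpecialLinearGroup (Fin 2) F) (OnePoint.infty : OnePoint F) := by
    rintro _ ⟨_, ⟨m, hm, rfl⟩, rfl⟩
    have h1 : (m : SpecialLinearGroup (Fin 2) F) • g • (OnePoint.infty : OnePoint F) =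
      g • OnePoint.infty := hx ⟨m, hm⟩
    change (g⁻¹ * (m : SpecialLinearGroup (Fin 2) F) * g⁻¹⁻¹) • (OnePoint.infty : OnePoint F) = _
    rw [inv_inv, mul_smul, mul_smul, h1, inv_smul_smul]
  rcases transitive_or_of_sylow_le hp2 hq hM' (P.mapSurjective hfs) hfix with h | h
  · left
    refine ⟨fun x y => ?_⟩
    obtain ⟨⟨_, m, hm, rfl⟩, hxy⟩ := h.exists_smul_eq (g⁻¹ • x) (g⁻¹ • y)
    refine ⟨⟨m, hm⟩, ?_⟩
    have hxy' : (g⁻¹ * m * g⁻¹⁻¹) • g⁻¹ • x = g⁻¹ • y := hxy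
    rw [smul_smul, inv_mul_cancel_right, mul_smul] at hxy'
    exact smul_left_cancel _ hxy'
  · exact .inr h

/-- In characteristic two, an element of a subgroup generating the diagonal part of the stabilizer
of infinity acts semiregularly outside its two fixed points. -/
lemma exists_ncard_orbit_eq [CharP F 2] (M : Subgroup (SpecialLinearGroup (Fin 2) F)) :
    ∃ m δ : ℕ, 1 ≤ δ ∧ δ ≤ 2 ∧ (orbit M (OnePoint.infty : OnePoint F)).ncard =
      δ + m * Nat.card ((M.subgroupOf (stabilizer (SpecialLinearGroup (Fin 2) F)
        (OnePoint.infty : OnePoint F))).map (diagHom F)) := by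
  set B := stabilizer (SpecialLinearGroup (Fin 2) F) (OnePoint.infty : OnePoint F)
  set O := orbit M (OnePoint.infty : OnePoint F)
  have hO : OnePoint.infty ∈ O := mem_orbit_self _
  obtain ⟨⟨r, hr⟩, hgen⟩ := IsCyclic.exists_generator (α := (M.subgroupOf B).map (diagHom F))
  have hcard := orderOf_eq_card_of_forall_mem_zpowers hgen
  rw [Subgroup.orderOf_mk] at hcard
  rw [← hcard]
  have ho := Set.ncard_sdiff_singleton_add_one hO
  obtain ⟨g, hg, rfl⟩ := hr
  by_cases h1 : diagHom F g = 1
  · refine ⟨(O \ {OnePoint.infty}).ncard, 1, le_rfl, one_le_two, ?_⟩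
    rw [h1, orderOf_one, mul_one, ← ho, add_comm]
  have hg10 := (mem_stabilizer_infty _).1 g.2
  have hsq : ∀ a : F, a * a = 1 → a = 1 := fun a ha => by
    have : (a - 1) * (a - 1) = 0 := by
      have h2 : (2 : F) = 0 := CharTwo.two_eq_zero
      linear_combination ha - (a - 1) * h2
    exact sub_eq_zero.1 (mul_self_eq_zero.1 this)
  set a := (g : SpecialLinearGroup (Fin 2) F) 0 0 with ha
  set b := (g : SpecialLinearGroup (Fin 2) F) 0 1 with hb
  have ha1 : 1 - a * a ≠ 0 := fun h => h1 (Units.ext (hsq a (sub_eq_zero.1 h).symm))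
  set c : F := a * b / (1 - a * a)
  have hgc : (g : SpecialLinearGroup (Fin 2) F) • (c : OnePoint F) = c := by
    rw [smul_coe hg10, OnePoint.coe_eq_coe, ← ha, ← hb]
    have hc' : c * (1 - a * a) = a * b := div_mul_cancel₀ _ ha1
    linear_combination -hc'
  have hfix : ∀ h ∈ Subgroup.zpowers g, (h : SpecialLinearGroup (Fin 2) F) • (c : OnePoint F) = c := by
    have : Subgroup.zpowers g ≤ stabilizer B (c : OnePoint F) := by
      rw [Subgroup.zpowers_le]; exact hgc
    exact fun h hh => this hh
  have hM : ∀ h ∈ Subgroup.zpowers g, (h : SpecialLinearGroup (Fin 2) F) ∈ M := by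
    have : Subgroup.zpowers g ≤ M.subgroupOf B := by
      rw [Subgroup.zpowers_le]; exact hg
    exact fun h hh => this hh
  have hdvd : Nat.card (Subgroup.zpowers g) ∣ ((O \ {OnePoint.infty}) \ {(c : OnePoint F)}).ncard := by
    refine card_dvd_ncard_of_free _ ?_ ?_
    · rintro ⟨h, hh⟩ x ⟨⟨hx, hx1⟩, hx2⟩
      refine ⟨⟨?_, fun hy => hx1 ?_⟩, fun hy => hx2 ?_⟩
      · rw [show O = orbit M x from (orbit_eq_iff.2 hx).symm]
        exact mem_orbit x (⟨h, hM h hh⟩ : M)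
      · have hy' : (h : SpecialLinearGroup (Fin 2) F) • x = OnePoint.infty := hy
        exact smul_left_cancel (h : SpecialLinearGroup (Fin 2) F) (hy'.trans h.2.symm)
      · have hy' : (h : SpecialLinearGroup (Fin 2) F) • x = (c : OnePoint F) := hy
        exact smul_left_cancel (h : SpecialLinearGroup (Fin 2) F) (hy'.trans (hfix h hh).symm)
    · rintro ⟨h, hh⟩ x ⟨⟨hx, hx1⟩, hx2⟩ hhx
      induction x using OnePoint.rec with
      | infty => exact absurd rfl hx1
      | coe d =>
        have hdc : d - c ≠ 0 := fun h => hx2 (congrArg _ (sub_eq_zero.1 h))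
        have e1 := hfix h hh
        have e2 : (h : SpecialLinearGroup (Fin 2) F) • (d : OnePoint F) = d := hhx
        refine Subtype.ext (eq_one_of_smul_coe h (Units.ext (hsq _ ?_)) e1)
        have h10 := (mem_stabilizer_infty _).1 h.2
        rw [smul_coe h10, OnePoint.coe_eq_coe] at e1 e2
        refine mul_right_cancel₀ hdc ?_
        rw [coe_diagHom]
        linear_combination e2 - e1
  rw [Nat.card_zpowers] at hdvd
  obtain ⟨m, hm⟩ := (orderOf_map_dvd (diagHom F) g).trans hdvd
  by_cases hcO : (c : OnePoint F) ∈ O \ {OnePoint.infty}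
  · refine ⟨m, 2, one_le_two, le_rfl, ?_⟩
    have := Set.ncard_sdiff_singleton_add_one hcO
    rw [← ho, ← this, hm]
    ring
  · refine ⟨m, 1, le_rfl, one_le_two, ?_⟩
    rw [Set.sdiff_singleton_eq_self hcO] at hm
    rw [← ho, hm]
    ring

lemma transitive_of_even [CharP F 2] (hq : 11 ≤ Nat.card F)
    {M : Subgroup (SpecialLinearGroup (Fin 2) F)} (hM : IsAdmissible M.index) :
    IsPretransitive M (OnePoint F) := by
  cases nonempty_fintype F
  obtain ⟨k, -, hk⟩ := FiniteField.card F 2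
  rw [← Nat.card_eq_fintype_card] at hk
  obtain ⟨m, δ, hδ, hδ2, ho⟩ := exists_ncard_orbit_eq M
  refine isPretransitive_of_ncard_orbit (orbit_arith_two hk hq hM (u := ((M.subgroupOf (stabilizer
    (SpecialLinearGroup (Fin 2) F) (OnePoint.infty : OnePoint F))).map (diagHom F)).index)
    ?_ ?_ ho hδ hδ2 (ncard_orbit_le M))
  · rw [Subgroup.index_mul_card, ← Nat.card_eq_card_units_add_one]
  · rw [index_mul_ncard_orbit, mul_comm]
    exact mul_dvd_mul_left _ (Subgroup.index_map_dvd _ diagHom_surjective)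

/-- A subgroup of `SL₂(q)` of admissible index is transitive on the projective line, unless the
number `q + 1` of points is itself admissible. -/
theorem transitive_or_admissible (hq : 11 ≤ Nat.card F)
    {M : Subgroup (SpecialLinearGroup (Fin 2) F)} (hM : IsAdmissible M.index) :
    IsPretransitive M (OnePoint F) ∨ IsAdmissible (Nat.card F + 1) := by
  obtain ⟨p, hF⟩ := CharP.exists F
  have : Fact p.Prime := ⟨CharP.char_is_prime F p⟩
  by_cases hp2 : p = 2
  · subst hp2
    exact .inl (transitive_of_even hq hM)
  · exact transitive_or_of_odd hp2 hq hM

end Transitivity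

/-- The power of a Sylow subgroup, as a Sylow subgroup of the direct power. -/
lemma exists_sylow_pi {ι T : Type*} [Fintype ι] [Group T] [Finite T] {p : ℕ} [Fact p.Prime]
    (P : Sylow p T) :
    ∃ X : Sylow p (ι → T), (X : Subgroup (ι → T)) = Subgroup.pi Set.univ fun _ => P := by
  have hp : p.Prime := Fact.out
  have h1 : IsPGroup p (Subgroup.pi Set.univ fun _ : ι => (P : Subgroup T)) := by
    obtain ⟨n, hn⟩ := IsPGroup.iff_card.1 P.isPGroup'
    rintro ⟨x, hx⟩
    refine ⟨n, Subtype.ext (funext fun i => ?_)⟩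
    have h := pow_card_eq_one' (x := (⟨x i, hx i trivial⟩ : (P : Subgroup T)))
    rw [hn] at h
    exact congrArg (Subgroup.subtype (P : Subgroup T)) h
  have h2 : ¬ p ∣ (Subgroup.pi Set.univ fun _ : ι => (P : Subgroup T)).index := by
    rw [Subgroup.index_pi]
    intro h
    obtain ⟨i, -, hi⟩ := hp.prime.exists_mem_finset_dvd h
    exact P.not_dvd_index hi
  exact ⟨h1.toSylow h2, rfl⟩

lemma range_mulSingle_normal {ι T : Type*} [DecidableEq ι] [Group T] (i : ι) :
    (MonoidHom.mulSingle (fun _ : ι => T) i).range.Normal := by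
  refine ⟨?_⟩
  rintro _ ⟨x, rfl⟩ g
  refine ⟨g i * x * (g i)⁻¹, ?_⟩
  ext j
  by_cases h : j = i
  · subst h; simp
  · simp [h]

section UnipotentSylow

variable {F : Type*} [Field F] [DecidableEq F]

variable (F) in
/-- The group of upper unitriangular matrices. -/
noncomputable def unipotent : Subgroup (SpecialLinearGroup (Fin 2) F) :=
  (diagHom F).ker.map (Subgroup.subtype _)

lemma mem_unipotent {g : SpecialLinearGroup (Fin 2) F} :
    g ∈ unipotent F ↔ g 0 0 = 1 ∧ g 1 0 = 0 := by
  constructor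
  · rintro ⟨h, hh, rfl⟩
    exact ⟨congrArg Units.val hh, (mem_stabilizer_infty _).1 h.2⟩
  · rintro ⟨h1, h2⟩
    exact ⟨⟨g, (mem_stabilizer_infty _).2 h2⟩, Units.ext h1, rfl⟩

lemma unipotent_commute {g h : SpecialLinearGroup (Fin 2) F} (hg : g ∈ unipotent F)
    (hh : h ∈ unipotent F) : g * h = h * g := by
  rw [mem_unipotent] at hg hh
  have h1 := diag_mul_diag hg.2
  have h2 := diag_mul_diag hh.2
  rw [hg.1, one_mul] at h1
  rw [hh.1, one_mul] at h2
  ext i j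
  fin_cases i <;> fin_cases j <;>
    simp [Matrix.mul_apply, Fin.sum_univ_two, hg.1, hg.2, hh.1, hh.2, h1, h2, add_comm]

lemma unipotent_not_le_center :
    ¬ unipotent F ≤ Subgroup.center (SpecialLinearGroup (Fin 2) F) := by
  intro h
  let g : SpecialLinearGroup (Fin 2) F := ⟨!![1, 1; 0, 1], by simp [det_fin_two]⟩
  let k : SpecialLinearGroup (Fin 2) F := ⟨!![1, 0; 1, 1], by simp [det_fin_two]⟩
  have hg : g ∈ unipotent F := mem_unipotent.2 ⟨rfl, rfl⟩
  have h1 : (k.1 * g.1) 0 0 = (g.1 * k.1) 0 0 :=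
    congrArg (fun m : SpecialLinearGroup (Fin 2) F => m.1 0 0)
      (Subgroup.mem_center_iff.1 (h hg) k)
  rw [Matrix.mul_apply, Matrix.mul_apply, Fin.sum_univ_two, Fin.sum_univ_two] at h1
  simp [g, k] at h1

lemma stabilizer_le_normalizer_unipotent :
    stabilizer (SpecialLinearGroup (Fin 2) F) (OnePoint.infty : OnePoint F) ≤
      Subgroup.normalizer (unipotent F : Set (SpecialLinearGroup (Fin 2) F)) := by
  rw [Subgroup.le_normalizer_iff]
  rintro h hh _ ⟨u, hu, rfl⟩
  have hc := (MonoidHom.normal_ker (diagHom F)).conj_mem u hu ⟨h, hh⟩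
  have := Subgroup.mem_map_of_mem (Subgroup.subtype _) hc
  rwa [map_mul, map_mul, map_inv] at this

/-- The unitriangular matrices form a Sylow subgroup of `SL₂(q)` in the defining characteristic. -/
lemma exists_sylow_unipotent [Finite F] {p : ℕ} [Fact p.Prime] [CharP F p] :
    ∃ P : Sylow p (SpecialLinearGroup (Fin 2) F),
      (P : Subgroup (SpecialLinearGroup (Fin 2) F)) = unipotent F := by
  have hp : p.Prime := Fact.out
  cases nonempty_fintype F
  obtain ⟨k, -, hk⟩ := FiniteField.card F p
  rw [← Nat.card_eq_fintype_card] at hk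
  have hU : Nat.card (unipotent F) = Nat.card F := by
    rw [unipotent, Subgroup.card_map_of_injective (Subgroup.subtype_injective _), card_ker_diagHom]
  have hpq : p ∣ Nat.card F := hk ▸ dvd_pow_self p k.ne_zero
  have hc := Nat.card_eq_card_units_add_one F
  have h2 : ¬ p ∣ (unipotent F).index := by
    have h := Subgroup.card_mul_index (unipotent F)
    rw [hU, card_sl_two, mul_comm (Nat.card Fˣ), mul_assoc] at h
    rw [Nat.eq_of_mul_eq_mul_left Nat.card_pos h, hp.dvd_mul]
    rintro (h | h)
    · exact hp.one_lt.ne' (Nat.dvd_one.1 ((Nat.dvd_add_right h).1 (hc ▸ hpq)))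
    · exact hp.one_lt.ne' (Nat.dvd_one.1 ((Nat.dvd_add_right hpq).1 h))
  exact ⟨(IsPGroup.of_card (hU.trans hk)).toSylow h2, rfl⟩

end UnipotentSylow

/-- If the preimages in `SL₂(q)` of the intersections of a subgroup with the factors of
`PSL₂(q) ^ e` are transitive on the projective line, then the subgroup supplements the normalizer
of the power of the unitriangular group. -/
lemma exists_eq_mul {F : Type*} [Field F] [DecidableEq F] {ι : Type*} [Finite ι] [DecidableEq ι]
    (A : Subgroup (ι → SpecialLinearGroup (Fin 2) F ⧸
      Subgroup.center (SpecialLinearGroup (Fin 2) F)))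
    (hA : ∀ i, IsPretransitive ((A.comap (MonoidHom.mulSingle
      (fun _ : ι => SpecialLinearGroup (Fin 2) F ⧸ Subgroup.center (SpecialLinearGroup (Fin 2) F))
      i)).comap (QuotientGroup.mk' _)) (OnePoint F))
    (w : ι → SpecialLinearGroup (Fin 2) F ⧸ Subgroup.center (SpecialLinearGroup (Fin 2) F)) :
    ∃ n ∈ Subgroup.normalizer ((Subgroup.pi Set.univ fun _ : ι =>
      (unipotent F).map (QuotientGroup.mk' (Subgroup.center (SpecialLinearGroup (Fin 2) F))) :
        Subgroup _) : Set (ι → SpecialLinearGroup (Fin 2) F ⧸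
          Subgroup.center (SpecialLinearGroup (Fin 2) F))),
      ∃ a ∈ A, w = n * a := by
  have key : ∀ i, ∃ n ∈ Subgroup.normalizer (((unipotent F).map (QuotientGroup.mk' (Subgroup.center
      (SpecialLinearGroup (Fin 2) F))) : Subgroup _) : Set (SpecialLinearGroup (Fin 2) F ⧸
        Subgroup.center (SpecialLinearGroup (Fin 2) F))),
      ∃ a, MonoidHom.mulSingle (fun _ : ι => SpecialLinearGroup (Fin 2) F ⧸
        Subgroup.center (SpecialLinearGroup (Fin 2) F)) i a ∈ A ∧ w i = n * a := by
    intro i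
    obtain ⟨s, hs⟩ := QuotientGroup.mk'_surjective _ (w i)
    obtain ⟨⟨m, hm⟩, hmx⟩ := (hA i).exists_smul_eq (s⁻¹ • (OnePoint.infty : OnePoint F))
      OnePoint.infty
    have hmx' : m • s⁻¹ • (OnePoint.infty : OnePoint F) = OnePoint.infty := hmx
    refine ⟨QuotientGroup.mk' _ (s * m⁻¹), ?_, QuotientGroup.mk' _ m, hm, ?_⟩
    · refine Subgroup.le_normalizer_map _ (Subgroup.mem_map_of_mem _ ?_)
      refine stabilizer_le_normalizer_unipotent ?_
      rw [mem_stabilizer_iff, mul_smul, smul_eq_iff_eq_inv_smul, inv_smul_eq_iff, hmx']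
    · rw [← map_mul, inv_mul_cancel_right, hs]
  choose n hn a ha hw using key
  refine ⟨n, ?_, a, Subgroup.pi_mem_of_mulSingle_mem _ ha, funext hw⟩
  rw [Subgroup.mem_normalizer_iff]
  intro x
  simp only [Subgroup.mem_pi, Set.mem_univ, true_imp_iff]
  exact forall_congr' fun i => Subgroup.mem_normalizer_iff.1 (hn i) (x i)

end MinimalTransitive

/-- **Theorem 3.1(ii), `PSL₂` case.** If a nonabelian chief factor `W` of an insoluble
minimal transitive permutation group of degree `n = 2^x·3^y·5^z` (`0 ≤ y, z ≤ 1`) is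
isomorphic to `PSL(2,q)^e` with `q ≥ 11` a prime power and `e ≥ 1`, then `q` has the form
`q = 2^{x₁}·3^{y₁}·5^{z₁} − 1` with `0 ≤ y₁, z₁ ≤ 1`. -/
theorem minimal_transitive_chief_factor_psl_two
    {Ω : Type*} [Fintype Ω] (G : Subgroup (Equiv.Perm Ω))
    (htrans : MulAction.IsPretransitive G Ω)
    (hmin : ∀ H : Subgroup (Equiv.Perm Ω), H < G → ¬ MulAction.IsPretransitive H Ω)
    (hinsol : ¬ IsSolvable G)
    (x y z : ℕ) (hy : y ≤ 1) (hz : z ≤ 1)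
    (hcard : Fintype.card Ω = 2 ^ x * 3 ^ y * 5 ^ z)
    (N : Subgroup G) [N.Normal] (W : Subgroup (G ⧸ N))
    (hWnormal : W.Normal) (hWbot : W ≠ ⊥)
    (hWmin : ∀ W' : Subgroup (G ⧸ N), W'.Normal → W' ≠ ⊥ → W' ≤ W → W' = W)
    (hWnonab : ¬ ∀ a ∈ W, ∀ b ∈ W, a * b = b * a)
    (q : ℕ) (hq11 : 11 ≤ q) (hqpp : ∃ p k : ℕ, p.Prime ∧ 0 < k ∧ q = p ^ k)
    (F : Type) [Field F] [Fintype F] (hF : Fintype.card F = q)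
    (e : ℕ) (he : 1 ≤ e)
    (hiso : Nonempty (W ≃* (Fin e →
      Matrix.SpecialLinearGroup (Fin 2) F ⧸
        Subgroup.center (Matrix.SpecialLinearGroup (Fin 2) F)))) :
    ∃ x₁ y₁ z₁ : ℕ, y₁ ≤ 1 ∧ z₁ ≤ 1 ∧ q + 1 = 2 ^ x₁ * 3 ^ y₁ * 5 ^ z₁ := by
  classical
  obtain ⟨φ⟩ := hiso
  have hn0 : Fintype.card Ω ≠ 0 := by rw [hcard]; positivity
  have : Nonempty Ω := Fintype.card_pos_iff.1 (Nat.pos_of_ne_zero hn0)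
  have hmin' : ∀ H : Subgroup G, MulAction.IsPretransitive H Ω → H = ⊤ := by
    intro H hH
    by_contra hne
    refine hmin (H.map G.subtype) ?_ ⟨fun α β => ?_⟩
    · refine lt_of_le_of_ne (Subgroup.map_subtype_le H) fun h => hne ?_
      apply Subgroup.map_injective G.subtype_injective
      rw [h, ← MonoidHom.range_eq_map, Subgroup.range_subtype]
    · obtain ⟨h, hh⟩ := hH.exists_smul_eq α β
      exact ⟨⟨_, Subgroup.mem_map_of_mem G.subtype h.2⟩, hh⟩
  by_contra hnot
  obtain ⟨A, hA, hfac⟩ := MinimalTransitive.exists_not_mem_mul (Ω := Ω) hmin' N W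
  obtain ⟨p, hchar⟩ := CharP.exists F
  have : Fact p.Prime := ⟨CharP.char_is_prime F p⟩
  obtain ⟨U, hU⟩ := MinimalTransitive.exists_sylow_unipotent (F := F) (p := p)
  obtain ⟨X, hX⟩ := MinimalTransitive.exists_sylow_pi (ι := Fin e) (U.mapSurjective
    (QuotientGroup.mk'_surjective (Subgroup.center (Matrix.SpecialLinearGroup (Fin 2) F))))
  rw [Sylow.coe_mapSurjective, hU] at hX
  let P : Sylow p W := X.mapSurjective (f := φ.symm.toMonoidHom) φ.symm.surjective
  have hP : (P : Subgroup W) = X.toSubgroup.map φ.symm.toMonoidHom :=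
    Sylow.coe_mapSurjective _ _
  have hmemX : ∀ x, x ∈ X.toSubgroup ↔ ∀ i, x i ∈ (MinimalTransitive.unipotent F).map
      (QuotientGroup.mk' (Subgroup.center (Matrix.SpecialLinearGroup (Fin 2) F))) := by
    intro x
    rw [hX, Subgroup.mem_pi]
    simp
  have hPnormal : ¬ ((P : Subgroup W).map W.subtype).Normal := by
    intro hnorm
    have hcomm : ∀ x ∈ X.toSubgroup, ∀ y ∈ X.toSubgroup, x * y = y * x := by
      intro x hx y hy
      funext i
      obtain ⟨u, hu, hux⟩ := (hmemX x).1 hx i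
      obtain ⟨v, hv, hvy⟩ := (hmemX y).1 hy i
      rw [Pi.mul_apply, Pi.mul_apply, ← hux, ← hvy, ← map_mul, ← map_mul,
        MinimalTransitive.unipotent_commute hu hv]
    have hbot : (P : Subgroup W).map W.subtype ≠ ⊥ := by
      intro hb
      rw [Subgroup.map_eq_bot_iff_of_injective _ W.subtype_injective, hP,
        Subgroup.map_eq_bot_iff_of_injective _ φ.symm.injective] at hb
      refine MinimalTransitive.unipotent_not_le_center (F := F) fun u hu => ?_
      have h1 : (fun _ => QuotientGroup.mk' _ u) ∈ X.toSubgroup :=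
        (hmemX _).2 fun _ => Subgroup.mem_map_of_mem _ hu
      rw [hb, Subgroup.mem_bot] at h1
      exact (QuotientGroup.eq_one_iff u).1 (congrFun h1 ⟨0, he⟩)
    have htop := hWmin _ hnorm hbot (Subgroup.map_subtype_le _)
    refine hWnonab fun a ha b hb => ?_
    rw [← htop, hP] at ha hb
    obtain ⟨_, ⟨x, hx, rfl⟩, rfl⟩ := ha
    obtain ⟨_, ⟨y, hy, rfl⟩, rfl⟩ := hb
    rw [← map_mul, ← map_mul, hcomm x hx y hy, map_mul, map_mul]
  obtain ⟨w, hw⟩ := hfac p P hPnormal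
  have hadm : MinimalTransitive.IsAdmissible (A.map φ.toMonoidHom).index := by
    rw [show (A.map φ.toMonoidHom).index = A.index from A.index_map_equiv φ]
    exact MinimalTransitive.IsAdmissible.of_dvd ⟨x, y, z, hy, hz, hcard⟩
      (by rwa [Nat.card_eq_fintype_card] at hA)
  obtain ⟨n, hn, a, ⟨b, hb, rfl⟩, hna⟩ := MinimalTransitive.exists_eq_mul (A.map φ.toMonoidHom)
    (fun i => by
      have := MinimalTransitive.range_mulSingle_normal (T := Matrix.SpecialLinearGroup (Fin 2) F ⧸
        Subgroup.center (Matrix.SpecialLinearGroup (Fin 2) F)) i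
      refine (MinimalTransitive.transitive_or_admissible
        (by rwa [Nat.card_eq_fintype_card, hF]) (hadm.of_dvd ?_)).resolve_right ?_
      · rw [Subgroup.index_comap_of_surjective _ (QuotientGroup.mk'_surjective _),
          Subgroup.index_comap]
        exact MinimalTransitive.relIndex_dvd_index _ _
      · rwa [Nat.card_eq_fintype_card, hF]) (φ w)
  refine hw (φ.symm n) ?_ b hb ?_
  · rw [hP]
    rw [← hX] at hn
    exact Subgroup.le_normalizer_map φ.symm.toMonoidHom (Subgroup.mem_map_of_mem _ hn)
  · apply φ.injective
    rw [map_mul, φ.apply_symm_apply]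
    exact hna
end

section
/- Let T be a nonabelian finite simple group, let G₁, …, G_e be finite groups with |G_i| < |T| for all i, and let G be a subdirect product in G₁ × ⋯ × G_e. Then G has no homomorphic image isomorphic to T; that is, there is no surjective group homomorphism from G onto T. -/
/-- The commutator subgroup of a nonabelian simple group is the whole group. -/
theorem commutator_top_eq_top_of_isSimpleGroup {T : Type*} [Group T] [IsSimpleGroup T]
    (hnonab : ¬ ∀ a b : T, a * b = b * a) : ⁅(⊤ : Subgroup T), (⊤ : Subgroup T)⁆ = ⊤ := by
  refine (Subgroup.Normal.eq_bot_or_eq_top inferInstance).resolve_left fun h => hnonab fun a b => ?_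
  rw [← commutatorElement_eq_one_iff_mul_comm, ← Subgroup.mem_bot, ← h]
  exact Subgroup.commutator_mem_commutator (Subgroup.mem_top a) (Subgroup.mem_top b)

/-- If finitely many normal subgroups each map onto a perfect group, so does their intersection. -/
theorem map_finset_inf_eq_top {G T ι : Type*} [Group G] [Group T]
    (hperf : ⁅(⊤ : Subgroup T), (⊤ : Subgroup T)⁆ = ⊤) {f : G →* T}
    (hf : Function.Surjective f) (K : ι → Subgroup G) (hn : ∀ i, (K i).Normal)
    (hK : ∀ i, (K i).map f = ⊤) (s : Finset ι) :
    (s.inf K).Normal ∧ (s.inf K).map f = ⊤ := by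
  classical
  induction s using Finset.induction_on with
  | empty =>
    rw [Finset.inf_empty]
    exact ⟨inferInstance, Subgroup.map_top_of_surjective f hf⟩
  | insert i s _ ih =>
    obtain ⟨hs, hmap⟩ := ih
    have := hn i
    rw [Finset.inf_insert]
    refine ⟨inferInstance, top_le_iff.mp ?_⟩
    calc ⊤ = ⁅(K i).map f, (s.inf K).map f⁆ := by rw [hK, hmap, hperf]
      _ = ⁅K i, s.inf K⁆.map f := (Subgroup.map_commutator _ _ f).symm
      _ ≤ (K i ⊓ s.inf K).map f := Subgroup.map_mono (Subgroup.commutator_le_inf _ _)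

/-- If a surjection onto `T` kills the kernel of a homomorphism to a finite group `H`, then
the cardinality of `T` is at most that of `H`. -/
theorem card_le_card_of_map_ker_eq_bot {G H T : Type*} [Group G] [Group H] [Group T] [Finite H]
    {f : G →* T} (hf : Function.Surjective f) (p : G →* H) (h : p.ker.map f = ⊥) :
    Nat.card T ≤ Nat.card H := by
  refine Nat.card_le_card_of_injective (fun t => p (Function.surjInv hf t)) fun a b hab => ?_
  have hmem : (Function.surjInv hf a)⁻¹ * Function.surjInv hf b ∈ p.ker :=
    (MonoidHom.eq_iff p).mp hab.symm
  have hbot := (Subgroup.map_eq_bot_iff _).mp h hmem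
  rw [← Function.surjInv_eq hf a, ← Function.surjInv_eq hf b]
  exact ((MonoidHom.eq_iff f).mpr hbot).symm

/-- If `T` is a nonabelian finite simple group, `G₁, …, G_e` are finite groups with
`|G_i| < |T|` for all `i`, and `G` is a subdirect product in `G₁ × ⋯ × G_e`, then `G` has
no homomorphic image isomorphic to `T`. -/
theorem subdirect_product_no_large_simple_quotient
    {T : Type*} [Group T] [Finite T] [IsSimpleGroup T]
    (hnonab : ¬ ∀ a b : T, a * b = b * a)
    {e : ℕ} (Gs : Fin e → Type*) [∀ i, Group (Gs i)] [∀ i, Finite (Gs i)]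
    (hsmall : ∀ i, Nat.card (Gs i) < Nat.card T)
    (G : Subgroup (∀ i, Gs i))
    (hsub : ∀ i, ∀ a : Gs i, ∃ g ∈ G, g i = a) :
    ¬ ∃ f : G →* T, Function.Surjective f := by
  rintro ⟨f, hf⟩
  let p : ∀ i, G →* Gs i := fun i => (Pi.evalMonoidHom Gs i).comp G.subtype
  have hK : ∀ i, (p i).ker.map f = ⊤ := fun i =>
    (((p i).normal_ker.map f hf).eq_bot_or_eq_top).resolve_left fun h =>
      (hsmall i).not_ge (card_le_card_of_map_ker_eq_bot hf (p i) h)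
  have hmap := (map_finset_inf_eq_top (commutator_top_eq_top_of_isSimpleGroup hnonab) hf
    (fun i => (p i).ker) (fun i => (p i).normal_ker) hK Finset.univ).2
  have hinf : Finset.univ.inf (fun i => (p i).ker) = ⊥ := by
    refine (Subgroup.eq_bot_iff_forall _).mpr fun g hg => Subtype.ext (funext fun i => ?_)
    exact Finset.inf_le (f := fun i => (p i).ker) (Finset.mem_univ i) hg
  rw [hinf, Subgroup.map_bot] at hmap
  exact bot_ne_top hmap
end

section
/- Let G₁, …, G_e be finite groups and let G be a subdirect product in G₁ × ⋯ × G_e. Fix 1 < f < e. Suppose that G_i is a nonabelian simple group for 1 ≤ i ≤ f, that |G_j| < |G_i| for all 1 ≤ i ≤ f and f+1 ≤ j ≤ e, and that for each 1 ≤ i ≤ f the order |G_i| does not divide the index [G₁ × ⋯ × G_e : G]. Then G contains the subgroup G₁ × ⋯ × G_f × 1 × ⋯ × 1 of all tuples whose coordinates beyond the f-th are trivial; consequently G = G₁ × ⋯ × G_f × L, where L is a subdirect product in G_{f+1} × ⋯ × G_e. -/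
section Subdirect

variable {ι : Type*} {Gs : ι → Type*} [∀ i, Group (Gs i)] {G : Subgroup (∀ i, Gs i)}

/-- A coordinate projection of a subdirect product sends the trace of a normal subgroup of the
full product to a normal subgroup of the factor. -/
theorem normal_map_eval_inf (hsub : ∀ i, ∀ a : Gs i, ∃ g ∈ G, g i = a)
    (N : Subgroup (∀ i, Gs i)) [N.Normal] (i : ι) :
    ((G ⊓ N).map (Pi.evalMonoidHom Gs i)).Normal := by
  refine ⟨?_⟩
  rintro _ ⟨x, ⟨hxG, hxN⟩, rfl⟩ a
  obtain ⟨g, hg, rfl⟩ := hsub i a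
  exact ⟨g * x * g⁻¹, ⟨G.mul_mem (G.mul_mem hg hxG) (G.inv_mem hg),
    Subgroup.Normal.conj_mem ‹_› x hxN g⟩, rfl⟩

/-- The tuples whose coordinates in `s` are trivial form a normal subgroup. -/
theorem normal_pi_bot (s : Set ι) : (Subgroup.pi s fun i => (⊥ : Subgroup (Gs i))).Normal := by
  refine ⟨fun x hx g => ?_⟩
  simp only [Subgroup.mem_pi, Subgroup.mem_bot] at hx ⊢
  intro j hj
  simp [hx j hj]

/-- Let `G` be a subdirect product with a simple nonabelian factor `Gs i`. If for every `j` in a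
finite set `s` some `g ∈ G` has `g j = 1` and `g i ≠ 1`, then every element of `Gs i` is the `i`-th
coordinate of an element of `G` that is trivial on `s`. -/
theorem exists_mem_eval_eq_and_trivial_on (hsub : ∀ i, ∀ a : Gs i, ∃ g ∈ G, g i = a)
    {i : ι} [IsSimpleGroup (Gs i)] (hnonab : ¬ ∀ a b : Gs i, a * b = b * a) (s : Finset ι)
    (hs : ∀ j ∈ s, ∃ g ∈ G, g j = 1 ∧ g i ≠ 1) (a : Gs i) :
    ∃ g ∈ G, g i = a ∧ ∀ j ∈ s, g j = 1 := by
  classical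
  have key : ∀ t : Set ι,
      (∃ g ∈ G, (∀ j ∈ t, g j = 1) ∧ g i ≠ 1) →
        ∀ a : Gs i, ∃ g ∈ G, g i = a ∧ ∀ j ∈ t, g j = 1 := by
    rintro t ⟨g, hg, hgt, hgi⟩ a
    have := normal_pi_bot (Gs := Gs) t
    rcases (normal_map_eval_inf hsub (Subgroup.pi t fun i => (⊥ : Subgroup (Gs i))) i).eq_bot_or_eq_top
      with h | h
    · refine absurd ?_ hgi
      rw [← Subgroup.mem_bot, ← h]
      exact ⟨g, ⟨hg, fun j hj => hgt j hj⟩, rfl⟩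
    · obtain ⟨x, ⟨hxG, hxt⟩, rfl⟩ := h.ge (Subgroup.mem_top a)
      exact ⟨x, hxG, rfl, fun j hj => hxt j hj⟩
  induction s using Finset.induction_on generalizing a with
  | empty => simpa using hsub i a
  | insert j s _ ih =>
    have ih := ih fun k hk => hs k (Finset.mem_insert_of_mem hk)
    obtain ⟨g₀, hg₀, hg₀j, hg₀i⟩ := hs j (Finset.mem_insert_self j s)
    have hj := key {j} ⟨g₀, hg₀, by simpa using hg₀j, hg₀i⟩
    push Not at hnonab
    obtain ⟨b, c, hbc⟩ := hnonab
    obtain ⟨x, hx, rfl, hxs⟩ := ih b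
    obtain ⟨y, hy, rfl, hyj⟩ := hj c
    refine key (insert j s : Finset ι) ⟨x * y * x⁻¹ * y⁻¹, G.mul_mem (G.mul_mem (G.mul_mem hx hy)
      (G.inv_mem hx)) (G.inv_mem hy), fun k hk => ?_, fun h => hbc ?_⟩ a
    · rcases Finset.mem_insert.mp hk with rfl | hk
      · simp [hyj k rfl]
      · simp [hxs k hk]
    · simpa [mul_inv_eq_iff_eq_mul] using h

/-- A subdirect product of finitely many groups contains its simple nonabelian factor `Gs i` as
soon as no other single coordinate `j` forces `g i = 1` through `g j = 1`. -/
theorem mulSingle_mem_of_forall_exists [Fintype ι] [DecidableEq ι]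
    (hsub : ∀ i, ∀ a : Gs i, ∃ g ∈ G, g i = a)
    {i : ι} [IsSimpleGroup (Gs i)] (hnonab : ¬ ∀ a b : Gs i, a * b = b * a)
    (h : ∀ j, j ≠ i → ∃ g ∈ G, g j = 1 ∧ g i ≠ 1) (a : Gs i) : Pi.mulSingle i a ∈ G := by
  obtain ⟨g, hg, rfl, hgj⟩ := exists_mem_eval_eq_and_trivial_on hsub hnonab (Finset.univ.erase i)
    (fun j hj => h j (Finset.ne_of_mem_erase hj)) a
  convert hg
  ext j
  rcases eq_or_ne j i with rfl | hj
  · simp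
  · rw [Pi.mulSingle_eq_of_ne hj, hgj j (by simpa using hj)]

/-- If two elements of `G` agree at `j`, and triviality at `j` forces triviality at `i`, then they
agree at `i`. -/
theorem eval_eq_of_eval_eq {i j : ι} (h : ∀ g ∈ G, g j = 1 → g i = 1) {x y : ∀ i, Gs i}
    (hx : x ∈ G) (hy : y ∈ G) (hxy : x j = y j) : x i = y i := by
  have := h (x * y⁻¹) (G.mul_mem hx (G.inv_mem hy)) (by simp [hxy])
  simpa [mul_inv_eq_one] using this

/-- If the `j`-th coordinate in a subdirect product determines the `i`-th one, then
`|Gs i| ≤ |Gs j|`. -/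
theorem card_le_card_of_coord_determined [∀ i, Finite (Gs i)]
    (hsub : ∀ i, ∀ a : Gs i, ∃ g ∈ G, g i = a) {i j : ι} (h : ∀ g ∈ G, g j = 1 → g i = 1) :
    Nat.card (Gs i) ≤ Nat.card (Gs j) := by
  choose g hg hgi using hsub i
  refine Nat.card_le_card_of_injective (fun a => g a j) fun a b hab => ?_
  rw [← hgi a, ← hgi b]
  exact eval_eq_of_eval_eq h (hg a) (hg b) hab

/-- If the `j`-th coordinate in a subdirect product determines the `i`-th one, where `j ≠ i`, then
`|Gs i|` divides the index of the subdirect product. -/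
theorem card_dvd_index_of_coord_determined [∀ i, Finite (Gs i)]
    (hsub : ∀ i, ∀ a : Gs i, ∃ g ∈ G, g i = a) {i j : ι} (hji : j ≠ i)
    (h : ∀ g ∈ G, g j = 1 → g i = 1) : Nat.card (Gs i) ∣ G.index := by
  classical
  let p : (∀ i, Gs i) →* Gs i × Gs j := (Pi.evalMonoidHom Gs i).prod (Pi.evalMonoidHom Gs j)
  have hp : Function.Surjective p := fun ⟨a, b⟩ =>
    ⟨Pi.mulSingle i a * Pi.mulSingle j b, by simp [p, hji, hji.symm]⟩
  have hbij : Function.Bijective fun x : G.map p => (x : Gs i × Gs j).2 := by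
    constructor
    · rintro ⟨_, x, hx, rfl⟩ ⟨_, y, hy, rfl⟩ hxy
      exact Subtype.ext (Prod.ext (eval_eq_of_eval_eq h hx hy hxy) hxy)
    · intro b
      obtain ⟨g, hg, rfl⟩ := hsub j b
      exact ⟨⟨p g, g, hg, rfl⟩, rfl⟩
  have hcard := (G.map p).card_mul_index
  rw [Nat.card_eq_of_bijective _ hbij, Nat.card_prod, mul_comm (Nat.card (Gs i))] at hcard
  rw [← Nat.eq_of_mul_eq_mul_left Nat.card_pos hcard]
  exact G.index_map_dvd hp

end Subdirect


/-- Let `G` be a subdirect product in `G₁ × ⋯ × G_e` and `1 < f < e`. Suppose `G_i` is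
nonabelian simple for `i ≤ f`, `|G_j| < |G_i|` whenever `i ≤ f < j`, and `|G_i|` does not
divide the index of `G` for `i ≤ f`. Then `G` contains `G₁ × ⋯ × G_f × 1 × ⋯ × 1`, and
consequently membership in `G` depends only on the coordinates beyond the `f`-th (so that
`G = G₁ × ⋯ × G_f × L` with `L` the projection of `G` to the last `e - f` coordinates, a
subdirect product in `G_{f+1} × ⋯ × G_e`). -/
theorem subdirect_product_splits_off_large_simple_factors
    {e : ℕ} (Gs : Fin e → Type*) [∀ i, Group (Gs i)] [∀ i, Finite (Gs i)]
    (G : Subgroup (∀ i, Gs i))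
    (hsub : ∀ i, ∀ a : Gs i, ∃ g ∈ G, g i = a)
    (f : ℕ) (hf1 : 1 < f) (hfe : f < e)
    (hsimple : ∀ i : Fin e, (i : ℕ) < f → IsSimpleGroup (Gs i))
    (hnonab : ∀ i : Fin e, (i : ℕ) < f → ¬ ∀ a b : Gs i, a * b = b * a)
    (hsmall : ∀ i j : Fin e, (i : ℕ) < f → f ≤ (j : ℕ) →
      Nat.card (Gs j) < Nat.card (Gs i))
    (hnotdvd : ∀ i : Fin e, (i : ℕ) < f → ¬ (Nat.card (Gs i) ∣ G.index)) :
    (∀ x : ∀ i, Gs i, (∀ j : Fin e, f ≤ (j : ℕ) → x j = 1) → x ∈ G) ∧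
      (∀ x y : ∀ i, Gs i, (∀ j : Fin e, f ≤ (j : ℕ) → x j = y j) → (x ∈ G ↔ y ∈ G)) := by
  have hsingle : ∀ (i : Fin e) (a : Gs i), (i : ℕ) < f → Pi.mulSingle i a ∈ G := by
    intro i a hi
    have := hsimple i hi
    by_contra hmem
    obtain ⟨j, hji, hker⟩ : ∃ j, j ≠ i ∧ ∀ g ∈ G, g j = 1 → g i = 1 := by
      by_contra! h
      exact hmem (mulSingle_mem_of_forall_exists hsub (hnonab i hi) h a)
    rcases lt_or_ge (j : ℕ) f with _ | hj
    · exact hnotdvd i hi (card_dvd_index_of_coord_determined hsub hji hker)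
    · exact (hsmall i j hi hj).not_ge (card_le_card_of_coord_determined hsub hker)
  have hmem : ∀ x : ∀ i, Gs i, (∀ j : Fin e, f ≤ (j : ℕ) → x j = 1) → x ∈ G := by
    intro x hx
    refine Subgroup.pi_mem_of_mulSingle_mem x fun i => ?_
    rcases lt_or_ge (i : ℕ) f with hi | hi
    · exact hsingle i (x i) hi
    · rw [hx i hi, Pi.mulSingle_one]
      exact G.one_mem
  refine ⟨hmem, fun x y hxy => ?_⟩
  have hdiv : x * y⁻¹ ∈ G := hmem _ fun j hj => by simp [hxy j hj]
  constructor
  · intro hx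
    simpa using G.mul_mem (G.inv_mem hdiv) hx
  · intro hy
    simpa using G.mul_mem hdiv hy
end

section
/- Let n ≥ 5 and let M be a maximal subgroup of the alternating group Alt_n whose index [Alt_n : M] has the form 2^a·3^b·5^c with a ≥ 0 and 0 ≤ b, c ≤ 1. If there exists a prime dividing |Alt_n| that does not divide |M|, then n ≤ 9. -/
open MulAction in
/-- A group of odd order never interchanges two distinct points. -/
theorem MulAction.eq_of_odd_card_of_smul_swap {G X : Type*} [Group G] [MulAction G X]
    (hodd : Odd (Nat.card G)) {g : G} {x y : X} (hxy : g • x = y) (hyx : g • y = x) : x = y := by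
  obtain ⟨k, hk⟩ := hodd
  have hsq : g ^ 2 ∈ stabilizer G x := by
    rw [mem_stabilizer_iff, pow_two, mul_smul, hxy, hyx]
  have hpow : (g ^ 2) ^ (k + 1) = g := by
    rw [← pow_mul, show 2 * (k + 1) = Nat.card G + 1 by omega, pow_succ, pow_card_eq_one', one_mul]
  have hg : g ∈ stabilizer G x := hpow ▸ pow_mem hsq (k + 1)
  rw [← hxy, mem_stabilizer_iff.1 hg]

open MulAction in
/-- In a transitive group of odd order, every nontrivial suborbit has at most half the size
of the complement of the base point. -/
theorem MulAction.two_mul_card_orbit_lt_card_of_odd {G Y : Type*} [Group G] [MulAction G Y]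
    [IsPretransitive G Y] [Finite Y] (hodd : Odd (Nat.card G)) {H : Subgroup G} {x y : Y}
    (hx : x ∈ fixedPoints H Y) (hxy : x ≠ y) :
    2 * Nat.card (orbit H y) < Nat.card Y := by
  classical
  have := Fintype.ofFinite Y
  choose t ht using fun z : Y => exists_smul_eq G x z
  let A : Finset (Y × Y) := (orbit G (x, y)).toFinset
  let B : Finset (Y × Y) := (orbit G (y, x)).toFinset
  have hBA : B = A.image Prod.swap := by
    ext ⟨u, v⟩
    simp [A, B, mem_orbit_iff, and_comm]
  have hcardB : B.card = A.card := by
    rw [hBA, Finset.card_image_of_injective _ Prod.swap_injective]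
  have hdisj : Disjoint A B := by
    rw [Finset.disjoint_left]
    rintro z hzA hzB
    simp only [A, B, Set.mem_toFinset] at hzA hzB
    have hmem : (y, x) ∈ orbit G (x, y) := by
      rw [← orbit_eq_iff, ← orbit_eq_iff.2 hzA, ← orbit_eq_iff.2 hzB]
    obtain ⟨g, hg⟩ := hmem
    simp only [Prod.smul_mk, Prod.mk.injEq] at hg
    exact hxy (eq_of_odd_card_of_smul_swap hodd hg.1 hg.2)
  have hsub : A ∪ B ⊆ Finset.univ.offDiag := by
    rintro ⟨u, v⟩ h
    simp only [A, B, Finset.mem_union, Set.mem_toFinset, mem_orbit_iff, Prod.smul_mk,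
      Prod.mk.injEq] at h
    simp only [Finset.mem_offDiag, Finset.mem_univ, true_and]
    rintro rfl
    rcases h with ⟨g, h₁, h₂⟩ | ⟨g, h₁, h₂⟩
    · exact hxy (smul_left_cancel g (h₁.trans h₂.symm))
    · exact hxy (smul_left_cancel g (h₂.trans h₁.symm))
  have hle : Nat.card Y * Nat.card (orbit H y) ≤ A.card := by
    rw [← Nat.card_prod, ← Nat.card_eq_card_toFinset (orbit G (x, y))]
    let f : Y × orbit H y → orbit G (x, y) := fun z =>
      ⟨(z.1, t z.1 • (z.2 : Y)), by
        obtain ⟨z, w, h, rfl⟩ := z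
        refine ⟨t z * h, ?_⟩
        have hfix : (h : G) • x = x := hx h
        simp only [Prod.smul_mk, mul_smul, hfix, ht]
        rfl⟩
    refine Nat.card_le_card_of_injective f ?_
    rintro ⟨z, w⟩ ⟨z', w'⟩ h
    simp only [f, Subtype.mk.injEq, Prod.mk.injEq] at h
    obtain ⟨rfl, h⟩ := h
    rw [Subtype.ext (smul_left_cancel _ h)]
  have hcard := Finset.card_le_card hsub
  rw [Finset.card_union_of_disjoint hdisj, hcardB, Finset.offDiag_card, Finset.card_univ,
    ← Nat.card_eq_fintype_card] at hcard
  have hpos : 0 < Nat.card Y := Nat.card_pos_iff.2 ⟨⟨x⟩, inferInstance⟩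
  have horb : 0 < Nat.card (orbit H y) := Nat.card_pos_iff.2 ⟨⟨⟨y, mem_orbit_self y⟩⟩, inferInstance⟩
  have hmul : Nat.card Y * (2 * Nat.card (orbit H y)) < Nat.card Y * Nat.card Y := by
    have := Nat.mul_pos hpos horb
    have := Nat.mul_pos hpos hpos
    rw [show Nat.card Y * (2 * Nat.card (orbit H y)) =
      2 * (Nat.card Y * Nat.card (orbit H y)) by ring]
    omega
  exact lt_of_mul_lt_mul_left hmul (Nat.zero_le _)

open MulAction in
/-- A `q`-subgroup of a transitive group of odd order and degree at most `2q` is either trivial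
on the points or has no fixed point. -/
theorem IsPGroup.dvd_card_of_odd_of_card_le {G Y : Type*} [Group G] [MulAction G Y]
    [IsPretransitive G Y] [Finite Y] (hodd : Odd (Nat.card G)) {q : ℕ} [Fact q.Prime]
    {Q : Subgroup G} (hQ : IsPGroup q Q) {y : Y} (hy : y ∉ fixedPoints Q Y)
    (hcard : Nat.card Y ≤ 2 * q) : q ∣ Nat.card Y := by
  by_contra hq
  obtain ⟨x, hx⟩ := hQ.nonempty_fixed_point_of_prime_not_dvd_card Y hq
  have hlt := two_mul_card_orbit_lt_card_of_odd hodd (y := y) hx (fun h => hy (h ▸ hx))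
  obtain ⟨k, hk⟩ := hQ.card_orbit y
  have hk0 : k ≠ 0 := by
    rintro rfl
    have := Fintype.ofFinite (orbit Q y)
    exact hy (mem_fixedPoints_iff_card_orbit_eq_one.2
      (by rw [← Nat.card_eq_fintype_card, hk, pow_zero]))
  have := Nat.le_self_pow hk0 q
  omega

open MulAction in
/-- Let `G` be a permutation group of odd order and degree `n`, and let `n / 2 < p` be a prime
dividing `|G|`. For a prime `q` with `p / 2 ≤ q < p`, the order of every `q`-subgroup of `G`
divides `(n - p)!`. -/
theorem IsPGroup.card_dvd_factorial_of_odd {G X : Type*} [Group G] [Finite G] [MulAction G X]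
    [FaithfulSMul G X] [Finite X] (hodd : Odd (Nat.card G)) {p q : ℕ} [Fact p.Prime]
    [Fact q.Prime] (hpG : p ∣ Nat.card G) (hXp : Nat.card X < 2 * p) (hqp : q < p)
    (hpq : p ≤ 2 * q) {Q : Subgroup G} (hQ : IsPGroup q Q) :
    Nat.card Q ∣ (Nat.card X - p).factorial := by
  obtain ⟨g, hg⟩ := exists_prime_orderOf_dvd_card' p hpG
  have hP : IsPGroup p (Subgroup.zpowers g) :=
    IsPGroup.of_card (n := 1) (by rw [Nat.card_zpowers, hg, pow_one])
  obtain ⟨x, hx⟩ : ∃ x : X, g • x ≠ x := by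
    by_contra! h
    have : g = 1 := FaithfulSMul.eq_of_smul_eq_smul (α := X) fun x => by rw [h, one_smul]
    rw [this, orderOf_one] at hg
    exact (Fact.out : p.Prime).one_lt.ne hg
  have hle : Nat.card (orbit G x) ≤ Nat.card X := Finite.card_subtype_le _
  have hpO : p ∣ Nat.card (orbit G x) :=
    hP.dvd_card_of_odd_of_card_le hodd (y := ⟨x, mem_orbit_self x⟩)
      (fun h => hx (congrArg Subtype.val (h ⟨g, Subgroup.mem_zpowers g⟩))) (by omega)
  have hO : Nat.card (orbit G x) = p := by
    obtain ⟨k, hk⟩ := hpO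
    have hpos : 0 < Nat.card (orbit G x) :=
      Nat.card_pos_iff.2 ⟨⟨⟨x, mem_orbit_self x⟩⟩, inferInstance⟩
    have hk2 : k < 2 := by
      by_contra! h
      nlinarith
    interval_cases k <;> omega
  have hfix : ∀ (h : Q) (y : X), y ∈ orbit G x → h • y = y := by
    intro h y hy
    by_contra hne
    have hdvd : q ∣ Nat.card (orbit G x) :=
      hQ.dvd_card_of_odd_of_card_le hodd (y := ⟨y, hy⟩)
        (fun hf => hne (congrArg Subtype.val (hf h))) (hO.trans_le hpq)
    rw [hO, Nat.prime_dvd_prime_iff_eq Fact.out Fact.out] at hdvd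
    omega
  let s : SubMulAction Q X :=
    { carrier := (orbit G x)ᶜ
      smul_mem' := fun h y hy hmem => hy <|
        inv_smul_smul (h : G) y ▸ mapsTo_smul_orbit (h : G)⁻¹ x hmem }
  have hinj : Function.Injective (toPermHom Q s) := by
    rw [injective_iff_map_eq_one]
    intro h hh
    refine Subtype.ext (FaithfulSMul.eq_of_smul_eq_smul (α := X) fun y => ?_)
    rw [Subgroup.coe_one, one_smul]
    by_cases hy : y ∈ orbit G x
    · exact hfix h y hy
    · exact congrArg Subtype.val (DFunLike.congr_fun hh (⟨y, hy⟩ : s))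
  have hcard : Nat.card s = Nat.card X - p := by
    rw [← hO]
    exact Set.ncard_compl (orbit G x)
  rw [← hcard, ← Nat.card_perm]
  exact Subgroup.card_dvd_of_injective _ hinj

/-- A consequence of Bertrand's postulate used to select two suitable primes below `n`. -/
theorem Nat.exists_two_primes_of_eleven_le {n : ℕ} (hn : 11 ≤ n) :
    ∃ p q : ℕ, p.Prime ∧ q.Prime ∧ n < 2 * p ∧ p ≤ n ∧ 7 ≤ q ∧ q < p ∧ p ≤ 2 * q := by
  obtain ⟨p, hp, hp11, hnp, hpn⟩ : ∃ p : ℕ, p.Prime ∧ 11 ≤ p ∧ n < 2 * p ∧ p ≤ n := by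
    by_cases h : n < 14
    · exact ⟨11, by norm_num, le_rfl, by omega, hn⟩
    · obtain ⟨p, hp, h₁, h₂⟩ := Nat.exists_prime_lt_and_le_two_mul (n / 2) (by omega)
      refine ⟨p, hp, ?_, by omega, by omega⟩
      by_contra! hlt
      have : 7 < p := by omega
      interval_cases p <;> revert hp <;> decide
  obtain ⟨q, hq, h₁, h₂⟩ := Nat.exists_prime_lt_and_le_two_mul ((p - 1) / 2) (by omega)
  refine ⟨p, q, hp, hq, hnp, hpn, ?_, by omega, by omega⟩
  by_contra! hlt
  have : q = 6 := by omega
  subst this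
  revert hq
  decide

/-- Let `G` be a permutation group of odd order and degree `n` with `|G| * k = n!`. If `p > n / 2`
is a prime not dividing `k` and `q` is a prime with `p / 2 ≤ q < p`, then `k` is divisible by every
power of `q` dividing `n! / (n - p)!`. -/
theorem Nat.pow_dvd_of_odd_perm {G X : Type*} [Group G] [Finite G] [MulAction G X]
    [FaithfulSMul G X] [Finite X] (hodd : Odd (Nat.card G)) {p q : ℕ} (hp : p.Prime)
    (hq : q.Prime) (hpX : p ≤ Nat.card X) (hXp : Nat.card X < 2 * p) (hqp : q < p)
    (hpq : p ≤ 2 * q) {k e : ℕ} (hk : Nat.card G * k = (Nat.card X).factorial) (hpk : ¬ p ∣ k)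
    (he : q ^ e * (Nat.card X - p).factorial ∣ (Nat.card X).factorial) : q ^ e ∣ k := by
  have := Fact.mk hp
  have := Fact.mk hq
  have hpG : p ∣ Nat.card G :=
    (hp.dvd_mul.1 (hk ▸ hp.dvd_factorial.2 hpX)).resolve_right hpk
  obtain ⟨Q⟩ : Nonempty (Sylow q G) := inferInstance
  have hQ := Q.isPGroup'.card_dvd_factorial_of_odd (X := X) hodd hpG hXp hqp hpq
  have hdvd := (Nat.mul_dvd_mul_left (q ^ e) hQ).trans he
  rw [← hk, ← Subgroup.card_mul_index (Q : Subgroup G), mul_comm, mul_assoc] at hdvd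
  have hdvd' := Nat.dvd_of_mul_dvd_mul_left Nat.card_pos hdvd
  exact (((Nat.Prime.coprime_iff_not_dvd hq).2 Q.not_dvd_index).pow_left e).dvd_of_dvd_mul_left
    hdvd'

/-- If `M` is a maximal subgroup of `Alt_n` (`n ≥ 5`) of index of the form `2^a·3^b·5^c`
with `b, c ≤ 1`, and some prime divides `|Alt_n|` but not `|M|`, then `n ≤ 9`. -/
theorem alternating_maximal_subgroup_small_index_missing_prime
    (n : ℕ) (hn : 5 ≤ n) (M : Subgroup (alternatingGroup (Fin n)))
    (hmax : IsCoatom M)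
    (a b c : ℕ) (hb : b ≤ 1) (hc : c ≤ 1)
    (hidx : M.index = 2 ^ a * 3 ^ b * 5 ^ c)
    (hprime : ∃ p : ℕ, p.Prime ∧ p ∣ Nat.card (alternatingGroup (Fin n)) ∧
      ¬ p ∣ Nat.card M) :
    n ≤ 9 := by
  by_contra! hn10
  have : Nontrivial (Fin n) := Fin.nontrivial_iff_two_le.2 (by omega)
  have hfac : Nat.card M * (2 ^ (a + 1) * 3 ^ b * 5 ^ c) = n.factorial := by
    have h := two_mul_nat_card_alternatingGroup (α := Fin n)
    rw [Nat.card_perm, Nat.card_fin, ← M.card_mul_index, hidx] at h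
    rw [← h]
    ring
  have hprimes {r : ℕ} (hr : r.Prime) (h : r ∣ 2 ^ (a + 1) * 3 ^ b * 5 ^ c) :
      r = 2 ∨ r = 3 ∨ r = 5 := by
    rcases hr.dvd_mul.1 h with h | h
    · rcases hr.dvd_mul.1 h with h | h
      · exact .inl ((Nat.prime_dvd_prime_iff_eq hr Nat.prime_two).1 (hr.dvd_of_dvd_pow h))
      · exact .inr (.inl ((Nat.prime_dvd_prime_iff_eq hr Nat.prime_three).1 (hr.dvd_of_dvd_pow h)))
    · exact .inr (.inr ((Nat.prime_dvd_prime_iff_eq hr Nat.prime_five).1 (hr.dvd_of_dvd_pow h)))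
  have h9 : ¬ 3 ^ 2 ∣ 2 ^ (a + 1) * 3 ^ b * 5 ^ c := by
    intro h
    have h := (Nat.Coprime.pow 2 c (by norm_num : Nat.Coprime 3 5)).dvd_of_dvd_mul_right h
    have h := (Nat.Coprime.pow 2 (a + 1) (by norm_num : Nat.Coprime 3 2)).dvd_of_dvd_mul_left h
    have := (Nat.pow_dvd_pow_iff_le_right (by norm_num)).1 h
    omega
  have h25 : ¬ 5 ^ 2 ∣ 2 ^ (a + 1) * 3 ^ b * 5 ^ c := by
    intro h
    have h := Nat.Coprime.dvd_of_dvd_mul_left (Nat.Coprime.mul_right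
      (Nat.Coprime.pow 2 (a + 1) (by norm_num : Nat.Coprime 5 2))
      (Nat.Coprime.pow 2 b (by norm_num : Nat.Coprime 5 3))) h
    have := (Nat.pow_dvd_pow_iff_le_right (by norm_num)).1 h
    omega
  have hsq {r : ℕ} (hr : r.Prime) (hrM : ¬ r ∣ Nat.card M)
      (h : r ^ 2 ∣ Nat.factorial 10) : r ^ 2 ∣ 2 ^ (a + 1) * 3 ^ b * 5 ^ c :=
    (((Nat.Prime.coprime_iff_not_dvd hr).2 hrM).pow_left 2).dvd_of_dvd_mul_left
      (hfac ▸ h.trans (Nat.factorial_dvd_factorial hn10))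
  obtain ⟨r, hr, hrA, hrM⟩ := hprime
  rw [← M.card_mul_index, hidx] at hrA
  have hrk : r ∣ 2 ^ (a + 1) * 3 ^ b * 5 ^ c := by
    refine ((hr.dvd_mul.1 hrA).resolve_left hrM).trans ⟨2, by ring⟩
  rcases hprimes hr hrk with rfl | rfl | rfl
  · have hodd : Odd (Nat.card M) := by rwa [← Nat.not_even_iff_odd, even_iff_two_dvd]
    have key {p q e : ℕ} (hp : p.Prime) (hq : q.Prime) (hpn : p ≤ n) (hnp : n < 2 * p)
        (hqp : q < p) (hpq : p ≤ 2 * q) (hp7 : 7 ≤ p)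
        (he : q ^ e * (n - p).factorial ∣ n.factorial) :
        q ^ e ∣ 2 ^ (a + 1) * 3 ^ b * 5 ^ c := by
      have hX : Nat.card (Fin n) = n := Nat.card_fin n
      refine Nat.pow_dvd_of_odd_perm (X := Fin n) hodd hp hq (hX.symm ▸ hpn) (hX.symm ▸ hnp) hqp
        hpq (hX.symm ▸ hfac) (fun h => ?_) (hX.symm ▸ he)
      have := hprimes hp h
      omega
    rcases Nat.eq_or_lt_of_le hn10 with h10 | h11
    · refine h25 (key (p := 7) (by norm_num) (by norm_num) ?_ ?_ ?_ ?_ le_rfl ?_)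
      all_goals try omega
      rw [← h10]
      decide
    · obtain ⟨p, q, hp, hq, hnp, hpn, hq7, hqp, hpq⟩ := Nat.exists_two_primes_of_eleven_le h11
      have h := key (e := 1) hp hq hpn hnp hqp hpq (by omega) (by
        rw [pow_one]
        exact (Nat.mul_dvd_mul_right (hq.dvd_factorial.2 hqp.le) _).trans
          (Nat.factorial_mul_factorial_dvd_factorial hpn))
      rw [pow_one] at h
      have := hprimes hq h
      omega
  · exact h9 (hsq hr hrM (by decide))
  · exact h25 (hsq hr hrM (by decide))
end

section
/- Let p = 2^k − 1 be a Mersenne prime with p ≥ 7, and let T = PSL(2,p) := SL₂(ℤ/pℤ)/Z(SL₂(ℤ/pℤ)). If H is a proper subgroup of T whose index [T : H] has the form 2^a·3^b·5^c with a ≥ 0 and 0 ≤ b, c ≤ 1, then 2^a = p + 1; that is, [T : H] = (p+1)·3^b·5^c. -/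
open Matrix MatrixGroups

namespace Matrix.SpecialLinearGroup

section Field

variable {F : Type*} [Field F]

/-- The upper triangular matrices in `SL(2, F)`. -/
def upperTriangular (F : Type*) [Field F] : Subgroup SL(2, F) where
  carrier := {g | g 1 0 = 0}
  mul_mem' {g h} hg hh := by
    simp only [Set.mem_ofPred_eq] at hg hh ⊢
    simp [Matrix.mul_apply, Fin.sum_univ_two, hg, hh]
  one_mem' := by simp
  inv_mem' {g} hg := by
    simp only [Set.mem_ofPred_eq] at hg ⊢
    simp [SL2_inv_expl, hg]

lemma mem_upperTriangular {g : SL(2, F)} : g ∈ upperTriangular F ↔ g 1 0 = 0 := Iff.rfl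

lemma apply_zero_zero_mul_of_mem_upperTriangular {g : SL(2, F)} (hg : g ∈ upperTriangular F) :
    g 0 0 * g 1 1 = 1 := by
  have hdet := g.det_coe
  rw [Matrix.det_fin_two, mem_upperTriangular.1 hg] at hdet
  simpa using hdet

/-- An upper triangular matrix of determinant one is given by its first row. -/
def upperTriangularEquiv (F : Type*) [Field F] : upperTriangular F ≃ Fˣ × F where
  toFun g := (⟨g.1 0 0, g.1 1 1, apply_zero_zero_mul_of_mem_upperTriangular g.2,
    by rw [mul_comm]; exact apply_zero_zero_mul_of_mem_upperTriangular g.2⟩, g.1 0 1)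
  invFun x := ⟨⟨!![(x.1 : F), x.2; 0, ((x.1⁻¹ : Fˣ) : F)], by simp [Matrix.det_fin_two_of]⟩, rfl⟩
  left_inv g := by
    have h : g.1 1 0 = 0 := g.2
    ext i j
    fin_cases i <;> fin_cases j <;> simp [h]
  right_inv x := by
    ext <;> simp

lemma card_upperTriangular (F : Type*) [Field F] [Finite F] :
    Nat.card (upperTriangular F) = (Nat.card F - 1) * Nat.card F := by
  rw [Nat.card_congr (upperTriangularEquiv F), Nat.card_prod, Nat.card_units]

lemma transvection_one_zero_eq {h : SL(2, F)} (hc : h 1 0 ≠ 0) (t : F) :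
    transvection (one_ne_zero : (1 : Fin 2) ≠ 0) t =
      transvection zero_ne_one (-(h 0 0 / h 1 0)) *
        (h * transvection zero_ne_one (-(t / h 1 0 ^ 2)) * h⁻¹) *
        transvection zero_ne_one (h 0 0 / h 1 0) := by
  have hdet := h.det_coe
  rw [Matrix.det_fin_two] at hdet
  have hb : h 0 1 = (h 0 0 * h 1 1 - 1) / h 1 0 := by
    field_simp
    linear_combination -hdet
  ext i j
  fin_cases i <;> fin_cases j <;>
    simp only [coe_mul, coe_inv, adjugate_fin_two, transvection_coe] <;>
    simp [Matrix.mul_apply, Fin.sum_univ_two, hb] <;> field_simp <;> ring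

/-- A subgroup containing all upper unitriangular matrices and some matrix which is not upper
triangular is everything. -/
lemma eq_top_of_transvection_mem_of_not_le {K : Subgroup SL(2, F)}
    (hK : ∀ t : F, transvection (zero_ne_one : (0 : Fin 2) ≠ 1) t ∈ K)
    (hle : ¬ K ≤ upperTriangular F) : K = ⊤ := by
  obtain ⟨h, hh, hc⟩ := SetLike.not_le_iff_exists.1 hle
  refine (Subgroup.eq_top_iff' K).2 fun g ↦ SL2.transvection_induction (· ∈ K) (fun i j hij t ↦ ?_)
    (fun _ _ ↦ K.mul_mem) g
  fin_cases i <;> fin_cases j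
  · exact absurd rfl hij
  · exact hK t
  · change transvection (one_ne_zero : (1 : Fin 2) ≠ 0) t ∈ K
    rw [transvection_one_zero_eq hc]
    exact K.mul_mem (K.mul_mem (hK _) (K.mul_mem (K.mul_mem hh (hK _)) (K.inv_mem hh))) (hK _)
  · exact absurd rfl hij

/-- A matrix in `SL(2, F)` with eigenvalue `1` is conjugate to a transvection. -/
lemma exists_conj_eq_transvection {u : SL(2, F)}
    (hu : ((u : Matrix (Fin 2) (Fin 2) F) - 1).det = 0) :
    ∃ (g : SL(2, F)) (t : F), g⁻¹ * u * g = transvection zero_ne_one t := by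
  obtain ⟨v, hv0, hv⟩ := Matrix.exists_mulVec_eq_zero_iff.2 hu
  rw [Matrix.sub_mulVec, Matrix.one_mulVec, sub_eq_zero] at hv
  have hcop : IsCoprime (v 0) (v 1) := by
    by_cases h0 : v 0 = 0
    · have h1 : v 1 ≠ 0 := fun h1 ↦ hv0 (by ext i; fin_cases i <;> simp [h0, h1])
      exact ⟨0, (v 1)⁻¹, by simp [h1]⟩
    · exact ⟨(v 0)⁻¹, 0, by simp [h0]⟩
  obtain ⟨g, hg0, hg1⟩ := hcop.exists_SL2_col 0
  have e0 := congrFun hv 0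
  have e1 := congrFun hv 1
  simp only [Matrix.mulVec, dotProduct, Fin.sum_univ_two, ← hg0, ← hg1] at e0 e1
  have hdg := g.det_coe
  rw [Matrix.det_fin_two] at hdg
  obtain ⟨w, hw⟩ : ∃ w, w = g⁻¹ * u * g := ⟨_, rfl⟩
  have h00 : w 0 0 = 1 := by
    simp only [hw, coe_mul, coe_inv, adjugate_fin_two]
    simp [Matrix.vecMul, dotProduct, Matrix.mul_apply, Fin.sum_univ_two]
    linear_combination g 1 1 * e0 - g 0 1 * e1 + hdg
  have h10 : w 1 0 = 0 := by
    simp only [hw, coe_mul, coe_inv, adjugate_fin_two]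
    simp [Matrix.vecMul, dotProduct, Matrix.mul_apply, Fin.sum_univ_two]
    linear_combination - g 1 0 * e0 + g 0 0 * e1
  have h11 : w 1 1 = 1 := by
    simpa [h00] using apply_zero_zero_mul_of_mem_upperTriangular (mem_upperTriangular.2 h10)
  refine ⟨g, w 0 1, ?_⟩
  rw [← hw]
  ext i j
  fin_cases i <;> fin_cases j <;> simp [transvection_coe, h00, h10, h11]

end Field

lemma card_mul_card_units {n F : Type*} [Fintype n] [DecidableEq n] [Nonempty n] [CommRing F] :
    Nat.card (SpecialLinearGroup n F) * Nat.card Fˣ = Nat.card (GL n F) := by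
  have hrange : (toGL : SpecialLinearGroup n F →* GL n F).range =
      (GeneralLinearGroup.det : GL n F →* Fˣ).ker := by
    ext x
    rw [MonoidHom.mem_ker, MonoidHom.mem_range]
    exact Set.ext_iff.1 range_toGL x
  rw [Nat.card_congr (MonoidHom.ofInjective (toGL_injective (n := n) (R := F))).toEquiv, hrange,
    ← (GeneralLinearGroup.det : GL n F →* Fˣ).ker.card_mul_index, Subgroup.index_ker,
    MonoidHom.range_eq_top.2 GeneralLinearGroup.det_surjective, Subgroup.card_top]

lemma card_fin_two {F : Type*} [Field F] [Finite F] :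
    Nat.card SL(2, F) = Nat.card F * (Nat.card F - 1) * (Nat.card F + 1) := by
  have := Fintype.ofFinite F
  have hcard := card_mul_card_units (n := Fin 2) (F := F)
  rw [Matrix.card_GL_field, Nat.card_units, Fin.prod_univ_two, ← Nat.card_eq_fintype_card] at hcard
  have hq : 1 < Nat.card F := Finite.one_lt_card
  obtain ⟨m, hm⟩ : ∃ m, Nat.card F = m + 2 := ⟨Nat.card F - 2, by omega⟩
  rw [hm] at hcard ⊢
  have h1 : (m + 2) ^ 2 - (m + 2) ^ ((0 : Fin 2) : ℕ) = (m + 1) * (m + 3) := by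
    simp only [Fin.val_zero, pow_zero]
    exact Nat.sub_eq_of_eq_add (by ring)
  have h2 : (m + 2) ^ 2 - (m + 2) ^ ((1 : Fin 2) : ℕ) = (m + 2) * (m + 1) := by
    simp only [Fin.val_one, pow_one]
    exact Nat.sub_eq_of_eq_add (by ring)
  rw [h1, h2] at hcard
  rw [show m + 2 - 1 = m + 1 from rfl] at hcard ⊢
  refine Nat.eq_of_mul_eq_mul_right (Nat.add_pos_right m one_pos) (hcard.trans ?_)
  ring

section ZMod

variable {p : ℕ} [Fact p.Prime]

lemma transvection_mem_of_mem {n : Type*} [Fintype n] [DecidableEq n] {i j : n} (hij : i ≠ j)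
    {K : Subgroup (SpecialLinearGroup n (ZMod p))} {t : ZMod p} (ht : t ≠ 0)
    (hK : transvection hij t ∈ K) (s : ZMod p) : transvection hij s ∈ K := by
  have hmul (m : ℕ) : transvection hij (m * t) = transvection hij t ^ m := by
    induction m with
    | zero => simp
    | succ m ih => rw [pow_succ, ← ih, ← transvection_add]; push_cast; ring_nf
  have hs : s = ((s / t).val : ZMod p) * t := by
    rw [ZMod.natCast_zmod_val, div_mul_cancel₀ _ ht]
  rw [hs, hmul]
  exact K.pow_mem hK _

lemma det_sub_one_eq_zero_of_pow_eq_one {n : Type*} [Fintype n] [DecidableEq n] [Nonempty n]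
    {u : SpecialLinearGroup n (ZMod p)} (hu : u ^ p = 1) :
    ((u : Matrix n n (ZMod p)) - 1).det = 0 := by
  have hpow : ((u : Matrix n n (ZMod p)) - 1) ^ p = 0 := by
    rw [sub_pow_char_of_commute p (Commute.one_right _), ← coe_pow, hu]
    simp
  refine eq_zero_of_pow_eq_zero (n := p) ?_
  rw [← Matrix.det_pow, hpow, Matrix.det_zero]

/-- A proper subgroup of `SL(2, p)` of order divisible by `p` is conjugate to a subgroup of the
upper triangular matrices, so its order divides `(p - 1) * p`. -/
lemma card_dvd_of_dvd_card {K : Subgroup SL(2, ZMod p)} (hK : K ≠ ⊤) (hdvd : p ∣ Nat.card K) :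
    Nat.card K ∣ (p - 1) * p := by
  obtain ⟨u, hu⟩ := exists_prime_orderOf_dvd_card' p hdvd
  have hup : (u : SL(2, ZMod p)) ^ p = 1 := by
    rw [← Subgroup.coe_pow, orderOf_dvd_iff_pow_eq_one.1 hu.dvd, Subgroup.coe_one]
  have hdet := det_sub_one_eq_zero_of_pow_eq_one hup
  obtain ⟨g, t, hg⟩ := exists_conj_eq_transvection hdet
  have ht : t ≠ 0 := by
    rintro rfl
    rw [transvection_coeff_zero, mul_eq_one_iff_eq_inv, mul_eq_left, OneMemClass.coe_eq_one] at hg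
    rw [hg, orderOf_one] at hu
    exact (Fact.out : p.Prime).one_lt.ne hu
  let e := MulAut.conj g⁻¹
  have hmem : transvection (zero_ne_one : (0 : Fin 2) ≠ 1) t ∈ K.map e.toMonoidHom :=
    ⟨u, u.2, by simpa [e] using hg⟩
  have hle : K.map e.toMonoidHom ≤ upperTriangular (ZMod p) := by
    by_contra hle
    have hall := transvection_mem_of_mem zero_ne_one ht hmem
    have htop := eq_top_of_transvection_mem_of_not_le hall hle
    refine hK (Subgroup.map_injective e.injective (htop.trans ?_))
    exact (Subgroup.map_top_of_surjective _ e.surjective).symm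
  rw [Nat.card_congr (K.equivMapOfInjective e.toMonoidHom e.injective).toEquiv]
  simpa [card_upperTriangular] using Subgroup.card_dvd_of_le hle

end ZMod

end Matrix.SpecialLinearGroup

open Matrix.SpecialLinearGroup

/-- Let `p = 2^k − 1` be a Mersenne prime with `p ≥ 7` and `T = PSL(2,p)`. If `H` is a
proper subgroup of `T` of index `2^a·3^b·5^c` with `b, c ≤ 1`, then `2^a = p + 1`. -/
theorem psl_two_mersenne_proper_subgroup_index
    (p k : ℕ) (hp : p.Prime) (hmersenne : p = 2 ^ k - 1) (hp7 : 7 ≤ p)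
    (H : Subgroup (Matrix.SpecialLinearGroup (Fin 2) (ZMod p) ⧸
      Subgroup.center (Matrix.SpecialLinearGroup (Fin 2) (ZMod p))))
    (hH : H ≠ ⊤)
    (a b c : ℕ) (hb : b ≤ 1) (hc : c ≤ 1)
    (hidx : H.index = 2 ^ a * 3 ^ b * 5 ^ c) :
    2 ^ a = p + 1 := by
  have := Fact.mk hp
  have hsurj := QuotientGroup.mk'_surjective (Subgroup.center SL(2, ZMod p))
  set K := H.comap (QuotientGroup.mk' (Subgroup.center SL(2, ZMod p))) with hKdef
  have hKtop : K ≠ ⊤ := fun h ↦ hH <| by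
    rw [← Subgroup.index_eq_one] at h ⊢
    rwa [← Subgroup.index_comap_of_surjective H hsurj]
  have hcard : Nat.card K * (2 ^ a * 3 ^ b * 5 ^ c) = p * (p - 1) * (p + 1) := by
    rw [← hidx, ← Subgroup.index_comap_of_surjective H hsurj, Subgroup.card_mul_index,
      card_fin_two, Nat.card_zmod]
  have hpdvd : p ∣ Nat.card K := by
    have h2 : ¬ p ∣ 2 := fun h ↦ by have := Nat.le_of_dvd two_pos h; omega
    have h3 : ¬ p ∣ 3 := fun h ↦ by have := Nat.le_of_dvd three_pos h; omega
    have h5 : ¬ p ∣ 5 := fun h ↦ by have := Nat.le_of_dvd (by norm_num) h; omega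
    have hdvd : p ∣ Nat.card K * (2 ^ a * 3 ^ b * 5 ^ c) := by
      rw [hcard, mul_assoc]
      exact dvd_mul_right _ _
    rcases hp.dvd_mul.1 hdvd with h | h
    · exact h
    · rcases hp.dvd_mul.1 h with h | h
      · rcases hp.dvd_mul.1 h with h | h
        · exact absurd (hp.dvd_of_dvd_pow h) h2
        · exact absurd (hp.dvd_of_dvd_pow h) h3
      · exact absurd (hp.dvd_of_dvd_pow h) h5
  have hKdvd := card_dvd_of_dvd_card hKtop hpdvd
  have hKeven : 2 ∣ Nat.card K := by
    have hneg : (-1 : SL(2, ZMod p)) ∈ K := by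
      rw [hKdef, Subgroup.mem_comap]
      convert H.one_mem
      rw [← MonoidHom.mem_ker, QuotientGroup.ker_mk', Subgroup.mem_center_iff]
      simp
    have hne : (⟨-1, hneg⟩ : K) ≠ 1 := fun h ↦ by
      have h00 := congrArg (fun g : K ↦ g.1 0 0) h
      have : Fact (2 < p) := ⟨by omega⟩
      exact ZMod.neg_one_ne_one (by simpa using h00)
    exact (orderOf_eq_prime (p := 2) (Subtype.ext (by simp)) hne).symm.dvd.trans
      (orderOf_dvd_natCard _)
  obtain ⟨t, ht⟩ := hKeven
  have hpk : p + 1 = 2 ^ k := by omega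
  obtain ⟨l, rfl⟩ : ∃ l, k = l + 2 := by
    refine ⟨k - 2, ?_⟩
    rcases k with _ | _ | k
    · omega
    · omega
    · rfl
  obtain ⟨m, hm⟩ : ∃ m, m + 1 = 2 ^ (l + 1) :=
    ⟨2 ^ (l + 1) - 1, Nat.sub_add_cancel Nat.one_le_two_pow⟩
  have hpm : p - 1 = 2 * m := by
    have h : p + 1 = (m + 1) * 2 := by rw [hpk, hm, ← pow_succ]
    omega
  have hmodd : Odd m := by
    have := pow_succ 2 l
    rw [Nat.odd_iff]
    omega
  have hpodd : Odd p := hp.odd_of_ne_two (by omega)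
  rw [ht, hpm, mul_assoc, Nat.mul_dvd_mul_iff_left two_pos] at hKdvd
  have htodd : Odd t := (hmodd.mul hpodd).of_dvd_nat hKdvd
  rw [hpk]
  have heq : 2 ^ a * (t * 3 ^ b * 5 ^ c) = 2 ^ (l + 2) * (m * p) := by
    rw [ht, hpm, hpk] at hcard
    linarith
  have hodd : Odd (t * 3 ^ b * 5 ^ c) :=
    (htodd.mul (Odd.pow (by decide))).mul (Odd.pow (by decide))
  refine Nat.dvd_antisymm ?_ ?_
  · exact (Nat.Coprime.pow_left a (Nat.coprime_two_left.2 (hmodd.mul hpodd))).dvd_of_dvd_mul_right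
      (heq ▸ dvd_mul_right _ _)
  · exact (Nat.Coprime.pow_left _ (Nat.coprime_two_left.2 hodd)).dvd_of_dvd_mul_right
      (heq ▸ dvd_mul_right _ _)
end
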